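/- Assume GRH. There is a constant C > 0 such that for all real x ≥ 2 and R ≥ 2 and integers q, h, a with 1 ≤ q ≤ h ≤ x, qR ≤ x and gcd(a,q) = 1, the quantity S = Σ_{0 < k ≤ h, q | k} Σ_{x < n ≤ 2x+h−k, n ≡ a (mod q)} [Λ(n)·λ_R(n+k) + Λ(n+k)·λ_R(n)]·f(n,x,h−k) satisfies |S − xh²/φ(q)² + (xh/φ(q))·log(h/q)| ≤ C·( (xh/φ(q))·(log log 3q)³ + (xh²·d(q)/(φ(q)²·R))·log(2h/q) + x^{1/2}·h^{3/2}·R·(log x)²/q^{1/2} + x^{1/2}·h²·R^{1/2}·(log x)²/q ). -/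

import Mathlib

open Finset ArithmeticFunction

/-- The Generalized Riemann Hypothesis for Dirichlet L-functions: every zero of a
Dirichlet L-function in the critical strip lies on the critical line. -/
def GRH : Prop :=
  ∀ (N : ℕ) [NeZero N] (χ : DirichletCharacter ℂ N) (s : ℂ),
    DirichletCharacter.LFunction χ s = 0 → 0 < s.re → s.re < 1 → s.re = 1 / 2

/-- `ψ(x; q, a) = ∑_{n ≤ x, n ≡ a (mod q)} Λ(n)`. -/
noncomputable def psi (x : ℝ) (q a : ℕ) : ℝ :=
  ∑ n ∈ (Finset.Icc 1 ⌊x⌋₊).filter (fun n : ℕ => (n : ZMod q) = (a : ZMod q)),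
    ArithmeticFunction.vonMangoldt n

/-- `I(x,h,q,a) = ∫_x^{2x} (ψ(y+h;q,a) − ψ(y;q,a) − h/φ(q))² dy`. -/
noncomputable def momentI (x h : ℝ) (q a : ℕ) : ℝ :=
  ∫ y in x..(2 * x), (psi (y + h) q a - psi y q a - h / (q.totient : ℝ)) ^ 2

/-- `λ_R(n) = ∑_{r ≤ R} (μ²(r)/φ(r)) ∑_{d ∣ (r,n)} d·μ(d)`. -/
noncomputable def lamR (R : ℝ) (n : ℕ) : ℝ :=
  ∑ r ∈ Finset.Icc 1 ⌊R⌋₊,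
    ((ArithmeticFunction.moebius r : ℝ) ^ 2 / (r.totient : ℝ)) *
      ∑ d ∈ (Nat.gcd r n).divisors, (d : ℝ) * (ArithmeticFunction.moebius d : ℝ)

/-- `c = γ + ∑_p (log p)/(p(p−1))`. -/
noncomputable def cGY : ℝ :=
  Real.eulerMascheroniConstant +
    ∑' p : Nat.Primes, Real.log (p : ℕ) / (((p : ℕ) : ℝ) * (((p : ℕ) : ℝ) - 1))

/-- `v(k) = ∑_{p ∣ k} (log p)/p`. -/
noncomputable def vGY (k : ℕ) : ℝ := ∑ p ∈ k.primeFactors, Real.log p / (p : ℝ)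

/-- `w(k) = ∏_{p ∣ k} (1 + 1/√p)`. -/
noncomputable def wGY (k : ℕ) : ℝ := ∏ p ∈ k.primeFactors, (1 + 1 / Real.sqrt p)

/-- `g(k) = ∏_{p ∣ k} (1 + p/(p−1))`. -/
noncomputable def gGY (k : ℕ) : ℝ := ∏ p ∈ k.primeFactors, (1 + (p : ℝ) / ((p : ℝ) - 1))

/-- The twin prime constant `C = ∏_{p > 2} (1 − 1/(p−1)²)`. -/
noncomputable def twinC : ℝ :=
  ∏' p : Nat.Primes, (if 2 < (p : ℕ) then 1 - 1 / (((p : ℕ) : ℝ) - 1) ^ 2 else 1)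

/-- The singular series `𝔖(k)`. -/
noncomputable def singSeries (k : ℕ) : ℝ :=
  if 2 ∣ k ∧ k ≠ 0 then
    2 * twinC * ∏ p ∈ k.primeFactors.filter (fun p => 2 < p), ((p : ℝ) - 1) / ((p : ℝ) - 2)
  else 0

/-- `f(n,x,h)`, the length of the interval `[x,2x] ∩ [n−h,n)`. -/
noncomputable def flen (n : ℕ) (x h : ℝ) : ℝ :=
  if x ≤ n ∧ (n : ℝ) < x + h then (n : ℝ) - x
  else if x + h ≤ n ∧ (n : ℝ) ≤ 2 * x then h
  else if 2 * x < n ∧ (n : ℝ) ≤ 2 * x + h then 2 * x - n + h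
  else 0

/-- Blaschke-modified quotient. -/
noncomputable def blG (g : ℂ → ℂ) (r3 : ℝ) {n : ℕ} (ρ : Fin n → ℂ) (z : ℂ) : ℂ :=
  g z * ∏ i, (((r3 : ℂ) ^ 2 - (starRingEnd ℂ) (ρ i) * z) / r3)

theorem blG_diff {g : ℂ → ℂ} (hg : Differentiable ℂ g) (r3 : ℝ) {n : ℕ} (ρ : Fin n → ℂ) :
    Differentiable ℂ (blG g r3 ρ) := by
  unfold blG
  fun_prop

theorem blG_sphere (f g : ℂ → ℂ) (r3 : ℝ) (hr3 : 0 < r3) {n : ℕ} (ρ : Fin n → ℂ)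
    (hf : ∀ z, f z = (∏ i, (z - ρ i)) * g z) (z : ℂ) (hz : ‖z‖ = r3) :
    ‖blG g r3 ρ z‖ = ‖f z‖ := by
  rw [hf, blG, norm_mul, norm_mul, mul_comm]
  congr 1
  rw [norm_prod, norm_prod]
  apply Finset.prod_congr rfl
  intro i _
  have h1 : ((r3 : ℂ) ^ 2 - (starRingEnd ℂ) (ρ i) * z) = (starRingEnd ℂ) (z - ρ i) * z := by
    rw [map_sub, sub_mul, mul_comm ((starRingEnd ℂ) z) z, Complex.mul_conj, Complex.normSq_eq_norm_sq, hz]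
    push_cast; ring
  rw [h1, norm_div, norm_mul, RCLike.norm_conj, hz, Complex.norm_real, Real.norm_of_nonneg hr3.le]
  field_simp

theorem blG_le (f g : ℂ → ℂ) (hg : Differentiable ℂ g) (r3 : ℝ) (hr3 : 0 < r3) {n : ℕ} (ρ : Fin n → ℂ)
    (hf : ∀ z, f z = (∏ i, (z - ρ i)) * g z) (M : ℝ) (hM : ∀ z, ‖z‖ ≤ r3 → ‖f z‖ ≤ M)
    (z : ℂ) (hz : ‖z‖ ≤ r3) :
    ‖blG g r3 ρ z‖ ≤ M := by
  have hb : Bornology.IsBounded (Metric.ball (0 : ℂ) r3) := Metric.isBounded_ball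
  apply Complex.norm_le_of_forall_mem_frontier_norm_le hb (blG_diff hg r3 ρ).diffContOnCl
  · intro w hw
    rw [frontier_ball _ hr3.ne'] at hw
    have hw' : ‖w‖ = r3 := by simpa using hw
    rw [blG_sphere f g r3 hr3 ρ hf w hw']
    exact hM w hw'.le
  · rw [closure_ball _ hr3.ne']
    simpa using hz

theorem blG_zero (g : ℂ → ℂ) (r3 : ℝ) (hr3 : 0 < r3) {n : ℕ} (ρ : Fin n → ℂ) :
    ‖blG g r3 ρ 0‖ = ‖g 0‖ * r3 ^ n := by
  rw [blG, norm_mul]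
  congr 1
  have : ∀ i ∈ (Finset.univ : Finset (Fin n)), (((r3 : ℂ) ^ 2 - (starRingEnd ℂ) (ρ i) * 0) / r3) = (r3 : ℂ) := by
    intro i _
    have : (r3 : ℂ) ≠ 0 := by exact_mod_cast hr3.ne'
    field_simp
    ring
  rw [Finset.prod_congr rfl this]
  simp [abs_of_pos hr3]

theorem f_zero_le (f g : ℂ → ℂ) (r2 : ℝ) {n : ℕ} (ρ : Fin n → ℂ)
    (hρ : ∀ i, ‖ρ i‖ ≤ r2)
    (hf : ∀ z, f z = (∏ i, (z - ρ i)) * g z) : ‖f 0‖ ≤ ‖g 0‖ * r2 ^ n := by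
  rw [hf, norm_mul, mul_comm]
  gcongr
  rw [norm_prod]
  calc ∏ i, ‖0 - ρ i‖ ≤ ∏ i : Fin n, r2 := by
        apply Finset.prod_le_prod
        · intros; positivity
        · intro i _; simpa using hρ i
    _ = r2 ^ n := by simp

theorem zeros_count (f g : ℂ → ℂ) (hg : Differentiable ℂ g) (r2 r3 : ℝ) (hr2 : 0 < r2) (hr : r2 < r3)
    {n : ℕ} (ρ : Fin n → ℂ) (hρ : ∀ i, ‖ρ i‖ ≤ r2)
    (hf : ∀ z, f z = (∏ i, (z - ρ i)) * g z) (B : ℝ) (h0 : f 0 ≠ 0)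
    (hM : ∀ z, ‖z‖ ≤ r3 → ‖f z‖ ≤ Real.exp B * ‖f 0‖) :
    n * Real.log (r3 / r2) ≤ B := by
  have hr3 : 0 < r3 := hr2.trans hr
  have h1 := blG_le f g hg r3 hr3 ρ hf _ hM 0 (by simpa using hr3.le)
  rw [blG_zero g r3 hr3] at h1
  have h2 := f_zero_le f g r2 ρ hρ hf
  have hf0 : 0 < ‖f 0‖ := norm_pos_iff.2 h0
  have h3 : ‖f 0‖ * (r3 / r2) ^ n ≤ Real.exp B * ‖f 0‖ := by
    calc ‖f 0‖ * (r3 / r2) ^ n ≤ (‖g 0‖ * r2 ^ n) * (r3 / r2) ^ n := by gcongr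
      _ = ‖g 0‖ * r3 ^ n := by rw [div_pow]; field_simp
      _ ≤ _ := h1
  have h4 : (r3 / r2) ^ n ≤ Real.exp B := by
    rw [mul_comm] at h3
    exact le_of_mul_le_mul_right h3 hf0
  have h5 := Real.log_le_log (by positivity) h4
  rwa [Real.log_pow, Real.log_exp] at h5

theorem zeros_max (f : ℂ → ℂ) (hfd : Differentiable ℂ f) (r2 r3 : ℝ) (hr2 : 0 < r2) (hr : r2 < r3)
    (B : ℝ) (h0 : f 0 ≠ 0) (hM : ∀ z, ‖z‖ ≤ r3 → ‖f z‖ ≤ Real.exp B * ‖f 0‖) :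
    ∃ (n : ℕ) (ρ : Fin n → ℂ) (g : ℂ → ℂ), Differentiable ℂ g ∧ (∀ i, ‖ρ i‖ ≤ r2) ∧
      (∀ z, f z = (∏ i, (z - ρ i)) * g z) ∧ (∀ z, ‖z‖ ≤ r2 → g z ≠ 0) := by
  classical
  let P : ℕ → Prop := fun n => ∃ (ρ : Fin n → ℂ) (g : ℂ → ℂ), Differentiable ℂ g ∧ (∀ i, ‖ρ i‖ ≤ r2) ∧
      (∀ z, f z = (∏ i, (z - ρ i)) * g z)
  have hlog : 0 < Real.log (r3 / r2) := Real.log_pos (by rw [lt_div_iff₀ hr2]; linarith)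
  have hbd : ∀ n, P n → n ≤ ⌈B / Real.log (r3 / r2)⌉₊ := by
    rintro n ⟨ρ, g, hg, hρ, hf⟩
    have := zeros_count f g hg r2 r3 hr2 hr ρ hρ hf B h0 hM
    have h2 : (n : ℝ) ≤ B / Real.log (r3 / r2) := by rwa [le_div_iff₀ hlog]
    exact_mod_cast h2.trans (Nat.le_ceil _)
  have hP0 : P 0 := ⟨fun i => i.elim0, f, hfd, fun i => i.elim0, by simp⟩
  set m := Nat.findGreatest P ⌈B / Real.log (r3 / r2)⌉₊ with hm
  have hPm : P m := Nat.findGreatest_spec (Nat.zero_le _) hP0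
  have hmax : ¬ P (m + 1) := by
    intro h
    have := Nat.le_findGreatest (hbd _ h) h
    omega
  obtain ⟨ρ, g, hg, hρ, hf⟩ := hPm
  refine ⟨m, ρ, g, hg, hρ, hf, ?_⟩
  intro w hw hgw
  apply hmax
  refine ⟨Fin.cons w ρ, dslope g w, ?_, ?_, ?_⟩
  · have := (Complex.differentiableOn_dslope (f := g) (c := w) (s := Set.univ) Filter.univ_mem).2 hg.differentiableOn
    exact differentiableOn_univ.1 this
  · intro i
    refine Fin.cases ?_ ?_ i
    · simpa using hw
    · intro j; simpa using hρ j
  · intro z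
    rw [Fin.prod_univ_succ, hf]
    have := sub_smul_dslope g w z
    simp only [smul_eq_mul, hgw, sub_zero] at this
    simp only [Fin.cons_zero, Fin.cons_succ]
    rw [← this]; ring

theorem logDeriv_bound_ball (G : ℂ → ℂ) (hG : Differentiable ℂ G) (B : ℝ) (hB : 0 < B)
    (hne : ∀ z, ‖z‖ ≤ 33/20 → G z ≠ 0)
    (hM : ∀ z, ‖z‖ ≤ 33/20 → ‖G z‖ ≤ Real.exp B * ‖G 0‖) (z : ℂ) (hz : ‖z‖ ≤ 8/5) :
    ‖logDeriv G z‖ ≤ 5200 * B := by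
  have hd : DifferentiableOn ℂ (logDeriv G) (Metric.ball 0 (33/20)) := by
    intro w hw
    have hw' : G w ≠ 0 := hne w (by simpa using (Metric.mem_ball.1 hw).le)
    have h1 : DifferentiableAt ℂ (deriv G) w := (hG.analyticAt w).deriv.differentiableAt
    exact (h1.div hG.differentiableAt hw').differentiableWithinAt
  have hex := DifferentiableOn.isExactOn_ball hd
  obtain ⟨H, hH0, hH⟩ := hex.with_val_at 0 0
  have hexp : ∀ w ∈ Metric.ball (0:ℂ) (33/20), Complex.exp (H w) * G 0 = G w := by
    have hconst : ∀ w ∈ Metric.ball (0:ℂ) (33/20), Complex.exp (-H w) * G w = Complex.exp (-H 0) * G 0 := by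
      intro w hw
      have hopen : IsOpen (Metric.ball (0:ℂ) (33/20)) := Metric.isOpen_ball
      apply hopen.is_const_of_deriv_eq_zero (convex_ball (0:ℂ) (33/20)).isPreconnected (𝕜 := ℂ)
        (f := fun w => Complex.exp (-H w) * G w) _ _ hw (by simp)
      · intro u hu
        exact ((((hH u hu).differentiableAt.neg).cexp).mul hG.differentiableAt).differentiableWithinAt
      · intro u hu
        have hne' : G u ≠ 0 := hne u (by simpa using (Metric.mem_ball.1 hu).le)
        have h2 := ((hH u hu).neg.cexp).mul (hG.differentiableAt (x := u)).hasDerivAt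
        have h3 := h2.deriv
        simp only [Pi.zero_apply]
        refine h3.trans ?_
        rw [logDeriv_apply]
        field_simp
        simp
    intro w hw
    have := hconst w hw
    rw [hH0, neg_zero, Complex.exp_zero, one_mul] at this
    rw [← this, ← mul_assoc, ← Complex.exp_add]
    simp
  have hre : Set.MapsTo H (Metric.ball 0 (33/20)) {z | z.re ≤ B} := by
    intro w hw
    have h1 := hexp w hw
    have h2 := hM w (by simpa using (Metric.mem_ball.1 hw).le)
    rw [← h1, norm_mul, Complex.norm_exp] at h2
    have h0 : 0 < ‖G 0‖ := norm_pos_iff.2 (hne 0 (by norm_num))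
    exact Real.exp_le_exp.1 (le_of_mul_le_mul_right h2 h0)
  have hHd : DifferentiableOn ℂ H (Metric.ball 0 (33/20)) := fun w hw => (hH w hw).differentiableAt.differentiableWithinAt
  have hHb : ∀ w, ‖w‖ ≤ 13/8 → ‖H w‖ ≤ 130 * B := by
    intro w hw
    have := Complex.borelCaratheodory_zero hB hHd hre (by norm_num) (z := w) (by simp; linarith) hH0
    refine this.trans ?_
    rw [div_le_iff₀ (by linarith)]
    nlinarith
  have hsub : Metric.closedBall z (1/40) ⊆ Metric.ball 0 (33/20) := by
    intro w hw
    have h1 : ‖w - z‖ ≤ 1/40 := by simpa [dist_eq_norm] using hw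
    have h2 : ‖w‖ ≤ ‖w - z‖ + ‖z‖ := by simpa using norm_add_le (w - z) z
    simp; linarith
  have hz' : z ∈ Metric.ball (0:ℂ) (33/20) := hsub (by simp)
  rw [← (hH z hz').deriv]
  have := Complex.norm_deriv_le_of_forall_mem_sphere_norm_le (c := z) (R := 1/40) (C := 130 * B) (f := H) (by norm_num)
    (hHd.mono hsub |>.diffContOnCl_ball subset_rfl) (by
      intro w hw
      apply hHb
      have h1 : ‖w - z‖ = 1/40 := by simpa [dist_eq_norm] using hw
      have h2 : ‖w‖ ≤ ‖w - z‖ + ‖z‖ := by simpa using norm_add_le (w - z) z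
      linarith)
  linarith

theorem zeros_lemma0 (f : ℂ → ℂ) (hfd : Differentiable ℂ f) 
    (B : ℝ) (hB : 0 < B) (h0 : f 0 ≠ 0) (hM : ∀ z, ‖z‖ ≤ 7/4 → ‖f z‖ ≤ Real.exp B * ‖f 0‖) :
    ∃ (n : ℕ) (ρ : Fin n → ℂ), (n : ℝ) ≤ 18 * B ∧ (∀ i, ‖ρ i‖ ≤ 33/20) ∧ (∀ i, f (ρ i) = 0) ∧
      ∀ z, ‖z‖ ≤ 8/5 → f z ≠ 0 → ‖logDeriv f z - ∑ i, 1 / (z - ρ i)‖ ≤ 6000 * B := by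
  obtain ⟨n, ρ, g, hg, hρ, hf, hgne⟩ := zeros_max f hfd (33/20) (7/4) (by norm_num) (by norm_num) B h0 hM
  have hcount := zeros_count f g hg (33/20) (7/4) (by norm_num) (by norm_num) ρ hρ hf B h0 hM
  have hlog : (1:ℝ)/18 ≤ Real.log (7/4/(33/20)) := by
    have := Real.one_sub_inv_le_log_of_pos (x := 7/4/(33/20)) (by norm_num)
    refine le_trans ?_ this
    norm_num
  have hn : (n : ℝ) ≤ 18 * B := by
    have : (n : ℝ) * (1/18) ≤ n * Real.log (7/4/(33/20)) := by gcongr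
    linarith
  refine ⟨n, ρ, hn, hρ, ?_, ?_⟩
  · intro i
    rw [hf]
    rw [Finset.prod_eq_zero (Finset.mem_univ i) (by simp)]
    simp
  intro z hz hfz
  have hlow : ∀ i, ∀ w : ℂ, ‖w‖ ≤ 33/20 → (1/4 : ℝ) ≤ ‖(((7/4 : ℝ) : ℂ) ^ 2 - (starRingEnd ℂ) (ρ i) * w)‖ := by
    intro i w hw
    have h1 : ‖(((7/4 : ℝ) : ℂ) ^ 2)‖ = 49/16 := by
      rw [norm_pow, Complex.norm_real]; norm_num
    have h2 : ‖(starRingEnd ℂ) (ρ i) * w‖ ≤ 33/20 * (33/20) := by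
      rw [norm_mul, RCLike.norm_conj]
      have := hρ i
      gcongr
    have h3 := norm_sub_norm_le (((7/4 : ℝ) : ℂ) ^ 2) ((starRingEnd ℂ) (ρ i) * w)
    linarith
  have hterm : ∀ i, ∀ w : ℂ, ‖w‖ ≤ 33/20 → (((7/4 : ℝ) : ℂ) ^ 2 - (starRingEnd ℂ) (ρ i) * w) / ((7/4 : ℝ) : ℂ) ≠ 0 := by
    intro i w hw
    apply div_ne_zero
    · intro h
      have := hlow i w hw
      rw [h] at this; norm_num at this
    · norm_num
  have hGne : ∀ w, ‖w‖ ≤ 33/20 → blG g (7/4) ρ w ≠ 0 := by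
    intro w hw
    rw [blG]
    exact mul_ne_zero (hgne w hw) (Finset.prod_ne_zero_iff.2 fun i _ => hterm i w hw)
  have hf0G : ‖f 0‖ ≤ ‖blG g (7/4) ρ 0‖ := by
    rw [blG_zero g _ (by norm_num)]
    refine (f_zero_le f g (33/20) ρ hρ hf).trans ?_
    exact mul_le_mul_of_nonneg_left (pow_le_pow_left₀ (by norm_num) (by norm_num) n) (norm_nonneg _)
  have hGb := logDeriv_bound_ball (blG g (7/4) ρ) (blG_diff hg _ _) B hB hGne (by
    intro w hw
    refine (blG_le f g hg (7/4) (by norm_num) ρ hf _ hM w (by linarith)).trans ?_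
    gcongr) z hz
  have hz' : ‖z‖ ≤ 33/20 := by linarith
  have hlG : logDeriv (blG g (7/4) ρ) z = logDeriv g z + ∑ i, (- (starRingEnd ℂ) (ρ i)) / (((7/4 : ℝ) : ℂ) ^ 2 - (starRingEnd ℂ) (ρ i) * z) := by
    unfold blG
    rw [logDeriv_mul (f := g) z (hgne z hz') (Finset.prod_ne_zero_iff.2 fun i _ => hterm i z hz') hg.differentiableAt (by fun_prop)]
    congr 1
    rw [logDeriv_prod (f := fun i (w : ℂ) => (((7/4 : ℝ) : ℂ) ^ 2 - (starRingEnd ℂ) (ρ i) * w) / ((7/4 : ℝ) : ℂ)) (fun i _ => hterm i z hz') (fun i _ => by fun_prop)]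
    apply Finset.sum_congr rfl
    intro i _
    have hder : HasDerivAt (fun w : ℂ => (((7/4 : ℝ) : ℂ) ^ 2 - (starRingEnd ℂ) (ρ i) * w) / ((7/4 : ℝ) : ℂ)) ((- ((starRingEnd ℂ) (ρ i) * 1)) / ((7/4 : ℝ) : ℂ)) z := by
      exact (((hasDerivAt_id z).const_mul _).const_sub _).div_const _
    rw [logDeriv_apply, hder.deriv]
    have h1 := hterm i z hz'
    have h2 : ((7/4 : ℝ) : ℂ) ≠ 0 := by norm_num
    rw [div_div_div_cancel_right₀ h2, mul_one]
  have hfact : ∀ i, z - ρ i ≠ 0 := by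
    intro i h
    apply hfz
    rw [hf, Finset.prod_eq_zero (Finset.mem_univ i) h, zero_mul]
  have hlf : logDeriv f z = (∑ i, 1 / (z - ρ i)) + logDeriv g z := by
    have : f = fun z => (∏ i, (z - ρ i)) * g z := funext hf
    rw [this, logDeriv_mul (f := fun z => ∏ i, (z - ρ i)) (g := g) z (Finset.prod_ne_zero_iff.2 fun i _ => hfact i) (hgne z hz') (by fun_prop) hg.differentiableAt]
    congr 1
    rw [logDeriv_prod (fun i _ => hfact i) (fun i _ => by fun_prop)]
    apply Finset.sum_congr rfl
    intro i _
    rw [logDeriv_apply]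
    simp
  rw [hlf, add_sub_cancel_left]
  have : logDeriv g z = logDeriv (blG g (7/4) ρ) z - ∑ i, (- (starRingEnd ℂ) (ρ i)) / (((7/4 : ℝ) : ℂ) ^ 2 - (starRingEnd ℂ) (ρ i) * z) := by
    rw [hlG]; ring
  rw [this]
  refine (norm_sub_le _ _).trans ?_
  have hs : ‖∑ i, (- (starRingEnd ℂ) (ρ i)) / (((7/4 : ℝ) : ℂ) ^ 2 - (starRingEnd ℂ) (ρ i) * z)‖ ≤ ∑ i : Fin n, (33/5 : ℝ) := by
    refine (norm_sum_le _ _).trans (Finset.sum_le_sum fun i _ => ?_)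
    have h1 := hlow i z hz'
    rw [norm_div, norm_neg, RCLike.norm_conj, div_le_iff₀ (by linarith)]
    have := hρ i
    linarith
  rw [Finset.sum_const, Finset.card_univ, Fintype.card_fin, nsmul_eq_mul] at hs
  linarith

theorem zeros_lemma (f : ℂ → ℂ) (hfd : Differentiable ℂ f) (c : ℂ)
    (B : ℝ) (hB : 0 < B) (h0 : f c ≠ 0) (hM : ∀ z, ‖z - c‖ ≤ 7/4 → ‖f z‖ ≤ Real.exp B * ‖f c‖) :
    ∃ (n : ℕ) (ρ : Fin n → ℂ), (n : ℝ) ≤ 18 * B ∧ (∀ i, ‖ρ i - c‖ ≤ 33/20) ∧ (∀ i, f (ρ i) = 0) ∧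
      ∀ z, ‖z - c‖ ≤ 8/5 → f z ≠ 0 → ‖logDeriv f z - ∑ i, 1 / (z - ρ i)‖ ≤ 6000 * B := by
  obtain ⟨n, ρ, h1, h2, h3, h4⟩ := zeros_lemma0 (fun z => f (z + c)) (by fun_prop) B hB (by simpa using h0)
    (by
      intro z hz
      simpa using hM (z + c) (by simpa using hz))
  refine ⟨n, fun i => ρ i + c, h1, by simpa using h2, h3, ?_⟩
  intro z hz hfz
  have := h4 (z - c) hz (by simpa using hfz)
  rw [logDeriv_apply, deriv_comp_add_const] at this
  simp only [sub_add_cancel] at this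
  rw [logDeriv_apply]
  convert this using 5
  ring

theorem periodic_sum_mul {D : ℕ} [NeZero D] (χ : ZMod D → ℂ) (m : ℕ) :
    ∑ k ∈ Finset.range (D * m), χ (k : ZMod D) = m * ∑ b, χ b := by
  induction m with
  | zero => simp
  | succ m ih =>
    rw [Nat.mul_succ, Finset.sum_range_add, ih]
    push_cast
    rw [add_mul, one_mul]
    congr 1
    simp only [CharP.cast_eq_zero, zero_mul, zero_add]
    rw [← Fin.sum_univ_eq_sum_range (fun k : ℕ => χ (k : ZMod D)) D]
    obtain ⟨D', rfl⟩ : ∃ D', D = D' + 1 := ⟨D - 1, by have := NeZero.pos D; omega⟩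
    apply Finset.sum_congr rfl
    intro i _
    congr 1
    exact Fin.cast_val_eq_self i

theorem periodic_sum_range {D : ℕ} [NeZero D] (χ : ZMod D → ℂ) (hχ : ∀ b, ‖χ b‖ ≤ 1) (N : ℕ) :
    ‖∑ k ∈ Finset.range N, χ (k : ZMod D) - ((∑ b, χ b) / D) * N‖ ≤ 2 * D := by
  have hD : (D : ℂ) ≠ 0 := by exact_mod_cast NeZero.ne D
  have hDpos : (0:ℝ) < D := by exact_mod_cast NeZero.pos D
  have hN : N = D * (N / D) + N % D := (Nat.div_add_mod N D).symm
  have hr : N % D < D := Nat.mod_lt _ (NeZero.pos D)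
  generalize N / D = m at hN
  generalize N % D = r at hN hr
  subst hN
  rw [Finset.sum_range_add, periodic_sum_mul]
  have h1 : ‖∑ b, χ b‖ ≤ D := by
    refine (norm_sum_le _ _).trans ?_
    refine (Finset.sum_le_sum fun b _ => hχ b).trans ?_
    simp [ZMod.card]
  have h2 : ‖∑ k ∈ Finset.range r, χ ((D * m + k : ℕ) : ZMod D)‖ ≤ r := by
    refine (norm_sum_le _ _).trans ?_
    refine (Finset.sum_le_sum fun b _ => hχ _).trans ?_
    simp
  have h3 : (m : ℂ) * ∑ b, χ b + ∑ k ∈ Finset.range r, χ ((D * m + k : ℕ) : ZMod D) - ((∑ b, χ b) / D) * ((D * m + r : ℕ) : ℂ)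
     = ∑ k ∈ Finset.range r, χ ((D * m + k : ℕ) : ZMod D) - (∑ b, χ b) / D * r := by
    push_cast
    field_simp
    ring
  rw [h3]
  refine (norm_sub_le _ _).trans ?_
  have hr' : (r : ℝ) ≤ D := by exact_mod_cast hr.le
  have h4 : ‖(∑ b, χ b) / D * r‖ ≤ 1 * r := by
    rw [norm_mul, norm_div]
    simp only [Complex.norm_natCast]
    gcongr
    rw [div_le_one hDpos]; exact h1
  linarith

/-- mean value of a character -/
noncomputable def cmean {D : ℕ} [NeZero D] (χ : DirichletCharacter ℂ D) : ℂ := (∑ b, χ b) / D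

theorem cmean_le {D : ℕ} [NeZero D] (χ : DirichletCharacter ℂ D) : ‖cmean χ‖ ≤ 1 := by
  have hDpos : (0:ℝ) < D := by exact_mod_cast NeZero.pos D
  rw [cmean, norm_div, Complex.norm_natCast, div_le_one hDpos]
  refine (norm_sum_le _ _).trans ?_
  refine (Finset.sum_le_sum fun b _ => χ.norm_le_one b).trans ?_
  simp [ZMod.card]

theorem cmean_ne_one {D : ℕ} [NeZero D] (χ : DirichletCharacter ℂ D) (h : χ ≠ 1) : cmean χ = 0 := by
  rw [cmean, MulChar.sum_eq_zero_of_ne_one h, zero_div]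

noncomputable def Echi {D : ℕ} [NeZero D] (χ : DirichletCharacter ℂ D) (t : ℝ) : ℂ :=
  ∑ k ∈ Finset.Icc 1 ⌊t⌋₊, χ (k : ZMod D) - cmean χ * t

theorem sum_Icc_chi_le {D : ℕ} [NeZero D] (χ : DirichletCharacter ℂ D) (n : ℕ) :
    ‖∑ k ∈ Finset.Icc 1 n, χ (k : ZMod D) - cmean χ * (n + 1 : ℕ)‖ ≤ 2 * D + 1 := by
  have h1 : ∑ k ∈ Finset.range (n + 1), χ (k : ZMod D) = χ 0 + ∑ k ∈ Finset.Icc 1 n, χ (k : ZMod D) := by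
    rw [Finset.range_eq_Ico, Finset.sum_eq_sum_Ico_succ_bot (by omega)]
    rw [zero_add, Nat.cast_zero, Finset.Ico_add_one_right_eq_Icc]
  have h2 := periodic_sum_range χ (fun b => χ.norm_le_one b) (n + 1)
  rw [h1] at h2
  have : ∑ k ∈ Finset.Icc 1 n, χ (k : ZMod D) - cmean χ * (n + 1 : ℕ) = 
    (χ 0 + ∑ k ∈ Finset.Icc 1 n, χ (k : ZMod D) - ((∑ b, χ b) / D) * (n + 1 : ℕ)) - χ 0 := by
    rw [cmean]; ring
  rw [this]
  refine (norm_sub_le _ _).trans ?_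
  have := χ.norm_le_one 0
  linarith

theorem Echi_le {D : ℕ} [NeZero D] (χ : DirichletCharacter ℂ D) (t : ℝ) (ht : 0 ≤ t) :
    ‖Echi χ t‖ ≤ 4 * D := by
  have hD : (1:ℝ) ≤ D := by exact_mod_cast NeZero.pos D
  have h1 := sum_Icc_chi_le χ ⌊t⌋₊
  have h2 : Echi χ t = (∑ k ∈ Finset.Icc 1 ⌊t⌋₊, χ (k : ZMod D) - cmean χ * (⌊t⌋₊ + 1 : ℕ)) + cmean χ * ((⌊t⌋₊ + 1 : ℕ) - t) := by
    rw [Echi]; ring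
  rw [h2]
  refine (norm_add_le _ _).trans ?_
  have h3 : ‖cmean χ * ((⌊t⌋₊ + 1 : ℕ) - t)‖ ≤ 1 := by
    rw [norm_mul]
    have : ‖(((⌊t⌋₊ + 1 : ℕ) : ℂ) - t)‖ ≤ 1 := by
      have e : (((⌊t⌋₊ + 1 : ℕ) : ℂ) - t) = (((⌊t⌋₊ + 1 : ℕ) : ℝ) - t : ℝ) := by push_cast; rfl
      rw [e, Complex.norm_real, Real.norm_eq_abs, abs_le]
      have := Nat.floor_le ht
      have := Nat.lt_floor_add_one t
      push_cast
      constructor <;> linarith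
    have := cmean_le χ
    nlinarith [norm_nonneg (cmean χ), norm_nonneg (((⌊t⌋₊ + 1 : ℕ) : ℂ) - t)]
  linarith

theorem Echi_meas {D : ℕ} [NeZero D] (χ : DirichletCharacter ℂ D) : Measurable (Echi χ) := by
  unfold Echi
  apply Measurable.sub
  · exact (measurable_from_nat (f := fun n => ∑ k ∈ Finset.Icc 1 n, χ (k : ZMod D))).comp Nat.measurable_floor
  · fun_prop

noncomputable def Ichi {D : ℕ} [NeZero D] (χ : DirichletCharacter ℂ D) (s : ℂ) : ℂ :=
  ∫ t in Set.Ioi (1:ℝ), Echi χ t * (t : ℂ) ^ (-(s + 1))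

theorem Ichi_bound {D : ℕ} [NeZero D] (χ : DirichletCharacter ℂ D) (s : ℂ) (hs : 0 < s.re) :
    ‖Ichi χ s‖ ≤ 4 * D / s.re := by
  rw [Ichi]
  have hIntg0 := integrableOn_Ioi_rpow_of_lt (a := -(s.re + 1)) (by linarith) (c := 1) one_pos
  have h := MeasureTheory.norm_integral_le_of_norm_le (μ := MeasureTheory.volume.restrict (Set.Ioi (1:ℝ)))
    (f := fun t : ℝ => Echi χ t * (t : ℂ) ^ (-(s + 1))) (g := fun t : ℝ => 4 * D * t ^ (-(s.re + 1))) (hIntg0.const_mul _) (by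
      rw [MeasureTheory.ae_restrict_iff' measurableSet_Ioi]
      refine Filter.Eventually.of_forall fun t ht => ?_
      have ht' : (0:ℝ) < t := by have := Set.mem_Ioi.1 ht; linarith
      rw [norm_mul, Complex.norm_cpow_eq_rpow_re_of_pos ht']
      simp only [Complex.neg_re, Complex.add_re, Complex.one_re]
      gcongr
      exact Echi_le χ t ht'.le)
  refine h.trans ?_
  rw [MeasureTheory.integral_const_mul, integral_Ioi_rpow_of_lt (by linarith) one_pos]
  apply le_of_eq
  simp
  field_simp

theorem Ichi_diff {D : ℕ} [NeZero D] (χ : DirichletCharacter ℂ D) (s : ℂ) (hs : 0 < s.re) :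
    DifferentiableAt ℂ (Ichi χ) s := by
  have e : Ichi χ = fun s => mellin ((Set.Ioi (1:ℝ)).indicator (Echi χ)) (-s) := by
    ext s
    rw [Ichi, mellin]
    have : ∀ t : ℝ, (t : ℂ) ^ (-s - 1) • (Set.Ioi (1:ℝ)).indicator (Echi χ) t = 
      (Set.Ioi (1:ℝ)).indicator (fun t : ℝ => Echi χ t * (t : ℂ) ^ (-(s + 1))) t := by
      intro t
      by_cases ht : t ∈ Set.Ioi (1:ℝ)
      · rw [Set.indicator_of_mem ht, Set.indicator_of_mem ht, smul_eq_mul, mul_comm]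
        congr 2; ring
      · rw [Set.indicator_of_notMem ht, Set.indicator_of_notMem ht, smul_zero]
    simp_rw [this]
    rw [MeasureTheory.setIntegral_indicator measurableSet_Ioi]
    rw [Set.inter_eq_self_of_subset_right (Set.Ioi_subset_Ioi zero_le_one)]
  rw [e]
  have hm : Measurable ((Set.Ioi (1:ℝ)).indicator (Echi χ)) := (Echi_meas χ).indicator measurableSet_Ioi
  have hb : ∀ t, ‖(Set.Ioi (1:ℝ)).indicator (Echi χ) t‖ ≤ 4 * D := by
    intro t
    by_cases ht : t ∈ Set.Ioi (1:ℝ)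
    · rw [Set.indicator_of_mem ht]
      exact Echi_le χ t (by have := Set.mem_Ioi.1 ht; linarith)
    · rw [Set.indicator_of_notMem ht]; simp
  have h1 : DifferentiableAt ℂ (mellin ((Set.Ioi (1:ℝ)).indicator (Echi χ))) (-s) := by
    apply mellin_differentiableAt_of_isBigO_rpow (a := 0) (b := (-s).re - 1)
    · apply MeasureTheory.LocallyIntegrable.locallyIntegrableOn
      intro t
      refine ⟨Set.Icc (t-1) (t+1), Icc_mem_nhds (by linarith) (by linarith), ?_⟩
      apply MeasureTheory.Measure.integrableOn_of_bounded (M := 4 * D) (by simp) hm.aestronglyMeasurable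
      exact Filter.Eventually.of_forall hb
    · apply Asymptotics.IsBigO.of_bound (4 * D)
      refine Filter.Eventually.of_forall fun t => ?_
      simpa using hb t
    · simpa using hs
    · apply Asymptotics.IsBigO.of_bound 1
      filter_upwards [Ioo_mem_nhdsGT (show (0:ℝ) < 1 by norm_num)] with t ht
      rw [Set.indicator_of_notMem (by simp; exact ht.2.le)]
      simp
    · linarith
  exact h1.comp s (differentiable_neg.differentiableAt)

theorem LFunction_eq_I {D : ℕ} [NeZero D] (χ : DirichletCharacter ℂ D) (s : ℂ) (hs : 1 < s.re) :
    DirichletCharacter.LFunction χ s = cmean χ * s / (s - 1) + s * Ichi χ s := by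
  have hs1 : s - 1 ≠ 0 := by
    intro h
    have : s = 1 := by linear_combination h
    rw [this] at hs; simp at hs
  rw [DirichletCharacter.LFunction_eq_LSeries χ hs, LSeries_eq_mul_integral (fun n : ℕ => χ n) (r := 1) zero_le_one hs
    (DirichletCharacter.LSeriesSummable_of_one_lt_re χ hs)]
  · have hIntg0 := integrableOn_Ioi_cpow_of_lt (a := -s) (by simpa using hs) (c := 1) one_pos
    have hintE : MeasureTheory.IntegrableOn (fun t : ℝ => Echi χ t * (t : ℂ) ^ (-(s + 1))) (Set.Ioi 1) := by
      have hg := (integrableOn_Ioi_rpow_of_lt (a := -(s.re + 1)) (by linarith) (c := 1) one_pos).const_mul (4 * D)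
      refine MeasureTheory.Integrable.mono' hg ?_ ?_
      · apply Measurable.aestronglyMeasurable
        exact (Echi_meas χ).mul (by fun_prop)
      · rw [MeasureTheory.ae_restrict_iff' measurableSet_Ioi]
        refine Filter.Eventually.of_forall fun t ht => ?_
        have ht' : (0:ℝ) < t := by have := Set.mem_Ioi.1 ht; linarith
        rw [norm_mul, Complex.norm_cpow_eq_rpow_re_of_pos ht']
        simp only [Complex.neg_re, Complex.add_re, Complex.one_re]
        gcongr
        exact Echi_le χ t ht'.le
    have e : ∫ t in Set.Ioi (1 : ℝ), (∑ k ∈ Icc 1 ⌊t⌋₊, χ (k : ZMod D)) * (t : ℂ) ^ (-(s + 1)) = 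
       ∫ t in Set.Ioi (1 : ℝ), (Echi χ t * (t : ℂ) ^ (-(s + 1)) + cmean χ * (t : ℂ) ^ (-s)) := by
      apply MeasureTheory.setIntegral_congr_fun measurableSet_Ioi
      intro t ht
      have ht' : (t : ℂ) ≠ 0 := by have := Set.mem_Ioi.1 ht; norm_cast; linarith
      simp only [Echi]
      have : (t : ℂ) ^ (-s) = t * (t : ℂ) ^ (-(s + 1)) := by
        rw [show -s = 1 + (-(s+1)) by ring, Complex.cpow_add _ _ ht', Complex.cpow_one]
      rw [this]; ring
    rw [e, MeasureTheory.integral_add hintE (hIntg0.const_mul _), MeasureTheory.integral_const_mul,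
      integral_Ioi_cpow_of_lt (by simpa using hs) one_pos, ← Ichi]
    have hs2 : -s + 1 ≠ 0 := by
      intro h; apply hs1; linear_combination -h
    simp only [Complex.ofReal_one, Complex.one_cpow]
    field_simp
    ring
  · simp only [Real.rpow_one]
    apply Asymptotics.IsBigO.of_bound 1
    refine Filter.Eventually.of_forall fun n => ?_
    refine (norm_sum_le _ _).trans ?_
    refine (Finset.sum_le_sum fun k _ => χ.norm_le_one _).trans ?_
    simp

open Classical in
/-- the entire function attached to a character -/
noncomputable def fchi {D : ℕ} [NeZero D] (χ : DirichletCharacter ℂ D) (s : ℂ) : ℂ :=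
  if χ = 1 then DirichletCharacter.LFunctionTrivChar₁ D s else DirichletCharacter.LFunction χ s

open Classical in
noncomputable def dchi {D : ℕ} [NeZero D] (χ : DirichletCharacter ℂ D) : ℕ := if χ = 1 then 1 else 0

theorem fchi_diff {D : ℕ} [NeZero D] (χ : DirichletCharacter ℂ D) : Differentiable ℂ (fchi χ) := by
  by_cases h : χ = 1
  · have : fchi χ = DirichletCharacter.LFunctionTrivChar₁ D := by ext s; simp only [fchi, if_pos h]
    rw [this]
    exact DirichletCharacter.differentiable_LFunctionTrivChar₁ D
  · have : fchi χ = DirichletCharacter.LFunction χ := by ext s; simp only [fchi, if_neg h]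
    rw [this]
    exact DirichletCharacter.differentiable_LFunction h

theorem fchi_eq {D : ℕ} [NeZero D] (χ : DirichletCharacter ℂ D) (s : ℂ) (hs : s ≠ 1) :
    fchi χ s = (s - 1) ^ (dchi χ) * DirichletCharacter.LFunction χ s := by
  by_cases h : χ = 1
  · simp only [fchi, dchi, if_pos h]
    subst h
    rw [DirichletCharacter.LFunctionTrivChar₁, Function.update_of_ne hs, pow_one]
  · simp only [fchi, dchi, if_neg h]
    simp

theorem dchi_le {D : ℕ} [NeZero D] (χ : DirichletCharacter ℂ D) : dchi χ ≤ 1 := by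
  unfold dchi; split_ifs <;> simp

theorem fchi_ne_zero {D : ℕ} [NeZero D] (χ : DirichletCharacter ℂ D) (s : ℂ) (hs : 1 ≤ s.re) : fchi χ s ≠ 0 := by
  by_cases h1 : s = 1
  · by_cases h : χ = 1
    · simp only [fchi, if_pos h]
      rw [h1]
      exact DirichletCharacter.LFunctionTrivChar₁_apply_one_ne_zero D
    · simp only [fchi, if_neg h]
      exact DirichletCharacter.LFunction_ne_zero_of_one_le_re χ (Or.inl h) hs
  · rw [fchi_eq χ s h1]
    exact mul_ne_zero (pow_ne_zero _ (sub_ne_zero.2 h1)) (DirichletCharacter.LFunction_ne_zero_of_one_le_re χ (Or.inr h1) hs)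

theorem fchi_GRH (hG : GRH) {D : ℕ} [NeZero D] (χ : DirichletCharacter ℂ D) (s : ℂ) (hs : 0 < s.re) (h0 : fchi χ s = 0) :
    s.re = 1 / 2 := by
  have h1 : s.re < 1 := by
    by_contra h
    exact fchi_ne_zero χ s (not_lt.1 h) h0
  have h2 : s ≠ 1 := by rintro rfl; simp at h1
  rw [fchi_eq χ s h2] at h0
  rcases mul_eq_zero.1 h0 with h | h
  · exact absurd h (pow_ne_zero _ (sub_ne_zero.2 h2))
  · exact hG D χ s h hs h1

theorem fchi_formula {D : ℕ} [NeZero D] (χ : DirichletCharacter ℂ D) (s : ℂ) (hs : 0 < s.re) :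
    fchi χ s = cmean χ * s + (s - 1) ^ (dchi χ) * (s * Ichi χ s) := by
  have hU : IsOpen {s : ℂ | 0 < s.re} := isOpen_lt continuous_const Complex.continuous_re
  have h2mem : (2 : ℂ) ∈ {s : ℂ | 0 < s.re} := by simp
  have := AnalyticOnNhd.eqOn_of_preconnected_of_eventuallyEq (𝕜 := ℂ) (U := {s : ℂ | 0 < s.re})
    (f := fchi χ) (g := fun s => cmean χ * s + (s - 1) ^ (dchi χ) * (s * Ichi χ s)) (z₀ := 2)
    ((fchi_diff χ).differentiableOn.analyticOnNhd hU)
    (by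
      apply DifferentiableOn.analyticOnNhd _ hU
      intro z hz
      have := Ichi_diff χ z hz
      exact DifferentiableAt.differentiableWithinAt (by fun_prop))
    (convex_halfSpace_re_gt 0).isPreconnected h2mem (by
      have h1 : {s : ℂ | 1 < s.re} ∈ nhds (2:ℂ) :=
        (isOpen_lt continuous_const Complex.continuous_re).mem_nhds (by simp)
      filter_upwards [h1] with z hz
      have hz1 : z ≠ 1 := by rintro rfl; simp at hz
      have hz1' : z - 1 ≠ 0 := sub_ne_zero.2 hz1
      rw [fchi_eq χ z hz1, LFunction_eq_I χ z hz, mul_add]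
      congr 1
      by_cases h : χ = 1
      · simp only [dchi, if_pos h, pow_one]
        field_simp
      · rw [cmean_ne_one χ h]; simp)
  exact this hs

theorem fchi_growth {D : ℕ} [NeZero D] (χ : DirichletCharacter ℂ D) (s : ℂ) (hs : 1 / 4 ≤ s.re) :
    ‖fchi χ s‖ ≤ 17 * D * (‖s‖ + 1) ^ 2 := by
  have hD : (1:ℝ) ≤ D := by exact_mod_cast NeZero.pos D
  rw [fchi_formula χ s (by linarith)]
  refine (norm_add_le _ _).trans ?_
  have h1 : ‖cmean χ * s‖ ≤ 1 * ‖s‖ := by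
    rw [norm_mul]; gcongr; exact cmean_le χ
  have h2 : ‖(s - 1) ^ (dchi χ) * (s * Ichi χ s)‖ ≤ (‖s‖ + 1) * (‖s‖ * (16 * D)) := by
    rw [norm_mul, norm_mul]
    gcongr
    · rw [norm_pow]
      have h3 : ‖s - 1‖ ≤ ‖s‖ + 1 := by simpa using norm_sub_le s 1
      have := dchi_le χ
      interval_cases dchi χ
      · simp
      · simpa using h3
    · refine (Ichi_bound χ s (by linarith)).trans ?_
      rw [div_le_iff₀ (by linarith)]
      nlinarith
  nlinarith [norm_nonneg s, mul_nonneg (norm_nonneg s) (norm_nonneg s)]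

theorem fchi_lower : ∃ c : ℝ, 0 < c ∧ c ≤ 1 ∧ ∀ (D : ℕ) [NeZero D] (χ : DirichletCharacter ℂ D) (t : ℝ),
    c ≤ ‖fchi χ (2 + t * Complex.I)‖ := by
  refine ⟨2 - Real.pi ^ 2 / 6, ?_, ?_, ?_⟩
  · have := Real.pi_lt_d2
    have := Real.pi_pos
    nlinarith
  · have := Real.pi_gt_three
    nlinarith
  intro D _ χ t
  set s : ℂ := 2 + t * Complex.I with hs
  have hre : s.re = 2 := by simp [hs]
  have hs1 : s ≠ 1 := by intro h; rw [h] at hre; norm_num at hre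
  rw [fchi_eq χ s hs1, norm_mul, norm_pow]
  have h1 : 1 ≤ ‖s - 1‖ := by
    have := Complex.abs_re_le_norm (s - 1)
    simp [hre] at this
    norm_num at this
    exact this
  have h2 : 2 - Real.pi ^ 2 / 6 ≤ ‖DirichletCharacter.LFunction χ s‖ := by
    rw [DirichletCharacter.LFunction_eq_LSeries χ (by rw [hre]; norm_num)]
    have hsum := DirichletCharacter.LSeriesSummable_of_one_lt_re χ (s := s) (by rw [hre]; norm_num)
    have hz := hasSum_zeta_two
    have hterm : ∀ n : ℕ, ‖LSeries.term (fun n : ℕ => χ n) s n‖ ≤ 1 / (n : ℝ) ^ 2 := by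
      intro n
      rcases Nat.eq_zero_or_pos n with rfl | hn
      · simp
      · rw [LSeries.norm_term_eq, if_neg (by omega), hre]
        have := χ.norm_le_one n
        have e : (n : ℝ) ^ (2:ℝ) = (n : ℝ) ^ 2 := by norm_cast
        rw [e]
        gcongr
    have hsplit : LSeries (fun n : ℕ => χ n) s = 1 + ∑' n : ℕ, LSeries.term (fun n : ℕ => χ n) s (n + 2) := by
      rw [LSeries, ← hsum.sum_add_tsum_nat_add 2]
      simp [Finset.sum_range_succ, LSeries.term]
    have hz2 : ∑' n : ℕ, 1 / ((n + 2 : ℕ) : ℝ) ^ 2 = Real.pi ^ 2 / 6 - 1 := by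
      have := hz.summable.sum_add_tsum_nat_add 2
      rw [hz.tsum_eq] at this
      simp [Finset.sum_range_succ] at this ⊢
      linarith
    have hb : ‖∑' n : ℕ, LSeries.term (fun n : ℕ => χ n) s (n + 2)‖ ≤ Real.pi ^ 2 / 6 - 1 := by
      rw [← hz2]
      apply tsum_of_norm_bounded (((summable_nat_add_iff 2).2 hz.summable).hasSum)
      intro n
      exact hterm (n + 2)
    rw [hsplit]
    have := norm_sub_norm_le (1 : ℂ) (-∑' n : ℕ, LSeries.term (fun n : ℕ => χ n) s (n + 2))
    rw [sub_neg_eq_add, norm_neg, norm_one] at this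
    linarith
  have h3 : 1 ≤ ‖s - 1‖ ^ dchi χ := one_le_pow₀ h1
  nlinarith [norm_nonneg (DirichletCharacter.LFunction χ s)]

noncomputable def ell (D : ℕ) (T : ℝ) : ℝ := Real.log (D * (|T| + 2))

theorem ell_ge {D : ℕ} [NeZero D] (T : ℝ) : 1 / 2 ≤ ell D T := by
  have hD : (1:ℝ) ≤ D := by exact_mod_cast NeZero.pos D
  have h1 : Real.log 2 ≤ ell D T := by
    apply Real.log_le_log (by norm_num)
    nlinarith [abs_nonneg T]
  have := Real.log_two_gt_d9
  linarith

theorem local_exp (hG : GRH) : ∃ K : ℝ, 1 ≤ K ∧ ∀ (D : ℕ) [NeZero D] (χ : DirichletCharacter ℂ D) (T : ℝ),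
    ∃ (n : ℕ) (ρ : Fin n → ℂ), (n : ℝ) ≤ K * ell D T ∧ (∀ i, (ρ i).re = 1 / 2) ∧
      ∀ z : ℂ, ‖z - (2 + T * Complex.I)‖ ≤ 8/5 → fchi χ z ≠ 0 →
        ‖logDeriv (fchi χ) z - ∑ i, 1 / (z - ρ i)‖ ≤ K * ell D T := by
  obtain ⟨c, hc0, hc1, hc⟩ := fchi_lower
  have hA : 0 ≤ Real.log (153 / c) := Real.log_nonneg (by rw [le_div_iff₀ hc0]; linarith)
  refine ⟨6000 * (2 * Real.log (153 / c) + 2), by linarith, ?_⟩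
  intro D _ χ T
  have hD : (1:ℝ) ≤ D := by exact_mod_cast NeZero.pos D
  have hl := ell_ge (D := D) T
  set B := (2 * Real.log (153 / c) + 2) * ell D T with hB
  have hB0 : 0 < B := by positivity
  obtain ⟨n, ρ, h1, h2, h3, h4⟩ := zeros_lemma (fchi χ) (fchi_diff χ) (2 + T * Complex.I) B hB0
    (fchi_ne_zero χ _ (by simp)) (by
      intro z hz
      have hre : 1/4 ≤ z.re := by
        have := Complex.abs_re_le_norm (z - (2 + T * Complex.I))
        simp at this
        have := abs_le.1 (this.trans hz)
        linarith
      have hnorm : ‖z‖ ≤ |T| + 4 := by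
        have h := norm_add_le (z - (2 + T * Complex.I)) (2 + T * Complex.I)
        have h' := norm_add_le (2:ℂ) (T * Complex.I)
        simp at h h'
        linarith
      have hg := fchi_growth χ z hre
      have hl := hc D χ T
      have hb1 : 17 * D * (‖z‖ + 1) ^ 2 ≤ 153 * (D * (|T| + 2)) ^ 2 := by
        have : (‖z‖ + 1) ^ 2 ≤ (3 * (|T| + 2)) ^ 2 := by
          gcongr
          linarith [abs_nonneg T]
        calc 17 * D * (‖z‖ + 1) ^ 2 ≤ 17 * (D * D) * (3 * (|T| + 2)) ^ 2 := by
              gcongr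
              nlinarith
          _ = _ := by ring
      have hb2 : 153 * (D * (|T| + 2)) ^ 2 ≤ Real.exp B * c := by
        have hpos : 0 < D * (|T| + 2) := by positivity
        have e1 : (D * (|T| + 2)) ^ 2 = Real.exp (2 * ell D T) := by
          rw [ell, two_mul, Real.exp_add, Real.exp_log hpos]; ring
        have e2 : 153 / c ≤ Real.exp (2 * Real.log (153 / c) * ell D T) := by
          rw [← Real.log_le_iff_le_exp (by positivity)]
          nlinarith
        calc 153 * (D * (|T| + 2)) ^ 2 = (153 / c) * Real.exp (2 * ell D T) * c := by rw [e1]; field_simp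
          _ ≤ Real.exp (2 * Real.log (153 / c) * ell D T) * Real.exp (2 * ell D T) * c := by gcongr
          _ = Real.exp B * c := by rw [← Real.exp_add, hB]; ring_nf
      have hb3 : Real.exp B * c ≤ Real.exp B * ‖fchi χ (2 + T * Complex.I)‖ := by gcongr
      linarith)
  refine ⟨n, ρ, by rw [mul_assoc, ← hB]; linarith, ?_, by simpa only [mul_assoc, ← hB] using h4⟩
  intro i
  apply fchi_GRH hG χ _ _ (h3 i)
  have := Complex.abs_re_le_norm (ρ i - (2 + T * Complex.I))
  simp at this
  have := abs_le.1 (this.trans (h2 i))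
  linarith

theorem near_center (σ t T : ℝ) (h1 : 1/2 ≤ σ) (h2 : σ ≤ 7/2) (ht : |t - T| ≤ 1/2) :
    ‖((σ : ℂ) + t * Complex.I) - (2 + T * Complex.I)‖ ≤ 8/5 := by
  have e : ((σ : ℂ) + t * Complex.I) - (2 + T * Complex.I) = ((σ - 2 : ℝ) : ℂ) + ((t - T : ℝ) : ℂ) * Complex.I := by
    push_cast; ring
  rw [e, Complex.norm_add_mul_I]
  rw [Real.sqrt_le_left (by norm_num)]
  have := abs_le.1 ht
  nlinarith

theorem fchi_ne_zero' (hG : GRH) {D : ℕ} [NeZero D] (χ : DirichletCharacter ℂ D) (s : ℂ) (hs : 1/2 < s.re) : fchi χ s ≠ 0 := by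
  intro h
  have := fchi_GRH hG χ s (by linarith) h
  linarith

theorem logDeriv_bd (hG : GRH) : ∃ K : ℝ, 1 ≤ K ∧ ∀ (D : ℕ) [NeZero D] (χ : DirichletCharacter ℂ D) (η σ t : ℝ),
    0 < η → 1/2 + η ≤ σ → σ ≤ 7/2 → ‖logDeriv (fchi χ) (σ + t * Complex.I)‖ ≤ K * ell D t * (1 + 1 / η) := by
  obtain ⟨K, hK, h⟩ := local_exp hG
  refine ⟨K, hK, ?_⟩
  intro D _ χ η σ t hη h1 h2
  obtain ⟨n, ρ, hn, hρ, hb⟩ := h D χ t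
  have hz := hb (σ + t * Complex.I) (near_center σ t t (by linarith) h2 (by simp)) (fchi_ne_zero' hG χ _ (by simp; linarith))
  have hs : ‖∑ i, 1 / ((σ : ℂ) + t * Complex.I - ρ i)‖ ≤ ∑ i : Fin n, 1 / η := by
    refine (norm_sum_le _ _).trans (Finset.sum_le_sum fun i _ => ?_)
    rw [norm_div, norm_one]
    have : η ≤ ‖(σ : ℂ) + t * Complex.I - ρ i‖ := by
      refine le_trans ?_ (Complex.re_le_norm _)
      simp [hρ i]; linarith
    gcongr
  rw [Finset.sum_const, Finset.card_univ, Fintype.card_fin, nsmul_eq_mul] at hs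
  have h3 := norm_add_le (logDeriv (fchi χ) (σ + t * Complex.I) - ∑ i, 1 / ((σ : ℂ) + t * Complex.I - ρ i)) (∑ i, 1 / ((σ : ℂ) + t * Complex.I - ρ i))
  rw [sub_add_cancel] at h3
  have h4 : (n : ℝ) * (1 / η) ≤ K * ell D t * (1 / η) := by gcongr
  nlinarith

theorem poisson_integral_le (η γ a b : ℝ) (hη : 0 < η) : 
    ∫ t in a..b, η / (η ^ 2 + (t - γ) ^ 2) ≤ Real.pi := by
  have h : ∀ t ∈ Set.uIcc a b, HasDerivAt (fun t => Real.arctan ((t - γ) / η)) (η / (η ^ 2 + (t - γ) ^ 2)) t := by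
    intro t _
    have h1 : HasDerivAt (fun t : ℝ => (t - γ) / η) (1 / η) t := ((hasDerivAt_id t).sub_const γ).div_const η
    have h2 := h1.arctan
    convert h2 using 1
    have : η ^ 2 + (t - γ) ^ 2 ≠ 0 := by positivity
    have : 1 + ((t - γ) / η) ^ 2 ≠ 0 := by positivity
    field_simp
  rw [intervalIntegral.integral_eq_sub_of_hasDerivAt h]
  · have h1 := Real.arctan_lt_pi_div_two ((b - γ) / η)
    have h2 := Real.neg_pi_div_two_lt_arctan ((a - γ) / η)
    linarith
  · apply Continuous.intervalIntegrable
    apply Continuous.div (by fun_prop) (by fun_prop)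
    intro t; positivity

theorem logDeriv_cont (hG : GRH) {D : ℕ} [NeZero D] (χ : DirichletCharacter ℂ D) (σ : ℝ) (hσ : 1/2 < σ) :
    Continuous (fun t : ℝ => logDeriv (fchi χ) (σ + t * Complex.I)) := by
  rw [continuous_iff_continuousAt]
  intro t
  have h1 : ContinuousAt (logDeriv (fchi χ)) (σ + t * Complex.I) := by
    have ha : AnalyticAt ℂ (fchi χ) (σ + t * Complex.I) := (fchi_diff χ).analyticAt _
    exact (ha.deriv.div ha (fchi_ne_zero' hG χ _ (by simpa using hσ))).continuousAt
  exact ContinuousAt.comp (f := fun t : ℝ => (σ : ℂ) + t * Complex.I) h1 (by fun_prop)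

theorem re_integral_bd (hG : GRH) : ∃ K : ℝ, 1 ≤ K ∧ ∀ (D : ℕ) [NeZero D] (χ : DirichletCharacter ℂ D) (η T : ℝ),
    0 < η → η ≤ 1/2 → ∫ t in (T - 1/2)..(T + 1/2), |(logDeriv (fchi χ) (((1/2 + η : ℝ) : ℂ) + t * Complex.I)).re| ≤ K * ell D T := by
  obtain ⟨K, hK, h⟩ := local_exp hG
  refine ⟨5 * K, by linarith, ?_⟩
  intro D _ χ η T hη h1
  obtain ⟨n, ρ, hn, hρ, hb⟩ := h D χ T
  have hl := ell_ge (D := D) T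
  have hpt : ∀ t ∈ Set.Icc (T - 1/2) (T + 1/2), |(logDeriv (fchi χ) (((1/2 + η : ℝ) : ℂ) + t * Complex.I)).re| ≤ 
      K * ell D T + ∑ i, η / (η ^ 2 + (t - (ρ i).im) ^ 2) := by
    intro t ht
    have hz := hb (((1/2 + η : ℝ) : ℂ) + t * Complex.I) (near_center _ t T (by linarith) (by linarith) (by rw [abs_le]; constructor <;> linarith [ht.1, ht.2])) 
      (fchi_ne_zero' hG χ _ (by simp; linarith))
    have hre := (Complex.abs_re_le_norm _).trans hz
    rw [Complex.sub_re] at hre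
    have e : (∑ i, 1 / (((1/2 + η : ℝ) : ℂ) + t * Complex.I - ρ i)).re = ∑ i, η / (η ^ 2 + (t - (ρ i).im) ^ 2) := by
      rw [Complex.re_sum]
      apply Finset.sum_congr rfl
      intro i _
      rw [one_div, Complex.inv_re, Complex.normSq_apply]
      simp [hρ i]
      congr 1
      ring
    rw [e] at hre
    have hnn : 0 ≤ ∑ i, η / (η ^ 2 + (t - (ρ i).im) ^ 2) := Finset.sum_nonneg fun i _ => by positivity
    have h3 := abs_add_le ((logDeriv (fchi χ) (((1/2 + η : ℝ) : ℂ) + t * Complex.I)).re - ∑ i, η / (η ^ 2 + (t - (ρ i).im) ^ 2)) (∑ i, η / (η ^ 2 + (t - (ρ i).im) ^ 2))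
    rw [sub_add_cancel, abs_of_nonneg hnn] at h3
    linarith
  have hcont : ∀ i, Continuous fun t : ℝ => η / (η ^ 2 + (t - (ρ i).im) ^ 2) := by
    intro i
    apply Continuous.div (by fun_prop) (by fun_prop)
    intro t; positivity
  have hmono := intervalIntegral.integral_mono_on (μ := MeasureTheory.volume) (a := T - 1/2) (b := T + 1/2) (by linarith)
    (f := fun t : ℝ => |(logDeriv (fchi χ) (((1/2 + η : ℝ) : ℂ) + t * Complex.I)).re|)
    (g := fun t => K * ell D T + ∑ i, η / (η ^ 2 + (t - (ρ i).im) ^ 2)) 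
    (by
      apply Continuous.intervalIntegrable
      exact (Complex.continuous_re.comp (logDeriv_cont hG χ (1/2 + η) (by linarith))).abs)
    (by
      apply Continuous.intervalIntegrable
      exact continuous_const.add (continuous_finsetSum _ fun i _ => hcont i)) hpt
  refine hmono.trans ?_
  rw [intervalIntegral.integral_add (by simp) (by
      apply Continuous.intervalIntegrable
      exact (continuous_finsetSum _ fun i _ => hcont i)),
    intervalIntegral.integral_finsetSum (fun i _ => (hcont i).intervalIntegrable _ _)]
  have h5 : ∑ i, ∫ t in (T - 1/2)..(T + 1/2), η / (η ^ 2 + (t - (ρ i).im) ^ 2) ≤ ∑ i : Fin n, (4:ℝ) := by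
    apply Finset.sum_le_sum
    intro i _
    exact (poisson_integral_le η _ _ _ hη).trans Real.pi_le_four
  rw [Finset.sum_const, Finset.card_univ, Fintype.card_fin, nsmul_eq_mul] at h5
  rw [intervalIntegral.integral_const, smul_eq_mul]
  nlinarith

open MeasureTheory Filter Topology in
theorem shift_lemma (g : ℂ → ℂ) (a b M : ℝ) (hab : a ≤ b)
    (hd : ∀ s : ℂ, a ≤ s.re → s.re ≤ b → DifferentiableAt ℂ g s)
    (hb : ∀ σ t : ℝ, a ≤ σ → σ ≤ b → ‖g (σ + t * Complex.I)‖ ≤ M * (1 + ‖t‖) ^ (-(3/2) : ℝ)) :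
    Integrable (fun t : ℝ => g (a + t * Complex.I)) ∧ Integrable (fun t : ℝ => g (b + t * Complex.I)) ∧
    ∫ t : ℝ, g (a + t * Complex.I) = ∫ t : ℝ, g (b + t * Complex.I) := by
  have hJ : Integrable (fun t : ℝ => M * (1 + ‖t‖) ^ (-(3/2) : ℝ)) :=
    (integrable_one_add_norm (E := ℝ) (r := 3/2) (by simp; norm_num)).const_mul M
  have hIntg0 : ∀ σ : ℝ, a ≤ σ → σ ≤ b → Integrable (fun t : ℝ => g (σ + t * Complex.I)) := by
    intro σ h1 h2
    refine hJ.mono' ?_ (Eventually.of_forall fun t => hb σ t h1 h2)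
    apply Continuous.aestronglyMeasurable
    rw [continuous_iff_continuousAt]
    intro t
    exact ContinuousAt.comp (f := fun t : ℝ => (σ : ℂ) + t * Complex.I) (hd _ (by simpa) (by simpa)).continuousAt (by fun_prop)
  refine ⟨hIntg0 a le_rfl hab, hIntg0 b hab le_rfl, ?_⟩
  have hrect : ∀ T : ℝ, (∫ y in (-T)..T, g (b + y * Complex.I)) - (∫ y in (-T)..T, g (a + y * Complex.I)) =
      Complex.I * ((∫ x in a..b, g (x + (-T : ℝ) * Complex.I)) - ∫ x in a..b, g (x + (T : ℝ) * Complex.I)) := by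
    intro T
    have := Complex.integral_boundary_rect_eq_zero_of_differentiableOn g ⟨a, -T⟩ ⟨b, T⟩ (by
      intro s hs
      rw [Complex.mem_reProdIm] at hs
      have h1 := hs.1
      simp only [Set.uIcc_of_le hab] at h1
      exact (hd s h1.1 h1.2).differentiableWithinAt)
    simp only [smul_eq_mul] at this
    have h2 := congrArg (fun z => Complex.I * z) this
    simp only [mul_zero] at h2
    linear_combination (-1) * h2 + ((∫ y in (-T)..T, g (b + y * Complex.I)) - (∫ y in (-T)..T, g (a + y * Complex.I))) * (Complex.I_mul_I)
  have hlim1 := (intervalIntegral_tendsto_integral (hIntg0 b hab le_rfl) tendsto_neg_atTop_atBot tendsto_id).sub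
    (intervalIntegral_tendsto_integral (hIntg0 a le_rfl hab) tendsto_neg_atTop_atBot tendsto_id)
  have hhor : ∀ T : ℝ, ‖(∫ x in a..b, g (x + (T : ℝ) * Complex.I))‖ ≤ M * (1 + ‖T‖) ^ (-(3/2) : ℝ) * |b - a| := by
    intro T
    apply intervalIntegral.norm_integral_le_of_norm_le_const
    intro x hx
    rw [Set.uIoc_of_le hab] at hx
    exact hb x T hx.1.le hx.2
  have hz : Tendsto (fun T : ℝ => 2 * (M * (1 + ‖T‖) ^ (-(3/2) : ℝ) * |b - a|)) atTop (𝓝 0) := by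
    have h1 : Tendsto (fun T : ℝ => (1 + ‖T‖) ^ (-(3/2) : ℝ)) atTop (𝓝 0) := by
      apply (tendsto_rpow_neg_atTop (y := 3/2) (by norm_num)).comp
      apply tendsto_atTop_add_const_left
      exact tendsto_norm_atTop_atTop
    have := ((h1.const_mul M).mul_const |b - a|).const_mul 2
    simpa using this
  have hlim2 : Tendsto (fun T : ℝ => (∫ y in (-T)..T, g (b + y * Complex.I)) - (∫ y in (-T)..T, g (a + y * Complex.I))) atTop (𝓝 0) := by
    apply squeeze_zero_norm _ hz
    intro T
    rw [hrect, norm_mul, Complex.norm_I, one_mul]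
    refine (norm_sub_le _ _).trans ?_
    have h1 := hhor T
    have h2 := hhor (-T)
    rw [norm_neg] at h2
    linarith
  have := tendsto_nhds_unique hlim1 hlim2
  exact (sub_eq_zero.1 this).symm

theorem one_add_le_norm (σ t : ℝ) (hσ : 0 < σ) : 1 + ‖t‖ ≤ (1 + 1 / σ) * ‖(σ : ℂ) + t * Complex.I‖ := by
  have h1 := Complex.abs_re_le_norm ((σ : ℂ) + t * Complex.I)
  have h2 := Complex.abs_im_le_norm ((σ : ℂ) + t * Complex.I)
  simp at h1 h2
  rw [abs_of_pos hσ] at h1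
  have h3 : 1 ≤ 1 / σ * ‖(σ : ℂ) + t * Complex.I‖ := by
    rw [one_div, ← div_eq_inv_mul, le_div_iff₀ hσ]; linarith
  rw [Real.norm_eq_abs]
  linarith

theorem kern_norm (σ t : ℝ) (hσ : 0 < σ) :
    ‖1 / (((σ : ℂ) + t * Complex.I) * ((σ : ℂ) + t * Complex.I + 1))‖ ≤ (1 + 1 / σ) ^ 2 * (1 + ‖t‖) ^ (-2 : ℝ) := by
  have h1 := one_add_le_norm σ t hσ
  have h2 : 1 + ‖t‖ ≤ (1 + 1 / σ) * ‖(σ : ℂ) + t * Complex.I + 1‖ := by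
    have := one_add_le_norm (σ + 1) t (by linarith)
    have e : ((σ + 1 : ℝ) : ℂ) + t * Complex.I = (σ : ℂ) + t * Complex.I + 1 := by push_cast; ring
    rw [e] at this
    refine this.trans ?_
    gcongr
    linarith
  have hp : 0 < 1 + ‖t‖ := by positivity
  rw [norm_div, norm_mul, norm_one, Real.rpow_neg hp.le]
  have hp1 : 0 < ‖(σ : ℂ) + t * Complex.I‖ := by
    by_contra h
    have : ‖(σ : ℂ) + t * Complex.I‖ = 0 := le_antisymm (not_lt.1 h) (norm_nonneg _)
    rw [this] at h1; linarith
  have hp2 : 0 < ‖(σ : ℂ) + t * Complex.I + 1‖ := by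
    by_contra h
    have : ‖(σ : ℂ) + t * Complex.I + 1‖ = 0 := le_antisymm (not_lt.1 h) (norm_nonneg _)
    rw [this] at h2; linarith
  rw [show (2:ℝ) = ((2:ℕ):ℝ) by norm_num, Real.rpow_natCast, div_le_iff₀ (by positivity), mul_assoc, ← div_eq_inv_mul, 
    ← mul_div_assoc, le_div_iff₀ (by positivity)]
  calc 1 * (1 + ‖t‖) ^ 2 = (1 + ‖t‖) * (1 + ‖t‖) := by ring
    _ ≤ ((1 + 1 / σ) * ‖(σ : ℂ) + t * Complex.I‖) * ((1 + 1 / σ) * ‖(σ : ℂ) + t * Complex.I + 1‖) := by gcongr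
    _ = _ := by ring

theorem line_ne (σ t : ℝ) (hσ : 0 < σ) : ((σ : ℂ) + t * Complex.I) ≠ 0 := by
  intro h
  have := congrArg Complex.re h
  simp at this; linarith

theorem line_ne1 (σ t : ℝ) (hσ : 0 < σ) : ((σ : ℂ) + t * Complex.I + 1) ≠ 0 := by
  intro h
  have := congrArg Complex.re h
  simp at this; linarith

open MeasureTheory Filter Topology in
theorem kern_integrable (σ : ℝ) (hσ : 0 < σ) :
    Integrable (fun t : ℝ => 1 / (((σ : ℂ) + t * Complex.I) * ((σ : ℂ) + t * Complex.I + 1))) := by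
  refine ((integrable_one_add_norm (E := ℝ) (r := 2) (by simp)).const_mul ((1 + 1 / σ) ^ 2)).mono' ?_ 
    (Eventually.of_forall fun t => kern_norm σ t hσ)
  apply Continuous.aestronglyMeasurable
  apply Continuous.div (by fun_prop) (by fun_prop)
  intro t
  exact mul_ne_zero (line_ne σ t hσ) (line_ne1 σ t hσ)

open MeasureTheory Filter Topology in
theorem kern_mellin (σ y : ℝ) (hσ : 0 < σ) (hy : 0 < y) :
    ∫ t : ℝ, (y : ℂ) ^ (-((σ : ℂ) + t * Complex.I)) * (1 / (((σ : ℂ) + t * Complex.I) * ((σ : ℂ) + t * Complex.I + 1))) = 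
     2 * Real.pi * (max (1 - y) 0 : ℝ) := by
  let f : ℝ → ℂ := fun t => (Set.Ioc (0:ℝ) 1).indicator (fun _ => (1:ℂ)) t - (Set.Ioc (0:ℝ) 1).indicator (fun t : ℝ => (t : ℂ) ^ (1:ℂ)) t
  have hm : ∀ s : ℂ, 0 < s.re → HasMellin f s (1 / (s * (s + 1))) := by
    intro s hs
    have h1 := hasMellin_one_Ioc hs
    have h2 := hasMellin_cpow_Ioc 1 (s := s) (by simp; linarith)
    have h3 := hasMellin_sub h1.1 h2.1
    rw [h1.2, h2.2] at h3
    have hs0 : s ≠ 0 := by rintro rfl; simp at hs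
    have hs1 : s + 1 ≠ 0 := by
      intro h
      have := congrArg Complex.re h
      simp at this; linarith
    have e : 1 / s - 1 / (s + 1) = 1 / (s * (s + 1)) := by field_simp; ring
    rw [← e]
    exact h3
  have hfe : ∀ x : ℝ, 0 < x → f x = ((max (1 - x) 0 : ℝ) : ℂ) := by
    intro x hx
    simp only [f]
    by_cases h : x ≤ 1
    · rw [Set.indicator_of_mem (Set.mem_Ioc.2 ⟨hx, h⟩), Set.indicator_of_mem (Set.mem_Ioc.2 ⟨hx, h⟩), max_eq_left (by linarith)]
      simp
    · rw [Set.indicator_of_notMem (by simp; intro _; linarith), Set.indicator_of_notMem (by simp; intro _; linarith), max_eq_right (by linarith)]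
      simp
  have hmel : ∀ t : ℝ, mellin f ((σ : ℂ) + t * Complex.I) = 1 / (((σ : ℂ) + t * Complex.I) * ((σ : ℂ) + t * Complex.I + 1)) := by
    intro t
    exact (hm _ (by simpa using hσ)).2
  have hinv := mellinInv_mellin_eq σ f hy (hm σ (by simpa using hσ)).1 (by
    unfold Complex.VerticalIntegrable
    simp_rw [hmel]
    exact kern_integrable σ hσ) (by
    have h1 : ContinuousAt (fun x : ℝ => ((max (1 - x) 0 : ℝ) : ℂ)) y := by fun_prop
    apply h1.congr
    filter_upwards [Ioi_mem_nhds hy] with x hx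
    exact (hfe x hx).symm)
  rw [mellinInv, hfe y hy] at hinv
  simp_rw [hmel, smul_eq_mul] at hinv
  rw [← hinv]
  rw [Complex.real_smul]
  have : (Real.pi : ℂ) ≠ 0 := by exact_mod_cast Real.pi_ne_zero
  generalize (∫ t : ℝ, (y : ℂ) ^ (-((σ : ℂ) + t * Complex.I)) * (1 / (((σ : ℂ) + t * Complex.I) * ((σ : ℂ) + t * Complex.I + 1)))) = J
  push_cast
  field_simp

noncomputable def Kn (Y : ℝ) (s : ℂ) : ℂ := (Y : ℂ) ^ (s + 1) * (1 / (s * (s + 1)))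
noncomputable def Wk (N : ℕ) (s : ℂ) : ℂ := Kn (N + 1) s - Kn N s - Kn 2 s + Kn 1 s
noncomputable def wfun (N : ℕ) (y : ℝ) : ℝ := max ((N + 1) - y) 0 - max (N - y) 0 - max (2 - y) 0 + max (1 - y) 0

open MeasureTheory Filter Topology in
theorem Kn_integrable (Y σ y : ℝ) (hY : 0 < Y) (hσ : 0 < σ) (hy : 0 < y) :
    Integrable (fun t : ℝ => (y : ℂ) ^ (-((σ : ℂ) + t * Complex.I)) * Kn Y ((σ : ℂ) + t * Complex.I)) := by
  refine ((kern_integrable σ hσ).norm.const_mul (y ^ (-σ) * Y ^ (σ + 1))).mono' ?_ (Eventually.of_forall fun t => ?_)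
  · apply Continuous.aestronglyMeasurable
    unfold Kn
    have h1 : Continuous fun t : ℝ => (y : ℂ) ^ (-((σ : ℂ) + t * Complex.I)) := by
      apply Continuous.const_cpow (by fun_prop)
      left; exact_mod_cast hy.ne'
    have h2 : Continuous fun t : ℝ => (Y : ℂ) ^ (((σ : ℂ) + t * Complex.I) + 1) := by
      apply Continuous.const_cpow (by fun_prop)
      left; exact_mod_cast hY.ne'
    have h3 : Continuous (fun t : ℝ => 1 / (((σ : ℂ) + t * Complex.I) * ((σ : ℂ) + t * Complex.I + 1))) := by
      apply Continuous.div (by fun_prop) (by fun_prop)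
      intro t
      exact mul_ne_zero (line_ne σ t hσ) (line_ne1 σ t hσ)
    exact h1.mul (h2.mul h3)
  · rw [Kn, norm_mul, norm_mul, Complex.norm_cpow_eq_rpow_re_of_pos hy, Complex.norm_cpow_eq_rpow_re_of_pos hY]
    simp [mul_assoc]

open MeasureTheory Filter Topology in
theorem Kn_mellin (Y σ y : ℝ) (hY : 0 < Y) (hσ : 0 < σ) (hy : 0 < y) :
    ∫ t : ℝ, (y : ℂ) ^ (-((σ : ℂ) + t * Complex.I)) * Kn Y ((σ : ℂ) + t * Complex.I) = 
     2 * Real.pi * (max (Y - y) 0 : ℝ) := by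
  have h := kern_mellin σ (y / Y) hσ (by positivity)
  have h2 : ∀ t : ℝ, (y : ℂ) ^ (-((σ : ℂ) + t * Complex.I)) * Kn Y ((σ : ℂ) + t * Complex.I) = 
    Y * (((y / Y : ℝ) : ℂ) ^ (-((σ : ℂ) + t * Complex.I)) * (1 / (((σ : ℂ) + t * Complex.I) * ((σ : ℂ) + t * Complex.I + 1)))) := by
    intro t
    have hYc : (Y : ℂ) ≠ 0 := by exact_mod_cast hY.ne'
    rw [Kn, div_eq_mul_inv y Y, Complex.ofReal_mul, Complex.mul_cpow_ofReal_nonneg hy.le (by positivity), Complex.cpow_add _ _ hYc,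
      Complex.ofReal_inv, Complex.inv_cpow _ _ (by rw [Complex.arg_ofReal_of_nonneg hY.le]; exact Real.pi_pos.ne), ← Complex.cpow_neg, neg_neg, Complex.cpow_one]
    ring
  simp_rw [h2]
  rw [integral_const_mul, h]
  have : max (Y - y) 0 = Y * max (1 - y / Y) 0 := by
    rw [mul_max_of_nonneg _ _ hY.le, mul_zero]
    congr 1
    field_simp
  rw [this]
  push_cast
  ring

open MeasureTheory Filter Topology in
theorem Wk_integrable (N : ℕ) (hN : 1 ≤ N) (σ y : ℝ) (hσ : 0 < σ) (hy : 0 < y) :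
    Integrable (fun t : ℝ => (y : ℂ) ^ (-((σ : ℂ) + t * Complex.I)) * Wk N ((σ : ℂ) + t * Complex.I)) := by
  have hN' : (0:ℝ) < N := by exact_mod_cast hN
  have h1 := Kn_integrable (N + 1) σ y (by positivity) hσ hy
  have h2 := Kn_integrable N σ y hN' hσ hy
  have h3 := Kn_integrable 2 σ y (by positivity) hσ hy
  have h4 := Kn_integrable 1 σ y (by positivity) hσ hy
  refine (((h1.sub h2).sub h3).add h4).congr (Eventually.of_forall fun t => ?_)
  simp only [Wk, Pi.add_apply, Pi.sub_apply]
  ring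

open MeasureTheory Filter Topology in
theorem Wk_mellin (N : ℕ) (hN : 1 ≤ N) (σ y : ℝ) (hσ : 0 < σ) (hy : 0 < y) :
    ∫ t : ℝ, (y : ℂ) ^ (-((σ : ℂ) + t * Complex.I)) * Wk N ((σ : ℂ) + t * Complex.I) = 2 * Real.pi * (wfun N y : ℝ) := by
  have hN' : (0:ℝ) < N := by exact_mod_cast hN
  have h1 := Kn_integrable (N + 1) σ y (by positivity) hσ hy
  have h2 := Kn_integrable N σ y hN' hσ hy
  have h3 := Kn_integrable 2 σ y (by positivity) hσ hy
  have h4 := Kn_integrable 1 σ y (by positivity) hσ hy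
  have e : (fun t : ℝ => (y : ℂ) ^ (-((σ : ℂ) + t * Complex.I)) * Wk N ((σ : ℂ) + t * Complex.I)) = fun t : ℝ => 
    (((y : ℂ) ^ (-((σ : ℂ) + t * Complex.I)) * Kn (N + 1) ((σ : ℂ) + t * Complex.I) - (y : ℂ) ^ (-((σ : ℂ) + t * Complex.I)) * Kn N ((σ : ℂ) + t * Complex.I))
     - (y : ℂ) ^ (-((σ : ℂ) + t * Complex.I)) * Kn 2 ((σ : ℂ) + t * Complex.I)) + (y : ℂ) ^ (-((σ : ℂ) + t * Complex.I)) * Kn 1 ((σ : ℂ) + t * Complex.I) := by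
    ext t; rw [Wk]; ring
  rw [e, integral_add, integral_sub, integral_sub, Kn_mellin _ σ y (by positivity) hσ hy, Kn_mellin _ σ y hN' hσ hy, Kn_mellin _ σ y (by positivity) hσ hy,
     Kn_mellin _ σ y (by positivity) hσ hy]
  · rw [wfun]; push_cast; ring
  · exact h1
  · exact h2
  · exact h1.sub h2
  · exact h3
  · exact (h1.sub h2).sub h3
  · exact h4

theorem Kn_conj (Y : ℝ) (hY : 0 < Y) (s : ℂ) : Kn Y ((starRingEnd ℂ) s) = (starRingEnd ℂ) (Kn Y s) := by
  have : (Y : ℂ) ^ ((starRingEnd ℂ) s + 1) = (starRingEnd ℂ) ((Y : ℂ) ^ (s + 1)) := by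
    have := Complex.conj_cpow (Y : ℂ) (s + 1) (by rw [Complex.arg_ofReal_of_nonneg hY.le]; exact Real.pi_pos.ne)
    rw [Complex.conj_ofReal] at this
    rw [this]
    simp
  simp [Kn, this]

theorem Wk_conj (N : ℕ) (hN : 1 ≤ N) (s : ℂ) : Wk N ((starRingEnd ℂ) s) = (starRingEnd ℂ) (Wk N s) := by
  have hN' : (0:ℝ) < N := by exact_mod_cast hN
  simp [Wk, Kn_conj ((N : ℝ) + 1) (by positivity), Kn_conj N hN', Kn_conj 2, Kn_conj 1]

theorem wfun_small (N : ℕ) (hN : 1 ≤ N) (y : ℝ) (hy : y ≤ 1) : wfun N y = 0 := by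
  have hN' : (1:ℝ) ≤ N := by exact_mod_cast hN
  rw [wfun, max_eq_left, max_eq_left, max_eq_left, max_eq_left] <;> linarith

theorem wfun_mid (N : ℕ) (y : ℝ) (hy : 2 ≤ y) (hy2 : y ≤ N) : wfun N y = 1 := by
  rw [wfun, max_eq_left, max_eq_left, max_eq_right, max_eq_right] <;> linarith

theorem wfun_large (N : ℕ) (hN : 1 ≤ N) (y : ℝ) (hy2 : N + 1 ≤ y) : wfun N y = 0 := by
  have hN' : (1:ℝ) ≤ N := by exact_mod_cast hN
  rw [wfun, max_eq_right, max_eq_right, max_eq_right, max_eq_right] <;> linarith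

open MeasureTheory Filter Topology in
theorem max_integral (Y : ℝ) (hY : 1 ≤ Y) : IntegrableOn (fun y : ℝ => max (Y - y) 0) (Set.Ioi 1) ∧ 
   ∫ y in Set.Ioi (1:ℝ), max (Y - y) 0 = (Y - 1) ^ 2 / 2 := by
  have e : Set.Ioi (1:ℝ) = Set.Ioc 1 Y ∪ Set.Ioi Y := (Set.Ioc_union_Ioi_eq_Ioi hY).symm
  have h1 : IntegrableOn (fun y : ℝ => max (Y - y) 0) (Set.Ioc 1 Y) := by
    apply Continuous.integrableOn_Ioc; fun_prop
  have h2 : Set.EqOn (fun y : ℝ => max (Y - y) 0) (fun _ => 0) (Set.Ioi Y) := by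
    intro y hy
    simp only [Set.mem_Ioi] at hy
    simp only
    rw [max_eq_right (by linarith)]
  have h3 : IntegrableOn (fun y : ℝ => max (Y - y) 0) (Set.Ioi Y) :=
    integrableOn_zero.congr_fun h2.symm measurableSet_Ioi
  rw [e]
  refine ⟨h1.union h3, ?_⟩
  rw [setIntegral_union (Set.Ioc_disjoint_Ioi le_rfl) measurableSet_Ioi h1 h3, setIntegral_congr_fun measurableSet_Ioi h2]
  have h4 : Set.EqOn (fun y : ℝ => max (Y - y) 0) (fun y => Y - y) (Set.Ioc 1 Y) := by
    intro y hy
    simp only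
    rw [max_eq_left (by linarith [hy.2])]
  rw [setIntegral_congr_fun measurableSet_Ioc h4, ← intervalIntegral.integral_of_le hY, intervalIntegral.integral_sub (by simp) (by simp), integral_id]
  simp
  ring

open MeasureTheory Filter Topology in
theorem wfun_integral (N : ℕ) (hN : 1 ≤ N) : ∫ y in Set.Ioi (1:ℝ), wfun N y = N - 1 := by
  have hN' : (1:ℝ) ≤ N := by exact_mod_cast hN
  obtain ⟨a1, b1⟩ := max_integral (N + 1) (by linarith)
  obtain ⟨a2, b2⟩ := max_integral N hN'
  obtain ⟨a3, b3⟩ := max_integral 2 (by norm_num)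
  obtain ⟨a4, b4⟩ := max_integral 1 (by norm_num)
  unfold wfun
  rw [integral_add, integral_sub, integral_sub, b1, b2, b3, b4]
  · ring
  · exact a1
  · exact a2
  · exact a1.sub a2
  · exact a3
  · exact (a1.sub a2).sub a3
  · exact a4

theorem Wk_bd1 (N : ℕ) (hN : 1 ≤ N) (σ t : ℝ) (hσ : 0 < σ) :
    ‖Wk N ((σ : ℂ) + t * Complex.I)‖ ≤ 2 * (N + 1) ^ σ / ‖(σ : ℂ) + t * Complex.I‖ := by
  have hN' : (1:ℝ) ≤ N := by exact_mod_cast hN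
  set s := (σ : ℂ) + t * Complex.I with hs
  have hs0 : s ≠ 0 := line_ne σ t hσ
  have hs1 : s + 1 ≠ 0 := line_ne1 σ t hσ
  have key : ∀ Y : ℝ, 1 ≤ Y → Y ≤ N → ‖Kn (Y + 1) s - Kn Y s‖ ≤ (N + 1) ^ σ / ‖s‖ := by
    intro Y hY hYN
    have hmv := Convex.norm_image_sub_le_of_norm_hasDerivWithin_le (f := fun u : ℝ => (u : ℂ) ^ (s + 1)) (f' := fun u : ℝ => (s + 1) * (u : ℂ) ^ s)
      (s := Set.Icc Y (Y + 1)) (C := ‖s + 1‖ * (N + 1) ^ σ) (x := Y) (y := Y + 1) (by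
        intro u hu
        have hu0 : u ≠ 0 := by have := hu.1; intro h; linarith
        have := hasDerivAt_ofReal_cpow_const' (x := u) (r := s) hu0 (by
          intro h; rw [h] at hs1; simp at hs1)
        have h2 := (this.const_mul (s + 1)).hasDerivWithinAt (s := Set.Icc Y (Y + 1))
        refine h2.congr_of_mem ?_ hu
        intro u hu
        field_simp) (by
        intro u hu
        have hu0 : 0 < u := by have := hu.1; linarith
        rw [norm_mul, Complex.norm_cpow_eq_rpow_re_of_pos hu0]
        have : s.re = σ := by simp [hs]
        rw [this]
        gcongr
        have := hu.2; linarith) (convex_Icc _ _) (by simp) (by simp)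
    have e : Kn (Y + 1) s - Kn Y s = ((((Y + 1 : ℝ) : ℂ)) ^ (s + 1) - (Y : ℂ) ^ (s + 1)) / (s * (s + 1)) := by
      rw [Kn, Kn]; ring
    rw [e, norm_div, norm_mul]
    have p0 : 0 < ‖s‖ := norm_pos_iff.2 hs0
    have p1 : 0 < ‖s + 1‖ := norm_pos_iff.2 hs1
    rw [div_le_div_iff₀ (by positivity) p0]
    simp at hmv
    calc _ ≤ (‖s + 1‖ * (N + 1) ^ σ) * ‖s‖ := by
          gcongr
          push_cast
          exact hmv
      _ = _ := by ring
  have e : Wk N s = (Kn (N + 1) s - Kn N s) - (Kn (1 + 1) s - Kn 1 s) := by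
    rw [Wk]; norm_num; ring
  rw [e]
  refine (norm_sub_le _ _).trans ?_
  have h1 := key N hN' le_rfl
  have h2 := key 1 le_rfl hN'
  calc _ ≤ _ := add_le_add h1 h2
    _ = _ := by ring

theorem Wk_bd2 (N : ℕ) (hN : 1 ≤ N) (σ t : ℝ) (hσ : 0 < σ) :
    ‖Wk N ((σ : ℂ) + t * Complex.I)‖ ≤ 4 * (N + 1) ^ (σ + 1) * ‖1 / (((σ : ℂ) + t * Complex.I) * ((σ : ℂ) + t * Complex.I + 1))‖ := by
  have hN' : (1:ℝ) ≤ N := by exact_mod_cast hN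
  have key : ∀ Y : ℝ, 1 ≤ Y → Y ≤ N + 1 → ‖Kn Y ((σ : ℂ) + t * Complex.I)‖ ≤ (N + 1) ^ (σ + 1) * ‖1 / (((σ : ℂ) + t * Complex.I) * ((σ : ℂ) + t * Complex.I + 1))‖ := by
    intro Y hY hYN
    rw [Kn, norm_mul, Complex.norm_cpow_eq_rpow_re_of_pos (by linarith)]
    simp only [Complex.add_re, Complex.ofReal_re, Complex.mul_re, Complex.I_re, Complex.ofReal_im, Complex.I_im, Complex.one_re]
    simp only [mul_zero, zero_mul, sub_zero, add_zero]
    gcongr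
  rw [Wk]
  have h1 := key (N + 1) (by linarith) le_rfl
  have h2 := key N hN' (by linarith)
  have h3 := key 2 (by norm_num) (by linarith)
  have h4 := key 1 (by norm_num) (by linarith)
  refine (norm_add_le _ _).trans ?_
  have h5 := norm_sub_le (Kn (N + 1) ((σ : ℂ) + t * Complex.I) - Kn N ((σ : ℂ) + t * Complex.I)) (Kn 2 ((σ : ℂ) + t * Complex.I))
  have h6 := norm_sub_le (Kn (N + 1) ((σ : ℂ) + t * Complex.I)) (Kn N ((σ : ℂ) + t * Complex.I))
  linarith

theorem Wk_diff (N : ℕ) (hN : 1 ≤ N) (s : ℂ) (hs : 0 < s.re) : DifferentiableAt ℂ (Wk N) s := by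
  have hN' : (1:ℝ) ≤ N := by exact_mod_cast hN
  have hs0 : s ≠ 0 := by rintro rfl; simp at hs
  have hs1 : s + 1 ≠ 0 := by
    intro h
    have := congrArg Complex.re h
    simp at this; linarith
  have key : ∀ Y : ℝ, 1 ≤ Y → DifferentiableAt ℂ (Kn Y) s := by
    intro Y hY
    unfold Kn
    have : (Y : ℂ) ≠ 0 := by exact_mod_cast (by linarith : Y ≠ 0)
    apply DifferentiableAt.mul
    · apply DifferentiableAt.const_cpow (by fun_prop) (Or.inl this)
    · have h0 : s * (s + 1) ≠ 0 := mul_ne_zero hs0 hs1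
      fun_prop (disch := exact h0)
  unfold Wk
  exact (((key _ (by linarith)).sub (key _ hN')).sub (key _ (by norm_num))).add (key _ le_rfl)

theorem logDeriv_fchi {D : ℕ} [NeZero D] (χ : DirichletCharacter ℂ D) (s : ℂ) (hs : 1 < s.re) :
    - logDeriv (fchi χ) s = LSeries (fun n => χ n * (vonMangoldt n : ℂ)) s - (dchi χ : ℂ) * (1 / (s - 1)) := by
  have hs1 : s ≠ 1 := by rintro rfl; simp at hs
  have h1 := DirichletCharacter.LSeries_twist_vonMangoldt_eq χ hs
  have h2 : (fun n : ℕ => χ n * (vonMangoldt n : ℂ)) = ((fun n : ℕ => χ n) * fun n : ℕ => (vonMangoldt n : ℂ)) := rfl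
  rw [h2, h1]
  have hev : fchi χ =ᶠ[nhds s] fun s => (s - 1) ^ (dchi χ) * LSeries (fun n => χ n) s := by
    have : {s : ℂ | 1 < s.re} ∈ nhds s := (isOpen_lt continuous_const Complex.continuous_re).mem_nhds hs
    filter_upwards [this] with z hz
    rw [fchi_eq χ z (by rintro rfl; simp at hz), DirichletCharacter.LFunction_eq_LSeries χ hz]
  have hL0 : LSeries (fun n => χ n) s ≠ 0 := DirichletCharacter.LSeries_ne_zero_of_one_lt_re χ hs
  have hLd : DifferentiableAt ℂ (LSeries (fun n => χ n)) s := by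
    have : LSeries (fun n => χ n) =ᶠ[nhds s] DirichletCharacter.LFunction χ := by
      have : {s : ℂ | 1 < s.re} ∈ nhds s := (isOpen_lt continuous_const Complex.continuous_re).mem_nhds hs
      filter_upwards [this] with z hz
      rw [DirichletCharacter.LFunction_eq_LSeries χ hz]
    exact (DirichletCharacter.differentiableAt_LFunction χ s (Or.inl hs1)).congr_of_eventuallyEq this
  have e : logDeriv (fchi χ) s = logDeriv (fun s => (s - 1) ^ (dchi χ) * LSeries (fun n => χ n) s) s := by
    rw [logDeriv_apply, logDeriv_apply, hev.deriv_eq, hev.eq_of_nhds]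
  rw [e, logDeriv_mul (f := fun s : ℂ => (s - 1) ^ (dchi χ)) (g := LSeries (fun n => χ n)) s (pow_ne_zero _ (sub_ne_zero.2 hs1)) hL0 (by fun_prop) hLd, logDeriv_apply (LSeries _)]
  have e2 : logDeriv (fun s : ℂ => (s - 1) ^ (dchi χ)) s = dchi χ * (1 / (s - 1)) := by
    have := logDeriv_fun_pow (f := fun s : ℂ => s - 1) (x := s) (by fun_prop) (dchi χ)
    rw [this, logDeriv_apply]
    simp [deriv_sub_const]
  rw [e2]
  ring

open MeasureTheory Filter Topology in
theorem lemmaQ_sum {D : ℕ} [NeZero D] (χ : DirichletCharacter ℂ D) (A : ℝ → ℂ) (hA : Integrable A) (c : ℝ) (hc : 1 < c) :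
    Integrable (fun t : ℝ => A t * LSeries (fun n => χ n * (vonMangoldt n : ℂ)) ((c : ℂ) + t * Complex.I)) ∧
    ∫ t : ℝ, A t * LSeries (fun n => χ n * (vonMangoldt n : ℂ)) ((c : ℂ) + t * Complex.I) =
     ∑' n : ℕ, χ n * (vonMangoldt n : ℂ) * ∫ t : ℝ, (n : ℂ) ^ (-((c : ℂ) + t * Complex.I)) * A t := by
  have hsum : ∀ t : ℝ, LSeriesSummable (fun n => χ n * (vonMangoldt n : ℂ)) ((c : ℂ) + t * Complex.I) := fun t =>
    DirichletCharacter.LSeriesSummable_twist_vonMangoldt χ (by simpa using hc)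
  have hsum0 := (hsum 0).norm
  have hterm : ∀ (n : ℕ) (s : ℂ), LSeries.term (fun n => χ n * (vonMangoldt n : ℂ)) s n = χ n * (vonMangoldt n : ℂ) * (n : ℂ) ^ (-s) := by
    intro n s
    by_cases hn : n = 0
    · subst hn; simp
    · rw [LSeries.term_of_ne_zero hn, Complex.cpow_neg]; rfl
  have hnt : ∀ (n : ℕ) (t : ℝ), ‖LSeries.term (fun n => χ n * (vonMangoldt n : ℂ)) ((c : ℂ) + t * Complex.I) n‖ = 
     ‖LSeries.term (fun n => χ n * (vonMangoldt n : ℂ)) ((c : ℂ) + (0:ℝ) * Complex.I) n‖ := by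
    intro n t
    rw [LSeries.norm_term_eq, LSeries.norm_term_eq]
    simp
  have hcont : ∀ n : ℕ, Continuous fun t : ℝ => LSeries.term (fun n => χ n * (vonMangoldt n : ℂ)) ((c : ℂ) + t * Complex.I) n := by
    intro n
    by_cases hn : n = 0
    · subst hn; simp; exact continuous_const
    · simp_rw [hterm]
      apply Continuous.mul continuous_const
      apply Continuous.const_cpow (by fun_prop)
      left; exact_mod_cast hn
  have hIntg0 : ∀ n : ℕ, Integrable (fun t : ℝ => A t * LSeries.term (fun n => χ n * (vonMangoldt n : ℂ)) ((c : ℂ) + t * Complex.I) n) := by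
    intro n
    refine (hA.norm.mul_const ‖LSeries.term (fun n => χ n * (vonMangoldt n : ℂ)) ((c : ℂ) + (0:ℝ) * Complex.I) n‖).mono' 
      (hA.aestronglyMeasurable.mul (hcont n).aestronglyMeasurable) (Eventually.of_forall fun t => ?_)
    rw [norm_mul, hnt]
  have hS : Summable fun n : ℕ => ∫ t : ℝ, ‖A t * LSeries.term (fun n => χ n * (vonMangoldt n : ℂ)) ((c : ℂ) + t * Complex.I) n‖ := by
    simp_rw [norm_mul, hnt]
    simp_rw [integral_mul_const]
    exact hsum0.mul_left _
  have h1 := hasSum_integral_of_summable_integral_norm hIntg0 hS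
  have e : ∀ t : ℝ, ∑' n : ℕ, A t * LSeries.term (fun n => χ n * (vonMangoldt n : ℂ)) ((c : ℂ) + t * Complex.I) n = 
     A t * LSeries (fun n => χ n * (vonMangoldt n : ℂ)) ((c : ℂ) + t * Complex.I) := by
    intro t
    rw [tsum_mul_left]; rfl
  simp_rw [e] at h1
  constructor
  · have hLc : Continuous fun t : ℝ => LSeries (fun n => χ n * (vonMangoldt n : ℂ)) ((c : ℂ) + t * Complex.I) := by
      unfold LSeries
      exact continuous_tsum hcont hsum0 (fun n t => (hnt n t).le)
    refine (hA.norm.mul_const (∑' n, ‖LSeries.term (fun n => χ n * (vonMangoldt n : ℂ)) ((c : ℂ) + (0:ℝ) * Complex.I) n‖)).mono' 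
      (hA.aestronglyMeasurable.mul hLc.aestronglyMeasurable) (Eventually.of_forall fun t => ?_)
    rw [norm_mul]
    gcongr
    unfold LSeries
    refine (norm_tsum_le_tsum_norm (hsum t).norm).trans ?_
    simp_rw [hnt]
    exact le_rfl
  · rw [← h1.tsum_eq]
    congr 1
    ext n
    rw [← integral_const_mul]
    congr 1
    ext t
    rw [hterm]
    ring

open MeasureTheory Filter Topology in
theorem lemmaQ_pole (A : ℝ → ℂ) (hA : Integrable A) (c : ℝ) (hc : 1 < c) :
    Integrable (fun t : ℝ => A t * (1 / (((c : ℂ) + t * Complex.I) - 1))) ∧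
    ∫ t : ℝ, A t * (1 / (((c : ℂ) + t * Complex.I) - 1)) =
     ∫ y in Set.Ioi (1:ℝ), ∫ t : ℝ, (y : ℂ) ^ (-((c : ℂ) + t * Complex.I)) * A t := by
  have hone : ∀ t : ℝ, 1 / (((c : ℂ) + t * Complex.I) - 1) = ∫ y in Set.Ioi (1:ℝ), (y : ℂ) ^ (-((c : ℂ) + t * Complex.I)) := by
    intro t
    rw [integral_Ioi_cpow_of_lt (by simpa using hc) (by norm_num)]
    simp
    rw [neg_div, ← div_neg, one_div]
    congr 1; ring
  have hprod : Integrable (fun z : ℝ × ℝ => ((z.2 : ℂ) ^ (-((c : ℂ) + z.1 * Complex.I)) * A z.1)) 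
      ((volume : Measure ℝ).prod ((volume : Measure ℝ).restrict (Set.Ioi 1))) := by
    have hy : Integrable (fun y : ℝ => y ^ (-c)) ((volume : Measure ℝ).restrict (Set.Ioi 1)) := 
      integrableOn_Ioi_rpow_of_lt (by linarith) (by norm_num)
    have h1 := hA.norm.mul_prod hy
    refine h1.mono' ?_ ?_
    · apply AEStronglyMeasurable.mul
      · apply Measurable.aestronglyMeasurable
        fun_prop
      · exact hA.aestronglyMeasurable.comp_fst
    · have : ∀ᵐ z ∂((volume : Measure ℝ).prod ((volume : Measure ℝ).restrict (Set.Ioi 1))), z.2 ∈ Set.Ioi (1:ℝ) := by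
        have h2 : ∀ᵐ y ∂((volume : Measure ℝ).restrict (Set.Ioi (1:ℝ))), y ∈ Set.Ioi (1:ℝ) := ae_restrict_mem measurableSet_Ioi
        exact Measure.quasiMeasurePreserving_snd.ae h2
      filter_upwards [this] with z hz
      have hz' : (0:ℝ) < z.2 := lt_trans one_pos hz
      rw [norm_mul, Complex.norm_cpow_eq_rpow_re_of_pos hz']
      simp [mul_comm]
  constructor
  · have hne : ∀ t : ℝ, ((c : ℂ) + t * Complex.I) - 1 ≠ 0 := by
      intro t h
      have := congrArg Complex.re h
      simp at this; linarith
    have hcont : Continuous fun t : ℝ => 1 / (((c : ℂ) + t * Complex.I) - 1) := by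
      apply Continuous.div (by fun_prop) (by fun_prop) hne
    refine (hA.norm.mul_const (1 / (c - 1))).mono' 
      (hA.aestronglyMeasurable.mul hcont.aestronglyMeasurable) (Eventually.of_forall fun t => ?_)
    rw [norm_mul, norm_div, norm_one]
    have h1 := Complex.abs_re_le_norm (((c : ℂ) + t * Complex.I) - 1)
    simp at h1
    have h2 := le_abs_self (c - 1)
    gcongr
    · linarith
  · rw [← integral_integral_swap (f := fun t y : ℝ => ((y : ℂ) ^ (-((c : ℂ) + t * Complex.I)) * A t)) hprod]
    congr 1
    ext t
    rw [hone, mul_comm, integral_mul_const]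

open MeasureTheory Filter Topology in
theorem lemmaQ {D : ℕ} [NeZero D] (χ : DirichletCharacter ℂ D) (A : ℝ → ℂ) (hA : Integrable A) (c : ℝ) (hc : 1 < c) :
    ∫ t : ℝ, A t * (- logDeriv (fchi χ) ((c : ℂ) + t * Complex.I)) =
     (∑' n : ℕ, χ n * (vonMangoldt n : ℂ) * ∫ t : ℝ, (n : ℂ) ^ (-((c : ℂ) + t * Complex.I)) * A t) - 
      dchi χ * ∫ y in Set.Ioi (1:ℝ), ∫ t : ℝ, (y : ℂ) ^ (-((c : ℂ) + t * Complex.I)) * A t := by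
  obtain ⟨a1, b1⟩ := lemmaQ_sum χ A hA c hc
  obtain ⟨a2, b2⟩ := lemmaQ_pole A hA c hc
  rw [← b1, ← b2, ← integral_const_mul, ← integral_sub a1 (a2.const_mul _)]
  congr 1
  ext t
  rw [logDeriv_fchi χ _ (by simpa using hc)]
  ring

theorem ell_le_sqrt (D : ℕ) (hD : 1 ≤ D) (t : ℝ) : ell D t ≤ 2 * Real.sqrt (2 * D) * (1 + ‖t‖) ^ (1/2 : ℝ) := by
  have hD' : (1:ℝ) ≤ D := by exact_mod_cast hD
  unfold ell
  have h0 : 0 ≤ |t| := abs_nonneg t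
  have h1 := Real.log_le_rpow_div (x := D * (|t| + 2)) (by positivity) (show (0:ℝ) < 1/2 by norm_num)
  refine h1.trans ?_
  rw [Real.sqrt_eq_rpow, mul_assoc, ← Real.mul_rpow (by positivity) (by positivity)]
  have : (D * (|t| + 2) : ℝ) ^ (1/2 : ℝ) ≤ (2 * D * (1 + ‖t‖)) ^ (1/2 : ℝ) := by
    apply Real.rpow_le_rpow (by positivity) _ (by norm_num)
    rw [Real.norm_eq_abs]
    nlinarith
  linarith

theorem strip_bd (N D : ℕ) (hN : 1 ≤ N) (hD : 1 ≤ D) (η σ t K : ℝ) (hη : 0 < η) (hK : 0 ≤ K) (h1 : η ≤ σ) (h2 : σ ≤ 2) (z : ℂ)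
    (hz : ‖z‖ ≤ K * ell D t * (1 + 1 / η)) :
    ‖Wk N ((σ : ℂ) + t * Complex.I) * z‖ ≤ (4 * (N + 1) ^ (3:ℝ) * (1 + 1 / η) ^ 2 * (K * (2 * Real.sqrt (2 * D)) * (1 + 1 / η))) * (1 + ‖t‖) ^ (-(3/2) : ℝ) := by
  have hN' : (1:ℝ) ≤ N := by exact_mod_cast hN
  have hW := Wk_bd2 N hN σ t (by linarith)
  have hk := kern_norm σ t (by linarith)
  have h3 : (1 + 1 / σ) ^ 2 ≤ (1 + 1 / η) ^ 2 := by
    have : 0 < σ := by linarith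
    gcongr
  have h4 : ((N:ℝ) + 1) ^ (σ + 1) ≤ (N + 1) ^ (3:ℝ) := by
    apply Real.rpow_le_rpow_of_exponent_le <;> linarith
  have hp : 0 < 1 + ‖t‖ := by positivity
  have hW' : ‖Wk N ((σ : ℂ) + t * Complex.I)‖ ≤ 4 * (N + 1) ^ (3:ℝ) * ((1 + 1 / η) ^ 2 * (1 + ‖t‖) ^ (-2 : ℝ)) := by
    refine hW.trans ?_
    gcongr
    refine hk.trans ?_
    gcongr
  have hz' : ‖z‖ ≤ K * (2 * Real.sqrt (2 * D) * (1 + ‖t‖) ^ (1/2 : ℝ)) * (1 + 1 / η) := by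
    refine hz.trans ?_
    gcongr
    exact ell_le_sqrt D hD t
  rw [norm_mul]
  refine (mul_le_mul hW' hz' (norm_nonneg _) (by positivity)).trans (le_of_eq ?_)
  rw [show (-(3/2) : ℝ) = -2 + 1/2 by norm_num, Real.rpow_add hp]
  ring

open MeasureTheory Filter Topology in
theorem psi_formula (hG : GRH) {D : ℕ} [NeZero D] (χ : DirichletCharacter ℂ D) (N : ℕ) (hN : 1 ≤ N) (η : ℝ) (hη : 0 < η) (hη2 : η ≤ 1/2) :
    Integrable (fun t : ℝ => Wk N (((1/2 + η : ℝ) : ℂ) + t * Complex.I) * (2 * (- logDeriv (fchi χ) (((1/2 + η : ℝ) : ℂ) + t * Complex.I)).re : ℝ)) ∧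
    2 * Real.pi * ((∑ n ∈ Finset.Icc 1 N, χ n * (vonMangoldt n : ℂ)) - dchi χ * (N - 1)) =
    ∫ t : ℝ, Wk N (((1/2 + η : ℝ) : ℂ) + t * Complex.I) * (2 * (- logDeriv (fchi χ) (((1/2 + η : ℝ) : ℂ) + t * Complex.I)).re : ℝ) := by
  have hD : 1 ≤ D := Nat.one_le_iff_ne_zero.2 (NeZero.ne D)
  obtain ⟨K, hK1, hK⟩ := logDeriv_bd hG
  set F : ℂ → ℂ := fun s => - logDeriv (fchi χ) s with hF
  have hFd : ∀ s : ℂ, 1/2 + η ≤ s.re → DifferentiableAt ℂ F s := by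
    intro s hs
    have h0 := fchi_ne_zero' hG χ s (by linarith)
    have h1 : DifferentiableAt ℂ (deriv (fchi χ)) s := ((fchi_diff χ).deriv) s
    have h2 := (fchi_diff χ) s
    exact (h1.div h2 h0).neg
  have hFb : ∀ σ t : ℝ, 1/2 + η ≤ σ → σ ≤ 1 + η → ‖F ((σ : ℂ) + t * Complex.I)‖ ≤ K * ell D t * (1 + 1 / η) := by
    intro σ t h1 h2
    rw [hF]; simp only [norm_neg]
    exact hK D χ η σ t hη h1 (by linarith)
  -- shift one
  obtain ⟨i1, i2, i3⟩ := shift_lemma (fun s => Wk N s * F s) (1/2 + η) (1 + η) _ (by linarith)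
    (fun s h1 h2 => (Wk_diff N hN s (by linarith)).mul (hFd s h1))
    (fun σ t h1 h2 => strip_bd N D hN hD η σ t K hη (by linarith) (by linarith) (by linarith) _ (hFb σ t h1 h2))
  -- shift two
  have hcl : ∀ a b c t : ℝ, a - b = c → (starRingEnd ℂ) ((a : ℂ) - ((b : ℂ) + t * Complex.I)) = (c : ℂ) + t * Complex.I := by
    intro a b c t h
    rw [← h]
    apply Complex.ext <;> simp
  have hre : ∀ s : ℂ, ((starRingEnd ℂ) (((1 + 2 * η : ℝ) : ℂ) - s)).re = 1 + 2 * η - s.re := by intro s; simp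
  obtain ⟨j1, j2, j3⟩ := shift_lemma (fun s => Wk N s * (starRingEnd ℂ) (F ((starRingEnd ℂ) (((1 + 2 * η : ℝ) : ℂ) - s)))) η (1/2 + η) _ (by linarith)
    (fun s h1 h2 => by
      refine (Wk_diff N hN s (by linarith)).mul ?_
      have h3 := hFd ((starRingEnd ℂ) (((1 + 2 * η : ℝ) : ℂ) - s)) (by rw [hre]; linarith)
      have h4 : DifferentiableAt ℂ (fun z => (starRingEnd ℂ) (F ((starRingEnd ℂ) z))) (((1 + 2 * η : ℝ) : ℂ) - s) := by
        have := DifferentiableAt.star_conj h3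
        rw [starRingEnd_self_apply] at this
        exact this
      exact h4.comp (f := fun s => ((1 + 2 * η : ℝ) : ℂ) - s) s (by fun_prop))
    (fun σ t h1 h2 => strip_bd N D hN hD η σ t K hη (by linarith) (by linarith) (by linarith) _ (by
      rw [RCLike.norm_conj]
      have e : (starRingEnd ℂ) (((1 + 2 * η : ℝ) : ℂ) - (σ + t * Complex.I)) = ((1 + 2 * η - σ : ℝ) : ℂ) + t * Complex.I := by
        exact hcl _ _ _ _ rfl
      rw [e]
      exact hFb _ _ (by linarith) (by linarith)))
  -- evaluate at the edge
  have hW1 := Wk_integrable N hN (1 + η) 1 (by linarith) one_pos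
  have hW2 := Wk_integrable N hN η 1 hη one_pos
  simp only [Complex.ofReal_one, Complex.one_cpow, one_mul] at hW1 hW2
  have q1 := lemmaQ χ _ hW1 (1 + η) (by linarith)
  have q2 := lemmaQ χ (fun t : ℝ => Wk N ((η : ℂ) + (-t : ℝ) * Complex.I)) hW2.comp_neg (1 + η) (by linarith)
  have z1 : ∀ y : ℝ, 1 ≤ y → ∫ t : ℝ, (y : ℂ) ^ (-(((1 + η : ℝ) : ℂ) + t * Complex.I)) * Wk N ((η : ℂ) + (-t : ℝ) * Complex.I) = 0 := by
    intro y hy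
    have hy0 : (0:ℝ) < y := by linarith
    rw [← integral_neg_eq_self]
    have e : ∀ t : ℝ, (y : ℂ) ^ (-(((1 + η : ℝ) : ℂ) + ((-t : ℝ) : ℂ) * Complex.I)) * Wk N ((η : ℂ) + ((-(-t) : ℝ) : ℂ) * Complex.I) = 
      (y : ℂ) ^ (-(((1 + 2 * η : ℝ) : ℂ))) * (((1 / y : ℝ) : ℂ) ^ (-((η : ℂ) + t * Complex.I)) * Wk N ((η : ℂ) + t * Complex.I)) := by
      intro t
      have hyc : (y : ℂ) ≠ 0 := by exact_mod_cast hy0.ne'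
      rw [one_div, Complex.ofReal_inv, Complex.inv_cpow _ _ (by rw [Complex.arg_ofReal_of_nonneg hy0.le]; exact Real.pi_pos.ne), ← Complex.cpow_neg, ← mul_assoc, ← Complex.cpow_add _ _ hyc, neg_neg]
      congr 2
      push_cast; ring
    simp_rw [e]
    rw [integral_const_mul, Wk_mellin N hN η (1 / y) hη (by positivity), wfun_small N hN _ (by rw [div_le_one hy0]; exact hy)]
    simp
  have z2 : ∀ n : ℕ, χ n * (vonMangoldt n : ℂ) * ∫ t : ℝ, (n : ℂ) ^ (-(((1 + η : ℝ) : ℂ) + t * Complex.I)) * Wk N ((η : ℂ) + (-t : ℝ) * Complex.I) = 0 := by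
    intro n
    rcases Nat.eq_zero_or_pos n with h | h
    · subst h; simp
    · have := z1 n (by exact_mod_cast h)
      rw [Complex.ofReal_natCast] at this
      rw [this, mul_zero]
  simp_rw [z2] at q2
  rw [tsum_zero, setIntegral_congr_fun (g := fun _ => (0:ℂ)) measurableSet_Ioi (fun y hy => z1 y (le_of_lt hy))] at q2
  simp only [integral_zero, mul_zero, sub_zero] at q2
  have q2' : ∫ t : ℝ, Wk N ((η : ℂ) + t * Complex.I) * (starRingEnd ℂ) (F (((1 + η : ℝ) : ℂ) + t * Complex.I)) = 0 := by
    have := congrArg (starRingEnd ℂ) q2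
    rw [_root_.map_zero, ← integral_conj] at this
    rw [← this]
    congr 1
    ext t
    rw [map_mul, ← Wk_conj N hN]
    simp [hF]
  have j3' : ∫ t : ℝ, Wk N (((1/2 + η : ℝ) : ℂ) + t * Complex.I) * (starRingEnd ℂ) (F (((1/2 + η : ℝ) : ℂ) + t * Complex.I)) = 0 := by
    rw [← q2']
    have e1 : ∀ t : ℝ, (starRingEnd ℂ) (((1 + 2 * η : ℝ) : ℂ) - (η + t * Complex.I)) = ((1 + η : ℝ) : ℂ) + t * Complex.I := by
      intro t; exact hcl _ _ _ _ (by ring)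
    have e2 : ∀ t : ℝ, (starRingEnd ℂ) (((1 + 2 * η : ℝ) : ℂ) - (((1/2 + η : ℝ) : ℂ) + t * Complex.I)) = ((1/2 + η : ℝ) : ℂ) + t * Complex.I := by
      intro t; exact hcl _ _ _ _ (by ring)
    simp_rw [e1, e2] at j3
    exact j3.symm
  have e2 : ∀ t : ℝ, (starRingEnd ℂ) (((1 + 2 * η : ℝ) : ℂ) - (((1/2 + η : ℝ) : ℂ) + t * Complex.I)) = ((1/2 + η : ℝ) : ℂ) + t * Complex.I := by
    intro t; exact hcl _ _ _ _ (by ring)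
  simp_rw [e2] at j2
  have ee : (fun t : ℝ => Wk N (((1/2 + η : ℝ) : ℂ) + t * Complex.I) * (2 * (F (((1/2 + η : ℝ) : ℂ) + t * Complex.I)).re : ℝ)) = 
    fun t : ℝ => Wk N (((1/2 + η : ℝ) : ℂ) + t * Complex.I) * F (((1/2 + η : ℝ) : ℂ) + t * Complex.I) + 
     Wk N (((1/2 + η : ℝ) : ℂ) + t * Complex.I) * (starRingEnd ℂ) (F (((1/2 + η : ℝ) : ℂ) + t * Complex.I)) := by
    ext t
    rw [← mul_add, Complex.add_conj]
  have hIntg0 : Integrable (fun t : ℝ => Wk N (((1/2 + η : ℝ) : ℂ) + t * Complex.I) * (2 * (F (((1/2 + η : ℝ) : ℂ) + t * Complex.I)).re : ℝ)) := by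
    rw [ee]; exact i1.add j2
  refine ⟨hIntg0, ?_⟩
  change _ = ∫ t : ℝ, Wk N (((1/2 + η : ℝ) : ℂ) + t * Complex.I) * (2 * (F (((1/2 + η : ℝ) : ℂ) + t * Complex.I)).re : ℝ)
  rw [ee, integral_add i1 j2, j3', add_zero, i3]
  change _ = ∫ t : ℝ, Wk N (((1 + η : ℝ) : ℂ) + t * Complex.I) * (- logDeriv (fchi χ) (((1 + η : ℝ) : ℂ) + t * Complex.I))
  rw [q1]
  have t1 : ∑' n : ℕ, χ n * (vonMangoldt n : ℂ) * ∫ t : ℝ, (n : ℂ) ^ (-(((1 + η : ℝ) : ℂ) + t * Complex.I)) * Wk N (((1 + η : ℝ) : ℂ) + t * Complex.I) = 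
      2 * Real.pi * ∑ n ∈ Finset.Icc 1 N, χ n * (vonMangoldt n : ℂ) := by
    rw [Finset.mul_sum]
    have hval : ∀ n : ℕ, 1 ≤ n → ∫ t : ℝ, (n : ℂ) ^ (-(((1 + η : ℝ) : ℂ) + t * Complex.I)) * Wk N (((1 + η : ℝ) : ℂ) + t * Complex.I) = 2 * Real.pi * wfun N n := by
      intro n hn
      have := Wk_mellin N hN (1 + η) n (by linarith) (by exact_mod_cast hn)
      rw [Complex.ofReal_natCast] at this
      exact this
    rw [tsum_eq_sum (s := Finset.Icc 1 N)]
    · apply Finset.sum_congr rfl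
      intro n hn
      rw [Finset.mem_Icc] at hn
      rw [hval n hn.1]
      by_cases h1 : n = 1
      · subst h1; simp
      · rw [wfun_mid N n (by exact_mod_cast (by omega : 2 ≤ n)) (by exact_mod_cast hn.2)]
        push_cast; ring
    · intro n hn
      rw [Finset.mem_Icc] at hn
      by_cases h1 : n = 0
      · subst h1; simp
      · rw [hval n (by omega), wfun_large N hN n (by exact_mod_cast (by omega : N + 1 ≤ n))]
        simp
  have t2 : ∫ y in Set.Ioi (1:ℝ), ∫ t : ℝ, (y : ℂ) ^ (-(((1 + η : ℝ) : ℂ) + t * Complex.I)) * Wk N (((1 + η : ℝ) : ℂ) + t * Complex.I) = 2 * Real.pi * (N - 1) := by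
    rw [setIntegral_congr_fun (g := fun y => 2 * Real.pi * ((wfun N y : ℝ) : ℂ)) measurableSet_Ioi
      (fun y hy => Wk_mellin N hN (1 + η) y (by linarith) (lt_trans one_pos hy)), integral_const_mul, integral_complex_ofReal, wfun_integral N hN]
    push_cast; ring
  rw [t1, t2]
  ring

theorem rpow_three_half_tele (u : ℝ) (hu : 1 < u) : 1 / (u * Real.sqrt u) ≤ 2 * (1 / Real.sqrt (u - 1) - 1 / Real.sqrt u) := by
  set a := Real.sqrt u with ha
  set b := Real.sqrt (u - 1) with hb
  have hb0 : 0 < b := Real.sqrt_pos.2 (by linarith)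
  have hab : b ≤ a := Real.sqrt_le_sqrt (by linarith)
  have ha0 : 0 < a := by linarith
  have ha2 : a ^ 2 = u := Real.sq_sqrt (by linarith)
  have hb2 : b ^ 2 = u - 1 := Real.sq_sqrt (by linarith)
  rw [← ha2, div_sub_div _ _ hb0.ne' ha0.ne', ← mul_div_assoc, div_le_div_iff₀ (by positivity) (by positivity)]
  have h1 : (a - b) * (a + b) = 1 := by nlinarith
  have h2 : a - b ≥ 0 := by linarith
  have h3 : 1 ≤ 2 * a * (a - b) := by nlinarith
  have h4 : b * a * 1 ≤ a * a * (2 * a * (a - b)) := by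
    apply mul_le_mul _ h3 (by norm_num) (by positivity)
    gcongr
  nlinarith

theorem sum_three_half (M n : ℕ) (hM : 1 ≤ M) : ∑ u ∈ Finset.Ioc M n, 1 / ((u : ℝ) * Real.sqrt u) ≤ 2 / Real.sqrt M := by
  have hM' : (1:ℝ) ≤ M := by exact_mod_cast hM
  have hp : 0 < Real.sqrt M := Real.sqrt_pos.2 (by linarith)
  rcases le_or_gt n M with h | h
  · rw [Finset.Ioc_eq_empty (by omega)]; simp; positivity
  · have key : ∀ k : ℕ, ∑ u ∈ Finset.Ioc M (M + k), 1 / ((u : ℝ) * Real.sqrt u) ≤ 2 * (1 / Real.sqrt M - 1 / Real.sqrt ((M + k : ℕ) : ℝ)) := by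
      intro k
      induction k with
      | zero => simp
      | succ k ih =>
        rw [← add_assoc, Finset.sum_Ioc_succ_top (by omega)]
        have := rpow_three_half_tele ((M + k + 1 : ℕ) : ℝ) (by push_cast; have : (0:ℝ) ≤ k := by positivity
                                                               linarith)
        have e : ((M + k + 1 : ℕ) : ℝ) - 1 = ((M + k : ℕ) : ℝ) := by push_cast; ring
        rw [e] at this
        linarith
    obtain ⟨k, rfl⟩ := Nat.exists_eq_add_of_lt h
    have := key (k + 1)
    rw [← add_assoc] at this
    refine this.trans ?_
    have : 0 ≤ 1 / Real.sqrt ((M + k + 1 : ℕ) : ℝ) := by positivity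
    rw [mul_sub, mul_one_div]; linarith

noncomputable def gW (N D j : ℕ) : ℝ := min (1 / ((j : ℝ) + 1)) (((N : ℝ) + 1) / ((j : ℝ) + 1) ^ 2) * Real.log (D * (j + 2))

theorem sum_gW : ∃ C : ℝ, 0 < C ∧ ∀ N D k : ℕ, 2 ≤ N → 1 ≤ D → D ≤ N → ∑ j ∈ Finset.range (k + 1), gW N D j ≤ C * (Real.log N) ^ 2 := by
  refine ⟨50, by norm_num, ?_⟩
  intro N D k hN hD hDN
  have hN' : (2:ℝ) ≤ N := by exact_mod_cast hN
  have hD' : (1:ℝ) ≤ D := by exact_mod_cast hD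
  have hDN' : (D:ℝ) ≤ N := by exact_mod_cast hDN
  set L := Real.log N with hL
  have hL2 : 1 / 2 ≤ L := by
    have h1 : Real.log 2 ≤ L := Real.log_le_log (by norm_num) hN'
    have := Real.log_two_gt_d9
    linarith
  have hpt : ∀ j ∈ Finset.range (k + 1), gW N D j ≤ (if j ≤ N then 3 * L * (1 / ((j : ℝ) + 1)) else 0) +
      (if N < j then (4 * L + 2) * Real.sqrt (N + 1) * (1 / ((j + 1 : ℕ) * Real.sqrt ((j + 1 : ℕ) : ℝ))) else 0) := by
    intro j _
    have hj : (0:ℝ) ≤ j := by positivity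
    have hlog0 : 0 ≤ Real.log (D * (j + 2)) := Real.log_nonneg (by nlinarith)
    by_cases h : j ≤ N
    · rw [if_pos h, if_neg (by omega), add_zero]
      unfold gW
      have hjN : (j:ℝ) ≤ N := by exact_mod_cast h
      have h1 : Real.log (D * (j + 2)) ≤ 3 * L := by
        have : Real.log ((N:ℝ)^3) = 3 * L := by rw [Real.log_pow, hL]; norm_num
        rw [← this]
        apply Real.log_le_log (by positivity)
        calc (D:ℝ) * (j + 2) ≤ N * (N + 2) := by gcongr
          _ ≤ N ^ 3 := by nlinarith [mul_nonneg (by linarith : (0:ℝ) ≤ N) (mul_nonneg (by linarith : (0:ℝ) ≤ (N:ℝ) - 2) (by linarith : (0:ℝ) ≤ (N:ℝ) + 1))]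
      calc _ ≤ (1 / ((j : ℝ) + 1)) * (3 * L) := by
            apply mul_le_mul (min_le_left _ _) h1 hlog0 (by positivity)
        _ = _ := by ring
    · rw [if_neg h, if_pos (by omega), zero_add]
      unfold gW
      have hjN : (N:ℝ) + 1 ≤ j := by exact_mod_cast (by omega : N + 1 ≤ j)
      set u : ℝ := (j:ℝ) + 1 with hu
      set M : ℝ := (N:ℝ) + 1 with hM
      have hu0 : 0 < u := by positivity
      have hM0 : 0 < M := by positivity
      have hMu : M ≤ u := by linarith
      have h1 : Real.log (D * (j + 2)) ≤ 4 * L + 2 * Real.sqrt (u / M) := by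
        have e1 : Real.log (D * (j + 2)) ≤ Real.log (N ^ 4 * (u / M)) := by
          apply Real.log_le_log (by positivity)
          have : (j:ℝ) + 2 ≤ (2 * M) * (u / M) := by
            rw [mul_assoc, mul_div_cancel₀ _ hM0.ne']; linarith
          calc (D:ℝ) * (j + 2) ≤ N * ((2 * M) * (u / M)) := by gcongr
            _ = (N * (2 * M)) * (u / M) := by ring
            _ ≤ N ^ 4 * (u / M) := by
              gcongr
              rw [hM]
              have : 2 * ((N:ℝ) + 1) ≤ N ^ 3 := by
                nlinarith [mul_nonneg (by linarith : (0:ℝ) ≤ N) (mul_nonneg (by linarith : (0:ℝ) ≤ (N:ℝ) - 2) (by linarith : (0:ℝ) ≤ (N:ℝ) + 1))]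
              calc (N:ℝ) * (2 * (N + 1)) ≤ N * N ^ 3 := by gcongr
                _ = _ := by ring
        refine e1.trans ?_
        rw [Real.log_mul (by positivity) (by positivity), Real.log_pow]
        have := Real.log_le_rpow_div (x := u / M) (by positivity) (show (0:ℝ) < 1/2 by norm_num)
        rw [← Real.sqrt_eq_rpow] at this
        push_cast
        linarith
      have e2 : ((j + 1 : ℕ) : ℝ) = u := by push_cast; rfl
      rw [e2]
      have hs1 : Real.sqrt (u / M) = Real.sqrt u / Real.sqrt M := Real.sqrt_div hu0.le M
      set a := Real.sqrt u with ha
      set b := Real.sqrt M with hb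
      have ha0 : 0 < a := Real.sqrt_pos.2 hu0
      have hb0 : 0 < b := Real.sqrt_pos.2 hM0
      have hba : b ≤ a := Real.sqrt_le_sqrt hMu
      have ha2 : u = a ^ 2 := (Real.sq_sqrt hu0.le).symm
      have hb2 : M = b ^ 2 := (Real.sq_sqrt hM0.le).symm
      calc _ ≤ (M / u ^ 2) * (4 * L + 2 * Real.sqrt (u / M)) := by
            apply mul_le_mul (min_le_right _ _) h1 hlog0 (by positivity)
        _ = 4 * L * (b ^ 2 / a ^ 4) + 2 * (b * (1 / a ^ 3)) := by
            rw [hs1, ha2, hb2]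
            field_simp
        _ ≤ 4 * L * (b * (1 / a ^ 3)) + 2 * (b * (1 / a ^ 3)) := by
            gcongr
            rw [mul_one_div, div_le_div_iff₀ (by positivity) (by positivity)]
            nlinarith [mul_nonneg (mul_nonneg hb0.le (pow_nonneg ha0.le 3)) (sub_nonneg.2 hba)]
        _ = _ := by rw [ha2]; field_simp
  refine (Finset.sum_le_sum hpt).trans ?_
  rw [Finset.sum_add_distrib, ← Finset.sum_filter, ← Finset.sum_filter]
  have p1 : ∑ j ∈ (Finset.range (k + 1)).filter (fun j => j ≤ N), 3 * L * (1 / ((j : ℝ) + 1)) ≤ 3 * L * (4 * L) := by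
    rw [← Finset.mul_sum]
    gcongr
    calc ∑ j ∈ (Finset.range (k + 1)).filter (fun j => j ≤ N), 1 / ((j : ℝ) + 1) ≤ ∑ j ∈ Finset.range (N + 1), 1 / ((j : ℝ) + 1) := by
          apply Finset.sum_le_sum_of_subset_of_nonneg
          · intro j hj; simp at hj ⊢; omega
          · intros; positivity
      _ = (harmonic (N + 1) : ℝ) := by simp [harmonic]
      _ ≤ 1 + Real.log ((N + 1 : ℕ) : ℝ) := harmonic_le_one_add_log _
      _ ≤ 4 * L := by
        have : Real.log ((N + 1 : ℕ) : ℝ) ≤ Real.log ((N:ℝ)^2) := by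
          apply Real.log_le_log (by positivity)
          push_cast; nlinarith
        rw [Real.log_pow] at this
        push_cast at this ⊢
        linarith
  have p2 : ∑ j ∈ (Finset.range (k + 1)).filter (fun j => N < j), (4 * L + 2) * Real.sqrt (N + 1) * (1 / ((j + 1 : ℕ) * Real.sqrt ((j + 1 : ℕ) : ℝ))) ≤ (4 * L + 2) * 2 := by
    rw [← Finset.mul_sum]
    have h1 : ∑ j ∈ (Finset.range (k + 1)).filter (fun j => N < j), (1 / ((j + 1 : ℕ) * Real.sqrt ((j + 1 : ℕ) : ℝ))) ≤ ∑ u ∈ Finset.Ioc (N + 1) (k + 1), 1 / ((u : ℝ) * Real.sqrt u) := by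
      have : ∑ u ∈ Finset.Ioc (N + 1) (k + 1), 1 / ((u : ℝ) * Real.sqrt u) = ∑ j ∈ Finset.Ioc N k, (1 / ((j + 1 : ℕ) * Real.sqrt ((j + 1 : ℕ) : ℝ))) := by
        rw [← Finset.map_add_right_Ioc, Finset.sum_map]; rfl
      rw [this]
      apply Finset.sum_le_sum_of_subset_of_nonneg
      · intro j hj; simp at hj ⊢; omega
      · intros; positivity
    have h2 := h1.trans (sum_three_half (N + 1) (k + 1) (by omega))
    have hs : 0 < Real.sqrt ((N:ℝ) + 1) := Real.sqrt_pos.2 (by linarith)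
    rw [mul_assoc]
    gcongr
    calc _ ≤ Real.sqrt (N + 1) * (2 / Real.sqrt ((N + 1 : ℕ) : ℝ)) := by gcongr
      _ = 2 := by push_cast; field_simp
  nlinarith

open MeasureTheory Filter Topology in
theorem psi_bound (hG : GRH) : ∃ C : ℝ, 0 < C ∧ ∀ (N D : ℕ) [NeZero D] (χ : DirichletCharacter ℂ D), 2 ≤ N → D ≤ N →
    ‖(∑ n ∈ Finset.Icc 1 N, χ n * (vonMangoldt n : ℂ)) - dchi χ * N‖ ≤ C * (Real.sqrt N * (Real.log N) ^ 2) := by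
  obtain ⟨K, hK1, hK⟩ := re_integral_bd hG
  obtain ⟨C, hC0, hC⟩ := sum_gW
  refine ⟨4 + 512 * K * C * 4, by positivity, ?_⟩
  intro N D _ χ hN hDN
  have hD : 1 ≤ D := Nat.one_le_iff_ne_zero.2 (NeZero.ne D)
  have hN' : (2:ℝ) ≤ N := by exact_mod_cast hN
  set L := Real.log N with hL
  have hL2 : 1 / 2 ≤ L := by
    have h1 : Real.log 2 ≤ L := Real.log_le_log (by norm_num) hN'
    have := Real.log_two_gt_d9
    linarith
  set η : ℝ := 1 / (4 * L) with hη
  have hη0 : 0 < η := by positivity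
  have hη2 : η ≤ 1/2 := by rw [hη, div_le_div_iff₀ (by positivity) (by norm_num)]; linarith
  obtain ⟨hIntg0, hform⟩ := psi_formula hG χ N (by omega) η hη0 hη2
  set σ := 1/2 + η with hσ
  have hA : ((N:ℝ) + 1) ^ σ ≤ 4 * Real.sqrt N := by
    rw [hσ, Real.rpow_add (by positivity), ← Real.sqrt_eq_rpow]
    have h1 : Real.sqrt ((N:ℝ) + 1) ≤ 2 * Real.sqrt N := by
      rw [show (2:ℝ) = Real.sqrt 4 by rw [show (4:ℝ) = 2 ^ 2 by norm_num]; simp, ← Real.sqrt_mul (by norm_num)]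
      apply Real.sqrt_le_sqrt; linarith
    have h2 : ((N:ℝ) + 1) ^ η ≤ 2 := by
      calc ((N:ℝ) + 1) ^ η ≤ ((N:ℝ) ^ (2:ℝ)) ^ η := by
            apply Real.rpow_le_rpow (by positivity) _ hη0.le
            rw [Real.rpow_two]; nlinarith
        _ = Real.exp (1/2) := by
            rw [← Real.rpow_mul (by positivity), Real.rpow_def_of_pos (by linarith), ← hL, hη]
            congr 1; field_simp; norm_num
        _ ≤ 2 := by
            have := Real.exp_one_lt_d9
            have h3 : Real.exp (1/2) ^ 2 = Real.exp 1 := by rw [← Real.exp_nat_mul]; norm_num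
            nlinarith [Real.exp_pos (1/2 : ℝ)]
    calc _ ≤ (2 * Real.sqrt N) * 2 := by gcongr
      _ = _ := by ring
  set A := ((N:ℝ) + 1) ^ σ with hAd
  have hA0 : 0 < A := by positivity
  set G : ℝ → ℝ := fun t => |(logDeriv (fchi χ) ((σ : ℂ) + t * Complex.I)).re| with hGd
  have hGc : Continuous G := (Complex.continuous_re.comp (logDeriv_cont hG χ σ (by linarith))).abs
  set H : ℝ → ℝ := fun t => ‖Wk N ((σ : ℂ) + t * Complex.I) * (2 * (- logDeriv (fchi χ) ((σ : ℂ) + t * Complex.I)).re : ℝ)‖ with hHd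
  have hHi : Integrable H := hIntg0.norm
  have hW : ∀ (j : ℕ) (t : ℝ), (j:ℝ) - 1/2 ≤ |t| → H t ≤ 128 * A * min (1 / ((j : ℝ) + 1)) (((N : ℝ) + 1) / ((j : ℝ) + 1) ^ 2) * G t := by
    intro j t ht
    have e : H t = 2 * ‖Wk N ((σ : ℂ) + t * Complex.I)‖ * G t := by
      simp only [hHd, hGd]
      rw [norm_mul, Complex.norm_real, Real.norm_eq_abs, abs_mul, Complex.neg_re, abs_neg]
      norm_num; ring
    rw [e]
    have hG0 : 0 ≤ G t := abs_nonneg _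
    apply mul_le_mul_of_nonneg_right _ hG0
    have hs1 : (((j:ℝ) + 1) / 4) ≤ ‖(σ : ℂ) + t * Complex.I‖ := by
      have h1 := Complex.abs_re_le_norm ((σ : ℂ) + t * Complex.I)
      have h2 := Complex.abs_im_le_norm ((σ : ℂ) + t * Complex.I)
      simp at h1 h2
      rw [abs_of_pos (by linarith)] at h1
      rcases Nat.eq_zero_or_pos j with h | h
      · subst h; simp; linarith
      · have : (1:ℝ) ≤ j := by exact_mod_cast h
        linarith
    have hs2 : (((j:ℝ) + 1) / 4) ≤ ‖(σ : ℂ) + t * Complex.I + 1‖ := by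
      have h1 := Complex.abs_re_le_norm ((σ : ℂ) + t * Complex.I + 1)
      have h2 := Complex.abs_im_le_norm ((σ : ℂ) + t * Complex.I + 1)
      simp at h1 h2
      rw [abs_of_pos (by linarith)] at h1
      rcases Nat.eq_zero_or_pos j with h | h
      · subst h; simp; linarith
      · have : (1:ℝ) ≤ j := by exact_mod_cast h
        linarith
    have hj1 : (0:ℝ) < (j:ℝ) + 1 := by positivity
    have b1 : ‖Wk N ((σ : ℂ) + t * Complex.I)‖ ≤ 64 * A * (1 / ((j : ℝ) + 1)) := by
      refine (Wk_bd1 N (by omega) σ t (by linarith)).trans ?_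
      calc 2 * ((N:ℝ) + 1) ^ σ / ‖(σ : ℂ) + t * Complex.I‖ ≤ 2 * A / (((j:ℝ) + 1) / 4) := by gcongr
        _ = 8 * (A * (1 / ((j : ℝ) + 1))) := by field_simp; norm_num
        _ ≤ 64 * (A * (1 / ((j : ℝ) + 1))) := by gcongr; norm_num
        _ = _ := by ring
    have b2 : ‖Wk N ((σ : ℂ) + t * Complex.I)‖ ≤ 64 * A * (((N : ℝ) + 1) / ((j : ℝ) + 1) ^ 2) := by
      refine (Wk_bd2 N (by omega) σ t (by linarith)).trans ?_
      rw [norm_div, norm_mul, norm_one, Real.rpow_add (by positivity), Real.rpow_one, ← hAd]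
      calc 4 * (A * (N + 1)) * (1 / (‖(σ : ℂ) + t * Complex.I‖ * ‖(σ : ℂ) + t * Complex.I + 1‖)) 
          ≤ 4 * (A * (N + 1)) * (1 / ((((j:ℝ) + 1) / 4) * (((j:ℝ) + 1) / 4))) := by gcongr
        _ = _ := by field_simp; norm_num
    have := le_min b1 b2
    rw [← mul_min_of_nonneg _ _ (by positivity)] at this
    linarith
  have hunit : ∀ (j : ℕ) (T : ℝ), |T| = j → ∫ t in (T - 1/2)..(T + 1/2), H t ≤ 128 * K * A * gW N D j := by
    intro j T hT
    have h1 : ∫ t in (T - 1/2)..(T + 1/2), H t ≤ ∫ t in (T - 1/2)..(T + 1/2), 128 * A * min (1 / ((j : ℝ) + 1)) (((N : ℝ) + 1) / ((j : ℝ) + 1) ^ 2) * G t := by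
      apply intervalIntegral.integral_mono_on (by linarith) hHi.intervalIntegrable ((hGc.const_mul _).intervalIntegrable _ _)
      intro t ht
      apply hW
      have : |T| - |t| ≤ |T - t| := abs_sub_abs_le_abs_sub T t
      have h2 : |T - t| ≤ 1/2 := by rw [abs_le]; constructor <;> linarith [ht.1, ht.2]
      linarith
    refine h1.trans ?_
    rw [intervalIntegral.integral_const_mul]
    have h2 := hK D χ η T hη0 hη2
    rw [← hσ] at h2
    have e : ell D T = Real.log (D * (j + 2)) := by rw [ell, hT]
    rw [e] at h2
    unfold gW
    calc _ ≤ 128 * A * min (1 / ((j : ℝ) + 1)) (((N : ℝ) + 1) / ((j : ℝ) + 1) ^ 2) * (K * Real.log (D * (j + 2))) := by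
          gcongr
      _ = _ := by ring
  have hbig : ∀ k : ℕ, ∫ t in (-((k:ℝ) + 1/2))..((k:ℝ) + 1/2), H t ≤ 2 * ∑ j ∈ Finset.range (k + 1), 128 * K * A * gW N D j := by
    intro k
    induction k with
    | zero =>
      have := hunit 0 0 (by simp)
      simp at this ⊢
      have hg : 0 ≤ gW N D 0 := by
        unfold gW
        have hD' : (1:ℝ) ≤ D := by exact_mod_cast hD
        have : 0 ≤ Real.log (D * ((0:ℕ) + 2)) := Real.log_nonneg (by push_cast; linarith)
        positivity
      have : 0 ≤ 128 * K * A * gW N D 0 := by positivity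
      linarith
    | succ k ih =>
      rw [Finset.sum_range_succ, mul_add]
      have h1 := hunit (k + 1) ((k:ℝ) + 1) (by rw [abs_of_pos (by positivity)]; push_cast; rfl)
      have h2 := hunit (k + 1) (-((k:ℝ) + 1)) (by rw [abs_neg, abs_of_pos (by positivity)]; push_cast; rfl)
      have s1 := intervalIntegral.integral_add_adjacent_intervals (μ := volume) (f := H) (a := -((k:ℝ) + 1) - 1/2) (b := -((k:ℝ) + 1) + 1/2) (c := (k:ℝ) + 1/2)
        hHi.intervalIntegrable hHi.intervalIntegrable
      have s2 := intervalIntegral.integral_add_adjacent_intervals (μ := volume) (f := H) (a := -((k:ℝ) + 1) - 1/2) (b := (k:ℝ) + 1/2) (c := (k:ℝ) + 1 + 1/2)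
        hHi.intervalIntegrable hHi.intervalIntegrable
      rw [show -((k:ℝ) + 1) + 1/2 = -((k:ℝ) + 1/2) by ring] at s1 h2
      rw [show (k:ℝ) + 1 - 1/2 = (k:ℝ) + 1/2 by ring] at h1
      push_cast
      rw [show -((k:ℝ) + 1 + 1/2) = -((k:ℝ) + 1) - 1/2 by ring]
      linarith
  have hbig2 : ∀ k : ℕ, ∫ t in (-((k:ℝ) + 1/2))..((k:ℝ) + 1/2), H t ≤ 256 * K * A * (C * L ^ 2) := by
    intro k
    refine (hbig k).trans ?_
    rw [← Finset.mul_sum]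
    have := hC N D k hN hD hDN
    calc _ ≤ 2 * (128 * K * A * (C * L ^ 2)) := by gcongr
      _ = _ := by ring
  have hlim : ∫ t, H t ≤ 256 * K * A * (C * L ^ 2) := by
    have htend : Tendsto (fun k : ℕ => (k:ℝ) + 1/2) atTop atTop := tendsto_atTop_add_const_right _ _ tendsto_natCast_atTop_atTop
    have := intervalIntegral_tendsto_integral hHi (tendsto_neg_atTop_atBot.comp htend) htend
    exact le_of_tendsto' this hbig2
  have hfin : 2 * Real.pi * ‖((∑ n ∈ Finset.Icc 1 N, χ n * (vonMangoldt n : ℂ)) - dchi χ * (N - 1))‖ ≤ 256 * K * A * (C * L ^ 2) := by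
    have h1 := norm_integral_le_integral_norm (μ := volume) (fun t : ℝ => Wk N ((σ : ℂ) + t * Complex.I) * (2 * (- logDeriv (fchi χ) ((σ : ℂ) + t * Complex.I)).re : ℝ))
    rw [← hform, norm_mul] at h1
    have e : ‖(2 * Real.pi : ℂ)‖ = 2 * Real.pi := by
      rw [norm_mul, Complex.norm_real, Real.norm_eq_abs, abs_of_pos Real.pi_pos]; simp
    rw [e] at h1
    exact h1.trans hlim
  have hpi := Real.pi_gt_three
  set E := (∑ n ∈ Finset.Icc 1 N, χ n * (vonMangoldt n : ℂ)) - dchi χ * (N - 1) with hE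
  have hE2 : ‖E‖ ≤ 256 * K * A * (C * L ^ 2) := by nlinarith [norm_nonneg E]
  have e : (∑ n ∈ Finset.Icc 1 N, χ n * (vonMangoldt n : ℂ)) - dchi χ * N = E - dchi χ := by rw [hE]; ring
  rw [e]
  refine (norm_sub_le _ _).trans ?_
  have hd : ‖(dchi χ : ℂ)‖ ≤ 1 := by
    have := dchi_le χ
    rw [Complex.norm_natCast]; exact_mod_cast this
  have hsq : 1 ≤ Real.sqrt N := by rw [show (1:ℝ) = Real.sqrt 1 by simp]; exact Real.sqrt_le_sqrt (by linarith)
  have h4 : 1 ≤ 4 * (Real.sqrt N * L ^ 2) := by nlinarith [mul_nonneg (sub_nonneg.2 hsq) (sq_nonneg L)]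
  have h5 : 256 * K * A * (C * L ^ 2) ≤ 256 * K * (4 * Real.sqrt N) * (C * L ^ 2) := by gcongr
  have h6 : 0 ≤ K * C * (Real.sqrt N * L ^ 2) := by positivity
  nlinarith

theorem conj_char_unit {D : ℕ} [NeZero D] (χ : DirichletCharacter ℂ D) {a : ZMod D} (ha : IsUnit a) :
    (starRingEnd ℂ) (χ a) = χ a⁻¹ := by
  have h1 : χ a * χ a⁻¹ = 1 := by
    rw [← map_mul, ZMod.mul_inv_of_unit a ha, map_one]
  have h2 : ‖χ a‖ = 1 := by
    obtain ⟨u, rfl⟩ := ha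
    exact DirichletCharacter.unit_norm_eq_one χ u
  have h3 : χ a * (starRingEnd ℂ) (χ a) = 1 := by
    rw [Complex.mul_conj, Complex.normSq_eq_norm_sq, h2]; simp
  have h4 : χ a ≠ 0 := by
    intro h; rw [h] at h1; simp at h1
  exact mul_left_cancel₀ h4 (h3.trans h1.symm)

open Classical in
theorem parseval_chars {D : ℕ} [NeZero D] (f : ZMod D → ℝ) (hf : ∀ b, ¬ IsUnit b → f b = 0) :
    ∑ χ : DirichletCharacter ℂ D, ‖∑ b, (f b : ℂ) * χ b‖ ^ 2 = (D.totient : ℝ) * ∑ b, f b ^ 2 := by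
  have key : ∑ χ : DirichletCharacter ℂ D, ((‖∑ b, (f b : ℂ) * χ b‖ ^ 2 : ℝ) : ℂ)
      = (D.totient : ℂ) * ∑ b, (f b : ℂ) ^ 2 := by
    have h1 : ∀ χ : DirichletCharacter ℂ D, ((‖∑ b, (f b : ℂ) * χ b‖ ^ 2 : ℝ) : ℂ)
        = ∑ a, ∑ b, (f a : ℂ) * (f b : ℂ) * (χ a⁻¹ * χ b) := by
      intro χ
      rw [← Complex.normSq_eq_norm_sq, Complex.normSq_eq_conj_mul_self, map_sum, Finset.sum_mul_sum]
      refine Finset.sum_congr rfl fun a _ => Finset.sum_congr rfl fun b _ => ?_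
      by_cases ha : IsUnit a
      · rw [map_mul, conj_char_unit χ ha, Complex.conj_ofReal]; ring
      · rw [hf a ha]; simp
    simp_rw [h1]
    rw [Finset.sum_comm, Finset.mul_sum]
    refine Finset.sum_congr rfl fun a _ => ?_
    rw [Finset.sum_comm]
    simp_rw [← Finset.mul_sum]
    by_cases ha : IsUnit a
    · simp_rw [DirichletCharacter.sum_char_inv_mul_char_eq ℂ ha]
      simp
      ring
    · rw [hf a ha]; simp
  exact_mod_cast key

theorem card_chars (D : ℕ) [NeZero D] : Fintype.card (DirichletCharacter ℂ D) = D.totient := by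
  rw [← Nat.card_eq_fintype_card]
  exact DirichletCharacter.card_eq_totient_of_hasEnoughRootsOfUnity ℂ D

open Classical in
noncomputable def apE (D N : ℕ) (b : ZMod D) : ℝ :=
  if IsUnit b then (∑ n ∈ (Finset.Icc 1 N).filter (fun n : ℕ => (n : ZMod D) = b), vonMangoldt n)
    - N / (D.totient : ℝ) else 0

open Classical in
theorem apE_hat {D : ℕ} [NeZero D] (N : ℕ) (χ : DirichletCharacter ℂ D) :
    ∑ b, (apE D N b : ℂ) * χ b
      = (∑ n ∈ Finset.Icc 1 N, χ n * (vonMangoldt n : ℂ)) - dchi χ * N := by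
  have h0 : ∀ b : ZMod D, (apE D N b : ℂ) * χ b
      = (∑ n ∈ (Finset.Icc 1 N).filter (fun n : ℕ => (n : ZMod D) = b), χ n * (vonMangoldt n : ℂ))
        - (N / (D.totient : ℂ)) * χ b := by
    intro b
    have h2 : (∑ n ∈ (Finset.Icc 1 N).filter (fun n : ℕ => (n : ZMod D) = b), χ n * (vonMangoldt n : ℂ))
        = (∑ n ∈ (Finset.Icc 1 N).filter (fun n : ℕ => (n : ZMod D) = b), (vonMangoldt n : ℂ)) * χ b := by
      rw [Finset.sum_mul]
      refine Finset.sum_congr rfl fun n hn => ?_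
      rw [(Finset.mem_filter.1 hn).2]; ring
    rw [h2]
    unfold apE
    split_ifs with hb
    · push_cast; ring
    · rw [χ.map_nonunit hb]; simp
  simp_rw [h0]
  rw [Finset.sum_sub_distrib, Finset.sum_fiberwise, ← Finset.mul_sum]
  congr 1
  unfold dchi
  split_ifs with h
  · rw [h, MulChar.sum_one_eq_card_units]
    rw [ZMod.card_units_eq_totient]
    have : (D.totient : ℂ) ≠ 0 := by
      exact_mod_cast (Nat.totient_pos.2 (NeZero.pos D)).ne'
    push_cast
    field_simp
  · rw [MulChar.sum_eq_zero_of_ne_one h]; simp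

theorem ap_bound (hG : GRH) : ∃ C : ℝ, 0 < C ∧ ∀ (N D : ℕ) [NeZero D], 2 ≤ N → D ≤ N →
    ∑ b : ZMod D, apE D N b ^ 2 ≤ (C * (Real.sqrt N * (Real.log N) ^ 2)) ^ 2 := by
  classical
  obtain ⟨C, hC, h⟩ := psi_bound hG
  refine ⟨C, hC, fun N D _ hN hD => ?_⟩
  have h1 := parseval_chars (apE D N) (fun b hb => by unfold apE; rw [if_neg hb])
  simp_rw [apE_hat] at h1
  have hpos : (0:ℝ) < D.totient := by exact_mod_cast (Nat.totient_pos.2 (NeZero.pos D))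
  have h2 : (D.totient : ℝ) * ∑ b, apE D N b ^ 2
      ≤ (D.totient : ℝ) * (C * (Real.sqrt N * (Real.log N) ^ 2)) ^ 2 := by
    rw [← h1]
    refine (Finset.sum_le_card_nsmul _ _ ((C * (Real.sqrt N * (Real.log N) ^ 2)) ^ 2) ?_).trans ?_
    · intro χ _
      exact pow_le_pow_left₀ (norm_nonneg _) (h N D χ hN hD) 2
    · rw [Finset.card_univ, card_chars, nsmul_eq_mul]
  exact le_of_mul_le_mul_left h2 hpos

/-- prime-power sum over n not coprime to d -/
theorem sum_noncoprime (d N : ℕ) (hd : 1 ≤ d) (hdN : d ≤ N) :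
    ∑ n ∈ (Finset.Icc 1 N).filter (fun n => ¬ n.Coprime d), vonMangoldt n ≤ 2 * (Real.log N) ^ 2 := by
  have hN : 1 ≤ N := hd.trans hdN
  set M := ∏ p ∈ d.primeFactors, p ^ (Nat.log p N) with hM
  have hM0 : M ≠ 0 := by
    refine Finset.prod_ne_zero_iff.2 fun p hp => ?_
    exact pow_ne_zero _ (Nat.prime_of_mem_primeFactors hp).ne_zero
  have h1 : ∑ n ∈ (Finset.Icc 1 N).filter (fun n => ¬ n.Coprime d), vonMangoldt n
      ≤ ∑ n ∈ M.divisors, vonMangoldt n := by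
    rw [← Finset.sum_filter_ne_zero]
    refine Finset.sum_le_sum_of_subset_of_nonneg ?_ fun _ _ _ => vonMangoldt_nonneg
    intro n hn
    rw [Finset.mem_filter, Finset.mem_filter, Finset.mem_Icc] at hn
    obtain ⟨hn, h0⟩ := hn
    have hpp := vonMangoldt_ne_zero_iff.1 h0
    obtain ⟨p, j, hp, hj, rfl⟩ := (isPrimePow_nat_iff _).1 hpp
    have hpd : p ∣ d := by
      by_contra hcon
      exact hn.2 (Nat.Coprime.pow_left _ ((Nat.Prime.coprime_iff_not_dvd hp).2 hcon))
    rw [Nat.mem_divisors]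
    refine ⟨?_, hM0⟩
    have hmem : p ∈ d.primeFactors := Nat.mem_primeFactors.2 ⟨hp, hpd, by omega⟩
    refine dvd_trans ?_ (Finset.dvd_prod_of_mem (fun p => p ^ (Nat.log p N)) hmem)
    exact pow_dvd_pow _ (Nat.le_log_of_pow_le hp.one_lt hn.1.2)
  refine h1.trans ?_
  rw [vonMangoldt_sum, hM]
  push_cast
  rw [Real.log_prod (fun p hp => by
    have := (Nat.prime_of_mem_primeFactors hp).ne_zero
    positivity)]
  have hlN : 0 ≤ Real.log N := Real.log_nonneg (by exact_mod_cast hN)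
  have h2 : ∀ p ∈ d.primeFactors, Real.log ((p:ℝ) ^ (Nat.log p N)) ≤ Real.log N := by
    intro p hp
    have hp' := Nat.prime_of_mem_primeFactors hp
    apply Real.log_le_log
    · have := hp'.pos
      positivity
    · exact_mod_cast Nat.pow_log_le_self p (by omega)
  refine (Finset.sum_le_card_nsmul _ _ _ h2).trans ?_
  rw [nsmul_eq_mul]
  have h3 : (2:ℝ) ^ d.primeFactors.card ≤ N := by
    have h4 : 2 ^ d.primeFactors.card ≤ ∏ p ∈ d.primeFactors, p :=
      Finset.pow_card_le_prod _ _ _ (fun p hp => (Nat.prime_of_mem_primeFactors hp).two_le)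
    have h5 : ∏ p ∈ d.primeFactors, p ≤ d := Nat.le_of_dvd (by omega) (Nat.prod_primeFactors_dvd d)
    exact_mod_cast (h4.trans h5).trans hdN
  have h6 := Real.log_le_log (by positivity) h3
  rw [Real.log_pow] at h6
  have h7 : (0.5:ℝ) ≤ Real.log 2 := by linarith [Real.log_two_gt_d9]
  have h8 : (d.primeFactors.card : ℝ) ≤ 2 * Real.log N := by
    have : (0:ℝ) ≤ d.primeFactors.card := by positivity
    nlinarith
  nlinarith

noncomputable def apA (q a d N e k : ℕ) : ℝ :=
  ∑ n ∈ (Finset.Icc 1 N).filter (fun n : ℕ => (n : ZMod q) = (a : ZMod q) ∧ n ≡ k * e [MOD d]),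
    vonMangoldt n

theorem apA_nonneg (q a d N e k : ℕ) : 0 ≤ apA q a d N e k :=
  Finset.sum_nonneg fun _ _ => vonMangoldt_nonneg

theorem card_mult (q K : ℕ) (hq : 1 ≤ q) : (((Finset.Icc 1 K).filter (fun k => q ∣ k)).card : ℝ) ≤ K / q := by
  have : ((Finset.Icc 1 K).filter (fun k => q ∣ k)).card = K / q := by
    have := Nat.Ioc_filter_dvd_card_eq_div K q
    rwa [show Finset.Ioc 0 K = Finset.Icc 1 K from rfl] at this
  rw [this]; exact Nat.cast_div_le

theorem apA_noncop (q a d N e k : ℕ) (hd : 1 ≤ d) (hdN : d ≤ N) (hk : ¬ k.Coprime d) :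
    apA q a d N e k ≤ 2 * (Real.log N) ^ 2 := by
  refine le_trans ?_ (sum_noncoprime d N hd hdN)
  refine Finset.sum_le_sum_of_subset_of_nonneg ?_ fun _ _ _ => vonMangoldt_nonneg
  intro n hn
  rw [Finset.mem_filter] at hn ⊢
  refine ⟨hn.1, fun hc => hk ?_⟩
  have : (k * e).Coprime d := by
    have := hn.2.2.gcd_eq
    unfold Nat.Coprime at hc ⊢
    omega
  exact Nat.Coprime.coprime_mul_right this

theorem apA_cop (q a d N e k : ℕ) (hqd : q.Coprime d) (ha : a.Coprime q) (he : e.Coprime d) (hk : k.Coprime d) :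
    apA q a d N e k - N / ((q * d).totient : ℝ) = apE (q * d) N (((Nat.chineseRemainder hqd a (k * e) : ℕ)) : ZMod (q * d)) := by
  set c := Nat.chineseRemainder hqd a (k * e) with hc
  have hu : IsUnit ((c : ℕ) : ZMod (q * d)) := by
    rw [ZMod.isUnit_iff_coprime]
    apply Nat.Coprime.mul_right
    · have := c.2.1.gcd_eq
      unfold Nat.Coprime at ha ⊢; omega
    · have := c.2.2.gcd_eq
      have h2 := Nat.Coprime.mul_left hk he
      unfold Nat.Coprime at h2 ⊢; omega
  unfold apE
  rw [if_pos hu]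
  congr 1
  unfold apA
  apply Finset.sum_congr _ (fun _ _ => rfl)
  refine Finset.filter_congr fun n _ => ?_
  rw [ZMod.natCast_eq_natCast_iff, ZMod.natCast_eq_natCast_iff, ← Nat.modEq_and_modEq_iff_modEq_mul hqd]
  constructor
  · rintro ⟨h1, h2⟩
    exact ⟨h1.trans c.2.1.symm, h2.trans c.2.2.symm⟩
  · rintro ⟨h1, h2⟩
    exact ⟨h1.trans c.2.1, h2.trans c.2.2⟩

theorem claimE (hG : GRH) : ∃ C : ℝ, 0 < C ∧ ∀ (q a d N e K : ℕ), 1 ≤ q → 1 ≤ d → 2 ≤ N → q * d ≤ N → K ≤ N →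
    q.Coprime d → a.Coprime q → e.Coprime d →
    ∑ k ∈ (Finset.Icc 1 K).filter (fun k => q ∣ k),
      |apA q a d N e k - if k.Coprime d then N / ((q * d).totient : ℝ) else 0|
      ≤ C * (Real.sqrt N * (Real.log N) ^ 2) * ((K / q : ℝ) / Real.sqrt d + Real.sqrt (K / q : ℝ)) := by
  classical
  obtain ⟨C, hC, hap⟩ := ap_bound hG
  refine ⟨C + 2, by positivity, fun q a d N e K hq hd hN hqdN hKN hqd ha he => ?_⟩
  have : NeZero (q * d) := ⟨by positivity⟩
  set F := (Finset.Icc 1 K).filter (fun k => q ∣ k) with hF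
  set B := C * (Real.sqrt N * (Real.log N) ^ 2) with hB
  have hB0 : 0 ≤ B := by positivity
  have hap' := hap N (q * d) hN hqdN
  have hFcard : (F.card : ℝ) ≤ K / q := card_mult q K hq
  have hq0 : (0:ℝ) < q := by exact_mod_cast hq
  have hd0 : (0:ℝ) < d := by exact_mod_cast hd
  set c : ℕ → ZMod (q * d) := fun k => (((Nat.chineseRemainder hqd a (k * e) : ℕ)) : ZMod (q * d)) with hc
  rw [← Finset.sum_filter_add_sum_filter_not F (fun k => k.Coprime d)]
  have h1 : ∑ k ∈ F.filter (fun k => k.Coprime d),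
      |apA q a d N e k - if k.Coprime d then N / ((q * d).totient : ℝ) else 0|
      = ∑ k ∈ F.filter (fun k => k.Coprime d), |apE (q * d) N (c k)| := by
    refine Finset.sum_congr rfl fun k hk => ?_
    have hk' := (Finset.mem_filter.1 hk).2
    rw [if_pos hk', apA_cop q a d N e k hqd ha he hk']
  have h2 : ∑ k ∈ F.filter (fun k => k.Coprime d), (apE (q * d) N (c k)) ^ 2
      ≤ (K / (q * d) + 1) * B ^ 2 := by
    rw [← Finset.sum_fiberwise (F.filter (fun k => k.Coprime d)) c]
    refine le_trans ?_ (mul_le_mul_of_nonneg_left hap' (by positivity))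
    rw [Finset.mul_sum]
    refine Finset.sum_le_sum fun b _ => ?_
    have h3 : ∑ k ∈ (F.filter (fun k => k.Coprime d)).filter (fun k => c k = b), (apE (q * d) N (c k)) ^ 2
        = ((F.filter (fun k => k.Coprime d)).filter (fun k => c k = b)).card * (apE (q * d) N b) ^ 2 := by
      rw [← nsmul_eq_mul, ← Finset.sum_const]
      refine Finset.sum_congr rfl fun k hk => ?_
      rw [(Finset.mem_filter.1 hk).2]
    rw [h3]
    refine mul_le_mul_of_nonneg_right ?_ (sq_nonneg _)
    have h4 : ((F.filter (fun k => k.Coprime d)).filter (fun k => c k = b)).card ≤ (Finset.range (K / (q * d) + 1)).card := by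
      refine Finset.card_le_card_of_injOn (fun k => k / (q * d)) ?_ ?_
      · intro k hk
        simp only [Finset.coe_filter, Finset.mem_filter, hF, Finset.mem_Icc, Set.mem_ofPred_eq] at hk
        simp only [Finset.coe_range, Set.mem_Iio]
        exact Nat.lt_succ_of_le (Nat.div_le_div_right hk.1.1.1.2)
      · intro k hk k' hk' hkk
        simp only [Finset.coe_filter, Finset.mem_filter, hF, Finset.mem_Icc, Set.mem_ofPred_eq] at hk hk' hkk
        have h5 : c k = c k' := hk.2.trans hk'.2.symm
        simp only [hc] at h5
        rw [ZMod.natCast_eq_natCast_iff, ← Nat.modEq_and_modEq_iff_modEq_mul hqd] at h5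
        have h6 : k * e ≡ k' * e [MOD d] :=
          ((Nat.chineseRemainder hqd a (k * e)).2.2.symm.trans h5.2).trans (Nat.chineseRemainder hqd a (k' * e)).2.2
        have h7 : k ≡ k' [MOD d] := Nat.ModEq.cancel_right_of_coprime (by rw [Nat.gcd_comm]; exact he) h6
        have h8 : k ≡ k' [MOD q] :=
          ((Nat.modEq_zero_iff_dvd).2 hk.1.1.2).trans ((Nat.modEq_zero_iff_dvd).2 hk'.1.1.2).symm
        have h9 : k ≡ k' [MOD q * d] := (Nat.modEq_and_modEq_iff_modEq_mul hqd).1 ⟨h8, h7⟩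
        rw [← Nat.div_add_mod k (q * d), ← Nat.div_add_mod k' (q * d), hkk, h9]
    have h5 : ((K / (q * d) : ℕ) : ℝ) ≤ (K:ℝ) / ((q:ℝ) * d) := by
      have := @Nat.cast_div_le ℝ _ _ _ K (q * d)
      push_cast at this; exact this
    rw [Finset.card_range] at h4
    have h4' : (((F.filter (fun k => k.Coprime d)).filter (fun k => c k = b)).card : ℝ) ≤ ((K / (q * d) : ℕ) : ℝ) + 1 := by
      exact_mod_cast h4
    linarith
  set k0 : ℝ := (K:ℝ) / q with hk0
  have hk00 : 0 ≤ k0 := by positivity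
  have h6 : ∑ k ∈ F.filter (fun k => k.Coprime d), |apE (q * d) N (c k)|
      ≤ B * (k0 / Real.sqrt d + Real.sqrt k0) := by
    have hcs := Finset.sum_mul_sq_le_sq_mul_sq (F.filter (fun k => k.Coprime d)) (fun _ => (1:ℝ)) (fun k => |apE (q * d) N (c k)|)
    simp only [one_mul, one_pow, sq_abs, Finset.sum_const, nsmul_eq_mul, mul_one] at hcs
    have hcard : ((F.filter (fun k => k.Coprime d)).card : ℝ) ≤ k0 :=
      le_trans (by exact_mod_cast Finset.card_filter_le _ _) hFcard
    refine (pow_le_pow_iff_left₀ (Finset.sum_nonneg fun _ _ => abs_nonneg _) (by positivity) two_ne_zero).1 ?_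
    refine hcs.trans ((mul_le_mul hcard h2 (Finset.sum_nonneg fun _ _ => sq_nonneg _) hk00).trans ?_)
    have e1 : (k0 / Real.sqrt d + Real.sqrt k0) ^ 2 = k0 * (k0 / d) + 2 * (k0 / Real.sqrt d) * Real.sqrt k0 + k0 := by
      rw [add_sq, Real.sq_sqrt hk00, div_pow, Real.sq_sqrt hd0.le]; ring
    have e2 : (K:ℝ) / (q * d) = k0 / d := by rw [hk0, div_div]
    rw [mul_pow B, e1, e2]
    have e3 : 0 ≤ 2 * (k0 / Real.sqrt d) * Real.sqrt k0 * B ^ 2 := by positivity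
    nlinarith
  have h7 : ∑ k ∈ F.filter (fun k => ¬ k.Coprime d),
      |apA q a d N e k - if k.Coprime d then N / ((q * d).totient : ℝ) else 0|
      ≤ k0 * (2 * (Real.log N) ^ 2) := by
    have hdN : d ≤ N := le_trans (Nat.le_mul_of_pos_left d hq) hqdN
    have : ∀ k ∈ F.filter (fun k => ¬ k.Coprime d),
      |apA q a d N e k - if k.Coprime d then N / ((q * d).totient : ℝ) else 0| ≤ 2 * (Real.log N) ^ 2 := by
      intro k hk
      have hk' := (Finset.mem_filter.1 hk).2
      rw [if_neg hk', sub_zero, abs_of_nonneg (apA_nonneg _ _ _ _ _ _)]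
      exact apA_noncop q a d N e k hd hdN hk'
    refine (Finset.sum_le_card_nsmul _ _ _ this).trans ?_
    rw [nsmul_eq_mul]
    refine mul_le_mul_of_nonneg_right (le_trans (by exact_mod_cast Finset.card_filter_le _ _) hFcard) (by positivity)
  have h8 : k0 ≤ Real.sqrt N * Real.sqrt k0 := by
    have : k0 ≤ N := by
      rw [hk0, div_le_iff₀ hq0]
      have : (K:ℝ) ≤ N := by exact_mod_cast hKN
      have : (1:ℝ) ≤ q := by exact_mod_cast hq
      nlinarith [(Nat.cast_nonneg N : (0:ℝ) ≤ N)]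
    calc k0 = Real.sqrt k0 * Real.sqrt k0 := (Real.mul_self_sqrt hk00).symm
      _ ≤ _ := by gcongr
  rw [h1]
  refine (add_le_add h6 h7).trans ?_
  have h9 : k0 * (2 * (Real.log N) ^ 2) ≤ 2 * (Real.sqrt N * (Real.log N) ^ 2) * Real.sqrt k0 := by
    nlinarith [mul_le_mul_of_nonneg_right h8 (sq_nonneg (Real.log N))]
  have h10 : 0 ≤ 2 * (Real.sqrt N * (Real.log N) ^ 2) * (k0 / Real.sqrt d) := by positivity
  rw [hB]
  nlinarith

theorem totient_prod_real (n : ℕ) : (n.totient : ℝ) = n * ∏ p ∈ n.primeFactors, (1 - (p:ℝ)⁻¹) := by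
  have := Nat.totient_eq_mul_prod_factors n
  have h2 := congrArg (fun z : ℚ => (z : ℝ)) this
  push_cast at h2
  exact h2

noncomputable def phiF (n : ℕ) : ℝ := ((n:ℝ) / n.totient) ^ 2

theorem phiF_local (p : ℕ) (hp : 2 ≤ p) : ((1 - (p:ℝ)⁻¹)⁻¹) ^ 2 ≤ (1 + 1 / Real.sqrt p) * (1 + 512 / (p:ℝ) ^ 2) := by
  have hp2 : (2:ℝ) ≤ p := by exact_mod_cast hp
  set P : ℝ := (p : ℝ)
  have hP : 0 < P := by linarith
  set s := Real.sqrt P with hs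
  have hs0 : 0 < s := Real.sqrt_pos.2 hP
  have hs2 : s ^ 2 = P := Real.sq_sqrt hP.le
  have h1 : ((1 - P⁻¹)⁻¹) ^ 2 ≤ 1 + 8 / P := by
    have : (1 - P⁻¹)⁻¹ = P / (P - 1) := by
      have : P - 1 ≠ 0 := by linarith
      field_simp
    rw [this, div_pow, div_le_iff₀ (by nlinarith)]
    have h3 : 0 ≤ (1 + 8 / P) * (P - 1) ^ 2 - P ^ 2 := by
      have : (1 + 8 / P) * (P - 1) ^ 2 - P ^ 2 = (6 * P ^ 2 - 15 * P + 8) / P := by field_simp; ring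
      rw [this]
      apply div_nonneg _ hP.le
      nlinarith
    linarith
  have h2 : 8 / P ≤ 1 / s + 512 / P ^ 2 := by
    by_cases h8 : 8 ≤ s
    · have : 8 / P ≤ 1 / s := by
        rw [← hs2, div_le_div_iff₀ (by positivity) hs0]; nlinarith
      have : 0 ≤ 512 / P ^ 2 := by positivity
      linarith
    · push Not at h8
      have h64 : P ≤ 64 := by nlinarith
      have : 8 / P ≤ 512 / P ^ 2 := by
        rw [div_le_div_iff₀ hP (by positivity)]; nlinarith
      have : 0 ≤ 1 / s := by positivity
      linarith
  have h3 : 0 ≤ 1 / s * (512 / P ^ 2) := by positivity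
  nlinarith

theorem sum_inv_sq_le (M : ℕ) : ∑ n ∈ Finset.Icc 1 M, 1 / (n:ℝ) ^ 2 ≤ 2 := by
  have h : ∀ M : ℕ, ∑ n ∈ Finset.Icc 1 (M+1), 1 / (n:ℝ) ^ 2 ≤ 2 - 1 / ((M:ℝ) + 1) := by
    intro M
    induction M with
    | zero => norm_num
    | succ k ih =>
      rw [Finset.sum_Icc_succ_top (by omega)]
      have : 1 / (((k + 1 + 1 : ℕ):ℝ)) ^ 2 ≤ 1 / ((k:ℝ) + 1) - 1 / (((k+1:ℕ):ℝ) + 1) := by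
        push_cast
        rw [div_sub_div _ _ (by positivity) (by positivity), div_le_div_iff₀ (by positivity) (by positivity)]
        have : (0:ℝ) ≤ k := by positivity
        nlinarith
      linarith
  rcases M with _ | M
  · simp
  · have := h M
    have h2 : 0 ≤ 1 / ((M:ℝ) + 1) := by positivity
    linarith

noncomputable def kap (n : ℕ) : ℝ := ∑ t ∈ n.divisors, 1 / Real.sqrt t

theorem prod_sqrt_le_kap (n : ℕ) (hn : n ≠ 0) : ∏ p ∈ n.primeFactors, (1 + 1 / Real.sqrt p) ≤ kap n := by
  rw [Finset.prod_one_add]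
  unfold kap
  have : ∀ T ∈ n.primeFactors.powerset, ∏ p ∈ T, 1 / Real.sqrt p = 1 / Real.sqrt ((∏ p ∈ T, p : ℕ) : ℝ) := by
    intro T _
    rw [Finset.prod_div_distrib]
    push_cast
    rw [Real.sqrt_prod _ (fun i _ => Nat.cast_nonneg i)]
    simp
  rw [Finset.sum_congr rfl this]
  have hinj : Set.InjOn (fun T : Finset ℕ => ∏ p ∈ T, p) (n.primeFactors.powerset : Set (Finset ℕ)) := by
    intro T hT T' hT' h
    simp only [Finset.coe_powerset, Set.mem_preimage, Set.mem_powerset_iff, Finset.coe_subset] at hT hT'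
    have h1 := Nat.primeFactors_prod (s := T) (fun p hp => Nat.prime_of_mem_primeFactors (hT hp))
    have h2 := Nat.primeFactors_prod (s := T') (fun p hp => Nat.prime_of_mem_primeFactors (hT' hp))
    rw [← h1, ← h2]
    simp only at h
    rw [h]
  rw [← Finset.sum_image (s := n.primeFactors.powerset) (g := fun T : Finset ℕ => ∏ p ∈ T, p) (f := fun t : ℕ => 1 / Real.sqrt (t:ℝ)) hinj]
  refine Finset.sum_le_sum_of_subset_of_nonneg ?_ fun _ _ _ => by positivity
  intro t ht
  obtain ⟨T, hT, rfl⟩ := Finset.mem_image.1 ht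
  rw [Nat.mem_divisors]
  exact ⟨(Finset.prod_dvd_prod_of_subset _ _ _ (Finset.mem_powerset.1 hT)).trans (Nat.prod_primeFactors_dvd n), hn⟩

theorem phiF_le_kap (n : ℕ) (hn : n ≠ 0) : phiF n ≤ Real.exp 1024 * kap n := by
  have hn0 : (n:ℝ) ≠ 0 := by exact_mod_cast hn
  have h1 : phiF n = ∏ p ∈ n.primeFactors, ((1 - (p:ℝ)⁻¹)⁻¹) ^ 2 := by
    unfold phiF
    rw [totient_prod_real, Finset.prod_pow, Finset.prod_inv_distrib]
    congr 1
    rw [div_mul_eq_div_div, div_self hn0, one_div]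
  have h2 : phiF n ≤ ∏ p ∈ n.primeFactors, ((1 + 1 / Real.sqrt p) * (1 + 512 / (p:ℝ) ^ 2)) := by
    rw [h1]
    exact Finset.prod_le_prod (fun p _ => sq_nonneg _) (fun p hp => phiF_local p (Nat.prime_of_mem_primeFactors hp).two_le)
  rw [Finset.prod_mul_distrib] at h2
  have h3 : ∏ p ∈ n.primeFactors, (1 + 512 / (p:ℝ) ^ 2) ≤ Real.exp 1024 := by
    have : ∏ p ∈ n.primeFactors, (1 + 512 / (p:ℝ) ^ 2) ≤ ∏ p ∈ n.primeFactors, Real.exp (512 / (p:ℝ) ^ 2) := by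
      refine Finset.prod_le_prod (fun p _ => by positivity) fun p _ => ?_
      rw [add_comm]; exact Real.add_one_le_exp _
    refine this.trans ?_
    rw [← Real.exp_sum]
    apply Real.exp_le_exp.2
    have h4 : ∑ p ∈ n.primeFactors, 1 / (p:ℝ) ^ 2 ≤ ∑ p ∈ Finset.Icc 1 n, 1 / (p:ℝ) ^ 2 := by
      refine Finset.sum_le_sum_of_subset_of_nonneg ?_ fun _ _ _ => by positivity
      intro p hp
      rw [Finset.mem_Icc]
      exact ⟨(Nat.prime_of_mem_primeFactors hp).one_le, Nat.le_of_mem_primeFactors hp⟩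
    have h5 := sum_inv_sq_le n
    have h6 : ∑ p ∈ n.primeFactors, 512 / (p:ℝ) ^ 2 = 512 * ∑ p ∈ n.primeFactors, 1 / (p:ℝ) ^ 2 := by
      rw [Finset.mul_sum]; refine Finset.sum_congr rfl fun p _ => by ring
    rw [h6]; linarith
  have h4 := prod_sqrt_le_kap n hn
  refine h2.trans ?_
  rw [mul_comm]
  refine mul_le_mul h3 h4 (Finset.prod_nonneg fun p _ => by positivity) (Real.exp_pos _).le

theorem sum_multiples (a b t : ℕ) (ht : 1 ≤ t) (g : ℕ → ℝ) :
    ∑ n ∈ (Finset.Ioc a b).filter (fun n => t ∣ n), g n = ∑ m ∈ Finset.Ioc (a / t) (b / t), g (t * m) := by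
  symm
  refine Finset.sum_bij (fun m _ => t * m) ?_ ?_ ?_ ?_
  · intro m hm
    rw [Finset.mem_Ioc] at hm
    rw [Finset.mem_filter, Finset.mem_Ioc]
    refine ⟨⟨?_, ?_⟩, dvd_mul_right _ _⟩
    · have := (Nat.div_lt_iff_lt_mul (by omega)).1 hm.1
      rwa [mul_comm] at this
    · have := (Nat.le_div_iff_mul_le (by omega)).1 hm.2
      rwa [mul_comm] at this
  · intro m _ m' _ h
    exact Nat.eq_of_mul_eq_mul_left (by omega) h
  · intro n hn
    rw [Finset.mem_filter, Finset.mem_Ioc] at hn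
    obtain ⟨⟨h1, h2⟩, m, rfl⟩ := hn
    refine ⟨m, ?_, rfl⟩
    rw [Finset.mem_Ioc]
    exact ⟨(Nat.div_lt_iff_lt_mul (by omega)).2 (by rwa [mul_comm] at h1), (Nat.le_div_iff_mul_le (by omega)).2 (by rwa [mul_comm] at h2)⟩
  · intro m _; rfl

theorem sum_three_half' (M : ℕ) : ∑ t ∈ Finset.Icc 1 M, 1 / ((t:ℝ) * Real.sqrt t) ≤ 3 := by
  rcases M with _ | M
  · simp
  have h := sum_three_half 1 (M+1) le_rfl
  rw [← Finset.add_sum_Ioc_eq_sum_Icc (by omega)]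
  simp at h ⊢
  linarith

theorem phiF_sum (a b : ℕ) (g : ℕ → ℝ) (B : ℝ) (hg : ∀ n, 0 ≤ g n)
    (hB : ∀ t, 1 ≤ t → ∑ m ∈ Finset.Ioc (a / t) (b / t), g (t * m) ≤ B / t) :
    ∑ n ∈ Finset.Ioc a b, phiF n * g n ≤ 3 * Real.exp 1024 * B := by
  have hB0 : 0 ≤ B := by
    have := hB 1 le_rfl
    simp only [Nat.cast_one, div_one] at this
    exact le_trans (Finset.sum_nonneg fun _ _ => hg _) this
  have h1 : ∑ n ∈ Finset.Ioc a b, phiF n * g n ≤ Real.exp 1024 * ∑ n ∈ Finset.Ioc a b, kap n * g n := by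
    rw [Finset.mul_sum]
    refine Finset.sum_le_sum fun n hn => ?_
    rw [Finset.mem_Ioc] at hn
    rw [← mul_assoc]
    exact mul_le_mul_of_nonneg_right (phiF_le_kap n (by omega)) (hg n)
  have h2 : ∑ n ∈ Finset.Ioc a b, kap n * g n = ∑ t ∈ Finset.Icc 1 b, 1 / Real.sqrt t * ∑ n ∈ (Finset.Ioc a b).filter (fun n => t ∣ n), g n := by
    unfold kap
    simp_rw [Finset.sum_mul, Finset.mul_sum]
    refine Finset.sum_comm' ?_
    intro n t
    simp only [Nat.mem_divisors, Finset.mem_Ioc, Finset.mem_filter, Finset.mem_Icc]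
    constructor
    · rintro ⟨⟨h1, h2⟩, h3, h4⟩
      exact ⟨⟨⟨h1, h2⟩, h3⟩, Nat.pos_of_dvd_of_pos h3 (by omega), (Nat.le_of_dvd (by omega) h3).trans h2⟩
    · rintro ⟨⟨⟨h1, h2⟩, h3⟩, h4⟩
      exact ⟨⟨h1, h2⟩, h3, by omega⟩
  have h3 : ∑ n ∈ Finset.Ioc a b, kap n * g n ≤ 3 * B := by
    rw [h2]
    calc _ ≤ ∑ t ∈ Finset.Icc 1 b, (1 / ((t:ℝ) * Real.sqrt t)) * B := by
          refine Finset.sum_le_sum fun t ht => ?_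
          rw [Finset.mem_Icc] at ht
          rw [sum_multiples a b t ht.1]
          calc _ ≤ 1 / Real.sqrt t * (B / t) := mul_le_mul_of_nonneg_left (hB t ht.1) (by positivity)
            _ = _ := by ring
      _ ≤ _ := by
        rw [← Finset.sum_mul]
        exact mul_le_mul_of_nonneg_right (sum_three_half' b) hB0
  calc _ ≤ Real.exp 1024 * (3 * B) := h1.trans (mul_le_mul_of_nonneg_left h3 (Real.exp_pos _).le)
    _ = _ := by ring

noncomputable def KK : ℝ := 3 * Real.exp 1024

theorem KK_pos : 0 < KK := by unfold KK; positivity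

theorem sum_inv_sqrt_le (M : ℕ) : ∑ m ∈ Finset.Ioc 0 M, 1 / Real.sqrt m ≤ 2 * Real.sqrt M := by
  induction M with
  | zero => simp
  | succ k ih =>
    rw [Finset.sum_Ioc_succ_top (by omega)]
    have : 1 / Real.sqrt ((k+1 : ℕ):ℝ) ≤ 2 * Real.sqrt ((k+1:ℕ):ℝ) - 2 * Real.sqrt k := by
      have h1 : (0:ℝ) < ((k+1:ℕ):ℝ) := by positivity
      have h2 := Real.sq_sqrt h1.le
      have h3 := Real.sq_sqrt (Nat.cast_nonneg k : (0:ℝ) ≤ (k:ℝ))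
      have h4 := Real.sqrt_pos.2 h1
      have h5 := Real.sqrt_nonneg (k:ℝ)
      rw [div_le_iff₀ h4]
      push_cast at *
      nlinarith [sq_nonneg (Real.sqrt ((k:ℝ)+1) - Real.sqrt k)]
    linarith

theorem phiF_nonneg (n : ℕ) : 0 ≤ phiF n := sq_nonneg _

theorem phiF_sum_sqrt (Y : ℕ) : ∑ n ∈ Finset.Ioc 0 Y, phiF n * (1 / Real.sqrt n) ≤ KK * (2 * Real.sqrt Y) := by
  refine phiF_sum 0 Y (fun n => 1 / Real.sqrt n) _ (fun n => by positivity) ?_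
  intro t ht
  have ht0 : (0:ℝ) < t := by exact_mod_cast ht
  rw [Nat.zero_div]
  have h1 : ∀ m ∈ Finset.Ioc 0 (Y / t), 1 / Real.sqrt ((t * m : ℕ):ℝ) = 1 / Real.sqrt t * (1 / Real.sqrt m) := by
    intro m _
    push_cast
    rw [Real.sqrt_mul ht0.le]; ring
  rw [Finset.sum_congr rfl h1, ← Finset.mul_sum]
  have h2 := sum_inv_sqrt_le (Y / t)
  have h3 : Real.sqrt ((Y / t : ℕ):ℝ) ≤ Real.sqrt Y / Real.sqrt t := by
    rw [← Real.sqrt_div' _ ht0.le]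
    exact Real.sqrt_le_sqrt Nat.cast_div_le
  calc _ ≤ 1 / Real.sqrt t * (2 * (Real.sqrt Y / Real.sqrt t)) :=
        mul_le_mul_of_nonneg_left (h2.trans (by linarith)) (by positivity)
    _ = 2 * Real.sqrt Y / (Real.sqrt t * Real.sqrt t) := by field_simp
    _ = _ := by rw [Real.mul_self_sqrt ht0.le]

theorem phiF_sum_one (Y : ℕ) : ∑ n ∈ Finset.Ioc 0 Y, phiF n ≤ KK * Y := by
  have := phiF_sum 0 Y (fun n => 1) Y (fun n => by positivity) ?_
  · simpa [KK] using this
  intro t ht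
  simp
  exact Nat.cast_div_le

theorem phiF_sum_three_half (Y : ℕ) : ∑ n ∈ Finset.Ioc 0 Y, phiF n * (1 / ((n:ℝ) * Real.sqrt n)) ≤ KK * 3 := by
  refine phiF_sum 0 Y (fun n => 1 / ((n:ℝ) * Real.sqrt n)) _ (fun n => by positivity) ?_
  intro t ht
  have ht0 : (1:ℝ) ≤ t := by exact_mod_cast ht
  have hs : 1 ≤ Real.sqrt t := Real.one_le_sqrt.2 ht0
  rw [Nat.zero_div]
  have h1 : ∀ m ∈ Finset.Ioc 0 (Y / t), 1 / (((t * m : ℕ):ℝ) * Real.sqrt ((t * m : ℕ):ℝ)) ≤ 1 / t * (1 / ((m:ℝ) * Real.sqrt m)) := by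
    intro m hm
    have hm0 : (0:ℝ) < m := by exact_mod_cast (Finset.mem_Ioc.1 hm).1
    push_cast
    rw [Real.sqrt_mul (by linarith), div_mul_div_comm, one_mul]
    apply one_div_le_one_div_of_le (by positivity)
    have : 0 ≤ t * (m:ℝ) * Real.sqrt m := by positivity
    nlinarith
  refine (Finset.sum_le_sum h1).trans ?_
  rw [← Finset.mul_sum]
  have h2 := sum_three_half' (Y / t)
  rw [show Finset.Icc 1 (Y/t) = Finset.Ioc 0 (Y/t) from rfl] at h2
  calc _ ≤ 1 / (t:ℝ) * 3 := mul_le_mul_of_nonneg_left h2 (by positivity)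
    _ = _ := by ring

theorem sum_inv_Ioc_le (u U : ℕ) (hu : 1 ≤ u) (hU : u ≤ U) : ∑ m ∈ Finset.Ioc u U, 1 / (m:ℝ) ≤ Real.log (U / u) := by
  induction U, hU using Nat.le_induction with
  | base => simp
  | succ k hk ih =>
    rw [Finset.sum_Ioc_succ_top hk]
    have hk0 : (0:ℝ) < k := by exact_mod_cast (by omega : 0 < k)
    have hu0 : (0:ℝ) < u := by exact_mod_cast hu
    have h1 : Real.log (((k+1:ℕ):ℝ) / u) = Real.log (k / u) + Real.log (((k+1:ℕ):ℝ) / k) := by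
      rw [← Real.log_mul (by positivity) (by positivity)]
      congr 1
      field_simp
    have h2 := Real.one_sub_inv_le_log_of_pos (x := (((k+1:ℕ):ℝ) / k)) (by positivity)
    have h3 : 1 - (((k+1:ℕ):ℝ) / k)⁻¹ = 1 / ((k+1:ℕ):ℝ) := by
      push_cast; field_simp; ring
    rw [h1]; linarith

theorem sum_inv_le_log (M : ℕ) : ∑ m ∈ Finset.Ioc 0 M, 1 / (m:ℝ) ≤ 1 + Real.log M := by
  have := harmonic_le_one_add_log M
  rw [harmonic_eq_sum_Icc] at this
  push_cast at this
  rw [show Finset.Icc 1 M = Finset.Ioc 0 M from rfl] at this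
  simpa using this

theorem half_le_div (a t : ℕ) (ht : 1 ≤ t) (h : 1 ≤ a / t) : (a:ℝ) / t ≤ 2 * (a / t : ℕ) := by
  have ht0 : (0:ℝ) < t := by exact_mod_cast ht
  rw [div_le_iff₀ ht0]
  have h1 : a < t * (a / t + 1) := Nat.lt_mul_div_succ a (by omega)
  have h2 : t * (a / t + 1) ≤ 2 * (a / t) * t := by nlinarith
  exact_mod_cast (h1.le.trans h2)

theorem phiF_sum_inv (a b : ℕ) (ha : 1 ≤ a) (hab : a ≤ b) :
    ∑ n ∈ Finset.Ioc a b, phiF n * (1 / (n:ℝ)) ≤ KK * (1 + Real.log (b / a)) := by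
  refine phiF_sum a b (fun n => 1 / (n:ℝ)) _ (fun n => by positivity) ?_
  intro t ht
  have ht0 : (0:ℝ) < t := by exact_mod_cast ht
  have ha0 : (0:ℝ) < a := by exact_mod_cast ha
  have hab' : (a:ℝ) ≤ b := by exact_mod_cast hab
  have hb0 : (0:ℝ) < b := by linarith
  have hlog : 0 ≤ Real.log (b / a) := Real.log_nonneg (by rw [le_div_iff₀ ha0]; linarith)
  have h1 : ∀ m ∈ Finset.Ioc (a/t) (b / t), 1 / (((t * m : ℕ):ℝ)) = 1 / t * (1 / (m:ℝ)) := by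
    intro m hm
    push_cast
    rw [div_mul_div_comm, one_mul]
  rw [Finset.sum_congr rfl h1, ← Finset.mul_sum, div_eq_mul_one_div (1 + Real.log (b / a)), mul_comm]
  refine mul_le_mul_of_nonneg_right ?_ (by positivity)
  rcases Nat.eq_zero_or_pos (a / t) with h0 | h0
  · rw [h0]
    rcases Nat.eq_zero_or_pos (b / t) with h0' | h0'
    · rw [h0']; simp; linarith
    refine (sum_inv_le_log _).trans ?_
    have h2 : Real.log ((b / t : ℕ):ℝ) ≤ Real.log (b / a) := by
      apply Real.log_le_log (by exact_mod_cast h0')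
      refine Nat.cast_div_le.trans ?_
      have : a < t := by
        by_contra hc
        push Not at hc
        have := Nat.div_pos hc (by omega)
        omega
      have : (a:ℝ) ≤ t := by exact_mod_cast this.le
      gcongr
    linarith
  · have hle : a / t ≤ b / t := Nat.div_le_div_right hab
    refine (sum_inv_Ioc_le _ _ h0 hle).trans ?_
    have hpos : (0:ℝ) < ((a / t : ℕ):ℝ) := by exact_mod_cast h0
    have hpos' : (0:ℝ) < ((b / t : ℕ):ℝ) := by exact_mod_cast (h0.trans_le hle)
    have h2 : ((b / t : ℕ):ℝ) / ((a / t : ℕ):ℝ) ≤ 2 * (b / a) := by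
      rw [div_le_iff₀ hpos]
      have h3 := half_le_div a t ht h0
      have h4 : ((b / t : ℕ):ℝ) ≤ b / t := Nat.cast_div_le
      calc _ ≤ (b:ℝ) / t := h4
        _ = (b / a) * ((a:ℝ) / t) := by field_simp
        _ ≤ (b / a) * (2 * ((a / t : ℕ):ℝ)) := mul_le_mul_of_nonneg_left h3 (by positivity)
        _ = _ := by ring
    refine (Real.log_le_log (by positivity) h2).trans ?_
    rw [Real.log_mul (by norm_num) (by positivity)]
    have := Real.log_two_lt_d9
    linarith

theorem phiF_sum_inv0 (b : ℕ) (hb : 1 ≤ b) :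
    ∑ n ∈ Finset.Ioc 0 b, phiF n * (1 / (n:ℝ)) ≤ KK * (1 + Real.log b) := by
  refine phiF_sum 0 b (fun n => 1 / (n:ℝ)) _ (fun n => by positivity) ?_
  intro t ht
  have ht0 : (0:ℝ) < t := by exact_mod_cast ht
  have hb0 : (1:ℝ) ≤ b := by exact_mod_cast hb
  have hlog : 0 ≤ Real.log b := Real.log_nonneg hb0
  have h1 : ∀ m ∈ Finset.Ioc (0/t) (b / t), 1 / (((t * m : ℕ):ℝ)) = 1 / t * (1 / (m:ℝ)) := by
    intro m hm
    push_cast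
    rw [div_mul_div_comm, one_mul]
  rw [Finset.sum_congr rfl h1, ← Finset.mul_sum, div_eq_mul_one_div (1 + Real.log b), mul_comm]
  refine mul_le_mul_of_nonneg_right ?_ (by positivity)
  rw [Nat.zero_div]
  rcases Nat.eq_zero_or_pos (b / t) with h0' | h0'
  · rw [h0']; simp; linarith
  refine (sum_inv_le_log _).trans ?_
  have h2 : Real.log ((b / t : ℕ):ℝ) ≤ Real.log b := by
    apply Real.log_le_log (by exact_mod_cast h0')
    exact_mod_cast Nat.div_le_self _ _
  linarith

theorem sum_inv_sq_Ioc (u U : ℕ) (hu : 1 ≤ u) : ∑ m ∈ Finset.Ioc u U, 1 / (m:ℝ) ^ 2 ≤ 1 / (u:ℝ) := by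
  rcases le_or_gt u U with h | h
  · have : ∑ m ∈ Finset.Ioc u U, 1 / (m:ℝ) ^ 2 ≤ 1 / (u:ℝ) - 1 / (U:ℝ) := by
      induction U, h using Nat.le_induction with
      | base => simp
      | succ k hk ih =>
        rw [Finset.sum_Ioc_succ_top hk]
        have hk0 : (0:ℝ) < k := by exact_mod_cast (by omega : 0 < k)
        have : 1 / (((k+1:ℕ):ℝ)) ^ 2 ≤ 1 / (k:ℝ) - 1 / ((k+1:ℕ):ℝ) := by
          push_cast
          rw [div_sub_div _ _ (by positivity) (by positivity), div_le_div_iff₀ (by positivity) (by positivity)]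
          nlinarith
        linarith
    have h2 : (0:ℝ) ≤ 1 / U := by positivity
    linarith
  · rw [Finset.Ioc_eq_empty (by omega)]; simp

theorem phiF_sum_inv_sq (a b : ℕ) (ha : 1 ≤ a) :
    ∑ n ∈ Finset.Ioc a b, phiF n * (1 / (n:ℝ) ^ 2) ≤ KK * (2 / a) := by
  refine phiF_sum a b (fun n => 1 / (n:ℝ) ^ 2) _ (fun n => by positivity) ?_
  intro t ht
  have ht0 : (0:ℝ) < t := by exact_mod_cast ht
  have ha0 : (0:ℝ) < a := by exact_mod_cast ha
  have h1 : ∀ m ∈ Finset.Ioc (a/t) (b / t), 1 / (((t * m : ℕ):ℝ)) ^ 2 = 1 / (t:ℝ) ^ 2 * (1 / (m:ℝ) ^ 2) := by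
    intro m hm
    push_cast
    rw [div_mul_div_comm, one_mul, mul_pow]
  rw [Finset.sum_congr rfl h1, ← Finset.mul_sum]
  have h2 : ∑ m ∈ Finset.Ioc (a/t) (b / t), 1 / (m:ℝ) ^ 2 ≤ 2 * ((t:ℝ) / a) := by
    rcases Nat.eq_zero_or_pos (a / t) with h0 | h0
    · rw [h0]
      have h3 := sum_inv_sq_le (b / t)
      refine (show _ from h3).trans ?_
      have : a < t := by
        by_contra hc
        push Not at hc
        have := Nat.div_pos hc (by omega)
        omega
      have : (a:ℝ) ≤ t := by exact_mod_cast this.le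
      have : (1:ℝ) ≤ t / a := by rw [le_div_iff₀ ha0]; linarith
      linarith
    · refine (sum_inv_sq_Ioc _ _ h0).trans ?_
      have hpos : (0:ℝ) < ((a / t : ℕ):ℝ) := by exact_mod_cast h0
      have h3 := half_le_div a t ht h0
      rw [div_le_iff₀ hpos]
      calc (1:ℝ) = (t / a) * ((a:ℝ) / t) := by field_simp
        _ ≤ (t / a) * (2 * ((a / t : ℕ):ℝ)) := mul_le_mul_of_nonneg_left h3 (by positivity)
        _ = _ := by ring
  calc _ ≤ 1 / (t:ℝ) ^ 2 * (2 * (t / a)) := mul_le_mul_of_nonneg_left h2 (by positivity)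
    _ = _ := by field_simp

theorem phiF_sum_inv_sq0 (b : ℕ) :
    ∑ n ∈ Finset.Ioc 0 b, phiF n * (1 / (n:ℝ) ^ 2) ≤ KK * 2 := by
  refine phiF_sum 0 b (fun n => 1 / (n:ℝ) ^ 2) _ (fun n => by positivity) ?_
  intro t ht
  have ht0 : (1:ℝ) ≤ t := by exact_mod_cast ht
  have h1 : ∀ m ∈ Finset.Ioc (0/t) (b / t), 1 / (((t * m : ℕ):ℝ)) ^ 2 = 1 / (t:ℝ) ^ 2 * (1 / (m:ℝ) ^ 2) := by
    intro m hm
    push_cast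
    rw [div_mul_div_comm, one_mul, mul_pow]
  rw [Finset.sum_congr rfl h1, ← Finset.mul_sum, Nat.zero_div]
  have h3 := sum_inv_sq_le (b / t)
  calc _ ≤ 1 / (t:ℝ) ^ 2 * 2 := mul_le_mul_of_nonneg_left h3 (by positivity)
    _ ≤ 1 / (t:ℝ) * 2 := by
      have : 1 / (t:ℝ)^2 ≤ 1 / t := one_div_le_one_div_of_le (by positivity) (by nlinarith)
      linarith
    _ = _ := by ring

theorem one_le_nphi (n : ℕ) (hn : 1 ≤ n) : 1 ≤ (n:ℝ) / n.totient := by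
  have h : (0:ℝ) < n.totient := by exact_mod_cast Nat.totient_pos.2 hn
  rw [le_div_iff₀ h, one_mul]
  exact_mod_cast Nat.totient_le n

theorem nphi_le_phiF (n : ℕ) (hn : 1 ≤ n) : (n:ℝ) / n.totient ≤ phiF n := by
  have := one_le_nphi n hn
  unfold phiF
  nlinarith

theorem inv_totient_le (n : ℕ) (hn : 1 ≤ n) : 1 / (n.totient : ℝ) ≤ phiF n * (1 / (n:ℝ)) := by
  have h0 : (0:ℝ) < n := by exact_mod_cast hn
  have h : (0:ℝ) < n.totient := by exact_mod_cast Nat.totient_pos.2 hn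
  calc 1 / (n.totient : ℝ) = (n:ℝ) / n.totient * (1 / n) := by field_simp
    _ ≤ _ := mul_le_mul_of_nonneg_right (nphi_le_phiF n hn) (by positivity)

theorem inv_totient_sq (n : ℕ) (hn : 1 ≤ n) : 1 / (n.totient : ℝ) ^ 2 = phiF n * (1 / (n:ℝ) ^ 2) := by
  have h0 : (0:ℝ) < n := by exact_mod_cast hn
  have h : (0:ℝ) < n.totient := by exact_mod_cast Nat.totient_pos.2 hn
  unfold phiF; field_simp

theorem n_div_totient_sq (n : ℕ) (hn : 1 ≤ n) : (n:ℝ) / (n.totient : ℝ) ^ 2 = phiF n * (1 / (n:ℝ)) := by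
  have h0 : (0:ℝ) < n := by exact_mod_cast hn
  have h : (0:ℝ) < n.totient := by exact_mod_cast Nat.totient_pos.2 hn
  unfold phiF; field_simp

noncomputable def cR (R : ℝ) (d : ℕ) : ℝ :=
  ∑ r ∈ (Finset.Ioc 0 ⌊R⌋₊).filter (fun r => d ∣ r), (ArithmeticFunction.moebius r : ℝ) ^ 2 / (r.totient : ℝ)

noncomputable def wR (R : ℝ) (d : ℕ) : ℝ := (d : ℝ) * (ArithmeticFunction.moebius d : ℝ) * cR R d

theorem lamR_eq (R : ℝ) (m : ℕ) :
    lamR R m = ∑ d ∈ Finset.Ioc 0 ⌊R⌋₊, wR R d * (if d ∣ m then 1 else 0) := by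
  unfold lamR wR cR
  simp_rw [Finset.mul_sum, Finset.sum_mul]
  rw [show Finset.Icc 1 ⌊R⌋₊ = Finset.Ioc 0 ⌊R⌋₊ from rfl]
  have h1 : ∀ r ∈ Finset.Ioc 0 ⌊R⌋₊, ∑ i ∈ (Nat.gcd r m).divisors,
      ((ArithmeticFunction.moebius r : ℝ) ^ 2 / (r.totient : ℝ)) * ((i : ℝ) * (ArithmeticFunction.moebius i : ℝ))
      = ∑ i ∈ r.divisors, ((i : ℝ) * (ArithmeticFunction.moebius i : ℝ) * ((ArithmeticFunction.moebius r : ℝ) ^ 2 / (r.totient : ℝ))) * (if i ∣ m then 1 else 0) := by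
    intro r hr
    rw [Finset.mem_Ioc] at hr
    simp only [mul_ite, mul_one, mul_zero]
    rw [← Finset.sum_filter]
    have : (Nat.gcd r m).divisors = r.divisors.filter (fun i => i ∣ m) := by
      ext i
      simp only [Nat.mem_divisors, Finset.mem_filter, Nat.dvd_gcd_iff]
      have : Nat.gcd r m ≠ 0 := (Nat.gcd_pos_of_pos_left m hr.1).ne'
      have : r ≠ 0 := by omega
      tauto
    rw [this]
    refine Finset.sum_congr rfl fun i _ => by ring
  rw [Finset.sum_congr rfl h1]
  refine Finset.sum_comm' ?_
  intro r d
  simp only [Nat.mem_divisors, Finset.mem_Ioc, Finset.mem_filter]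
  constructor
  · rintro ⟨⟨h1, h2⟩, h3, h4⟩
    exact ⟨⟨⟨h1, h2⟩, h3⟩, Nat.pos_of_dvd_of_pos h3 (by omega), (Nat.le_of_dvd (by omega) h3).trans h2⟩
  · rintro ⟨⟨⟨h1, h2⟩, h3⟩, h4⟩
    exact ⟨⟨h1, h2⟩, h3, by omega⟩

theorem moebius_sq_le (n : ℕ) : (ArithmeticFunction.moebius n : ℝ) ^ 2 ≤ 1 := by
  have := ArithmeticFunction.abs_moebius_le_one (n := n)
  rw [sq_le_one_iff_abs_le_one]
  exact_mod_cast this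

theorem abs_moebius_le (n : ℕ) : |(ArithmeticFunction.moebius n : ℝ)| ≤ 1 := by
  have := ArithmeticFunction.abs_moebius_le_one (n := n)
  exact_mod_cast this

theorem cR_nonneg (R : ℝ) (d : ℕ) : 0 ≤ cR R d := Finset.sum_nonneg fun _ _ => by positivity

theorem cR_le (R : ℝ) (d : ℕ) (hd : 1 ≤ d) :
    cR R d ≤ 1 / (d.totient : ℝ) * ∑ s ∈ Finset.Ioc 0 (⌊R⌋₊ / d), 1 / (s.totient : ℝ) := by
  unfold cR
  rw [sum_multiples 0 _ d hd, Nat.zero_div, Finset.mul_sum]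
  refine Finset.sum_le_sum fun m hm => ?_
  rw [Finset.mem_Ioc] at hm
  have h1 : (0:ℝ) < d.totient := by exact_mod_cast Nat.totient_pos.2 hd
  have h2 : (0:ℝ) < m.totient := by exact_mod_cast Nat.totient_pos.2 hm.1
  rw [div_mul_div_comm, one_mul]
  apply div_le_div₀ (by norm_num) (moebius_sq_le _) (by positivity)
  exact_mod_cast Nat.totient_super_multiplicative d m

theorem wR_le (R : ℝ) (d : ℕ) (hd : 1 ≤ d) :
    |wR R d| ≤ phiF d * ∑ s ∈ Finset.Ioc 0 (⌊R⌋₊ / d), phiF s * (1 / (s : ℝ)) := by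
  unfold wR
  rw [abs_mul, abs_mul, abs_of_nonneg (cR_nonneg R d), Nat.abs_cast]
  have h0 : (0:ℝ) < d := by exact_mod_cast hd
  have hS : ∑ s ∈ Finset.Ioc 0 (⌊R⌋₊ / d), 1 / (s.totient : ℝ) ≤ ∑ s ∈ Finset.Ioc 0 (⌊R⌋₊ / d), phiF s * (1 / (s : ℝ)) :=
    Finset.sum_le_sum fun s hs => inv_totient_le s (Finset.mem_Ioc.1 hs).1
  have hS0 : 0 ≤ ∑ s ∈ Finset.Ioc 0 (⌊R⌋₊ / d), 1 / (s.totient : ℝ) := Finset.sum_nonneg fun _ _ => by positivity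
  calc _ ≤ (d:ℝ) * 1 * (1 / (d.totient : ℝ) * ∑ s ∈ Finset.Ioc 0 (⌊R⌋₊ / d), 1 / (s.totient : ℝ)) := by
        apply mul_le_mul _ (cR_le R d hd) (cR_nonneg R d) (by positivity)
        exact mul_le_mul_of_nonneg_left (abs_moebius_le d) h0.le
    _ = (d:ℝ) / d.totient * ∑ s ∈ Finset.Ioc 0 (⌊R⌋₊ / d), 1 / (s.totient : ℝ) := by ring
    _ ≤ _ := mul_le_mul (nphi_le_phiF d hd) hS hS0 (phiF_nonneg d)

theorem sum_swap_div (Q : ℕ) (f : ℕ → ℕ → ℝ) :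
    ∑ d ∈ Finset.Ioc 0 Q, ∑ s ∈ Finset.Ioc 0 (Q / d), f d s
      = ∑ s ∈ Finset.Ioc 0 Q, ∑ d ∈ Finset.Ioc 0 (Q / s), f d s := by
  refine Finset.sum_comm' ?_
  intro d s
  simp only [Finset.mem_Ioc]
  constructor
  · rintro ⟨⟨h1, h2⟩, h3, h4⟩
    have h5 := (Nat.le_div_iff_mul_le h1).1 h4
    exact ⟨⟨h1, (Nat.le_div_iff_mul_le h3).2 (by rwa [mul_comm])⟩, h3, h4.trans (Nat.div_le_self _ _)⟩
  · rintro ⟨⟨h1, h2⟩, h3, h4⟩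
    have h5 := (Nat.le_div_iff_mul_le h3).1 h2
    exact ⟨⟨h1, h2.trans (Nat.div_le_self _ _)⟩, h3, (Nat.le_div_iff_mul_le h1).2 (by rwa [mul_comm])⟩

theorem wR_sum_sqrt (R : ℝ) (hR : 0 ≤ R) :
    ∑ d ∈ Finset.Ioc 0 ⌊R⌋₊, |wR R d| * (1 / Real.sqrt d) ≤ 6 * KK ^ 2 * Real.sqrt R := by
  set Q := ⌊R⌋₊ with hQ
  have hQR : (Q:ℝ) ≤ R := Nat.floor_le hR
  calc _ ≤ ∑ d ∈ Finset.Ioc 0 Q, ∑ s ∈ Finset.Ioc 0 (Q / d), (phiF d * (1 / Real.sqrt d)) * (phiF s * (1 / (s : ℝ))) := by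
        refine Finset.sum_le_sum fun d hd => ?_
        rw [← Finset.mul_sum]
        calc _ ≤ (phiF d * ∑ s ∈ Finset.Ioc 0 (Q / d), phiF s * (1 / (s : ℝ))) * (1 / Real.sqrt d) :=
              mul_le_mul_of_nonneg_right (wR_le R d (Finset.mem_Ioc.1 hd).1) (by positivity)
          _ = _ := by ring
    _ = ∑ s ∈ Finset.Ioc 0 Q, ∑ d ∈ Finset.Ioc 0 (Q / s), (phiF d * (1 / Real.sqrt d)) * (phiF s * (1 / (s : ℝ))) := sum_swap_div _ _
    _ ≤ ∑ s ∈ Finset.Ioc 0 Q, (KK * 2 * Real.sqrt R) * (phiF s * (1 / ((s : ℝ) * Real.sqrt s))) := by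
        refine Finset.sum_le_sum fun s hs => ?_
        rw [← Finset.sum_mul]
        have hs0 : (0:ℝ) < s := by exact_mod_cast (Finset.mem_Ioc.1 hs).1
        have h1 : Real.sqrt ((Q / s : ℕ):ℝ) ≤ Real.sqrt R / Real.sqrt s := by
          rw [← Real.sqrt_div' _ hs0.le]
          refine Real.sqrt_le_sqrt (Nat.cast_div_le.trans ?_)
          gcongr
        calc _ ≤ (KK * (2 * (Real.sqrt R / Real.sqrt s))) * (phiF s * (1 / (s : ℝ))) := by
              refine mul_le_mul_of_nonneg_right ((phiF_sum_sqrt _).trans ?_) (mul_nonneg (phiF_nonneg _) (by positivity))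
              exact mul_le_mul_of_nonneg_left (by linarith) KK_pos.le
          _ = _ := by
              have := Real.sqrt_pos.2 hs0
              field_simp
    _ ≤ (KK * 2 * Real.sqrt R) * (KK * 3) := by
        rw [← Finset.mul_sum]
        exact mul_le_mul_of_nonneg_left (phiF_sum_three_half Q) (by have := KK_pos; positivity)
    _ = _ := by ring

theorem wR_sum (R : ℝ) (hR : 0 ≤ R) :
    ∑ d ∈ Finset.Ioc 0 ⌊R⌋₊, |wR R d| ≤ 6 * KK ^ 2 * R := by
  set Q := ⌊R⌋₊ with hQ
  have hQR : (Q:ℝ) ≤ R := Nat.floor_le hR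
  have hK := KK_pos
  calc _ ≤ ∑ d ∈ Finset.Ioc 0 Q, ∑ s ∈ Finset.Ioc 0 (Q / d), phiF d * (phiF s * (1 / (s : ℝ))) := by
        refine Finset.sum_le_sum fun d hd => ?_
        rw [← Finset.mul_sum]
        exact wR_le R d (Finset.mem_Ioc.1 hd).1
    _ = ∑ s ∈ Finset.Ioc 0 Q, ∑ d ∈ Finset.Ioc 0 (Q / s), phiF d * (phiF s * (1 / (s : ℝ))) := sum_swap_div _ _
    _ ≤ ∑ s ∈ Finset.Ioc 0 Q, (KK * R) * (phiF s * (1 / (s : ℝ) ^ 2)) := by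
        refine Finset.sum_le_sum fun s hs => ?_
        rw [← Finset.sum_mul]
        have hs0 : (0:ℝ) < s := by exact_mod_cast (Finset.mem_Ioc.1 hs).1
        have h1 : ((Q / s : ℕ):ℝ) ≤ R / s := Nat.cast_div_le.trans (by gcongr)
        calc _ ≤ (KK * (R / s)) * (phiF s * (1 / (s : ℝ))) := by
              refine mul_le_mul_of_nonneg_right ((phiF_sum_one _).trans ?_) (mul_nonneg (phiF_nonneg _) (by positivity))
              exact mul_le_mul_of_nonneg_left h1 KK_pos.le
          _ = _ := by
              field_simp
    _ ≤ (KK * R) * (KK * 2) := by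
        rw [← Finset.mul_sum]
        exact mul_le_mul_of_nonneg_left (phiF_sum_inv_sq0 Q) (by positivity)
    _ ≤ _ := by nlinarith [mul_nonneg (sq_nonneg KK) hR]

noncomputable def ellR (R : ℝ) (e : ℕ → ℕ) (n k : ℕ) : ℝ :=
  ∑ d ∈ Finset.Ioc 0 ⌊R⌋₊, wR R d * (if n ≡ k * e d [MOD d] then 1 else 0)

noncomputable def TT (R : ℝ) (q a : ℕ) (e : ℕ → ℕ) (N K : ℕ) : ℝ :=
  ∑ k ∈ (Finset.Icc 1 K).filter (fun k => q ∣ k),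
    ∑ n ∈ (Finset.Icc 1 N).filter (fun n : ℕ => (n : ZMod q) = (a : ZMod q)), vonMangoldt n * ellR R e n k

noncomputable def SS (R : ℝ) (k : ℕ) : ℝ :=
  ∑ d ∈ Finset.Ioc 0 ⌊R⌋₊, (if k.Coprime d then wR R d / (d.totient : ℝ) else 0)

theorem TT_eq (R : ℝ) (q a : ℕ) (e : ℕ → ℕ) (N K : ℕ) :
    TT R q a e N K = ∑ d ∈ Finset.Ioc 0 ⌊R⌋₊, wR R d * ∑ k ∈ (Finset.Icc 1 K).filter (fun k => q ∣ k), apA q a d N (e d) k := by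
  unfold TT ellR apA
  simp_rw [Finset.mul_sum]
  rw [Finset.sum_comm (s := Finset.Ioc 0 ⌊R⌋₊)]
  refine Finset.sum_congr rfl fun k _ => ?_
  rw [Finset.sum_comm]
  refine Finset.sum_congr rfl fun d _ => ?_
  rw [← Finset.filter_filter, Finset.sum_filter (s := (Finset.Icc 1 N).filter (fun n : ℕ => (n : ZMod q) = (a : ZMod q)))]
  refine Finset.sum_congr rfl fun n _ => ?_
  split_ifs <;> ring

theorem apA_noncop_q (q a d N e k : ℕ) (ha : a.Coprime q) (hk : q ∣ k) (hqd : ¬ q.Coprime d) : apA q a d N e k = 0 := by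
  unfold apA
  rw [Finset.filter_false_of_mem, Finset.sum_empty]
  rintro n _ ⟨h1, h2⟩
  obtain ⟨p, hp, hpq, hpd⟩ := Nat.Prime.not_coprime_iff_dvd.1 hqd
  rw [ZMod.natCast_eq_natCast_iff] at h1
  have h3 : n ≡ a [MOD p] := h1.of_dvd hpq
  have h4 : n ≡ 0 [MOD p] := (h2.of_dvd hpd).trans ((Nat.modEq_zero_iff_dvd).2 ((hpq.trans hk).mul_right e))
  have h5 : p ∣ a := (Nat.modEq_zero_iff_dvd).1 (h3.symm.trans h4)
  exact Nat.Prime.not_coprime_iff_dvd.2 ⟨p, hp, h5, hpq⟩ ha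

theorem TT_bound (hG : GRH) : ∃ C : ℝ, 0 < C ∧ ∀ (R : ℝ) (q a : ℕ) (e : ℕ → ℕ) (N K : ℕ), 0 ≤ R → 1 ≤ q → 2 ≤ N →
    q * ⌊R⌋₊ ≤ N → K ≤ N → a.Coprime q → (∀ d, 1 ≤ d → (e d).Coprime d) →
    |TT R q a e N K - N / (q.totient : ℝ) * ∑ k ∈ (Finset.Icc 1 K).filter (fun k => q ∣ k), SS R k|
      ≤ C * (Real.sqrt N * (Real.log N) ^ 2) * ((K / q : ℝ) * Real.sqrt R + Real.sqrt (K / q : ℝ) * R) := by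
  obtain ⟨C, hC, hE⟩ := claimE hG
  have hK := KK_pos
  refine ⟨C * (6 * KK ^ 2), by positivity, fun R q a e N K hR hq hN hqR hKN ha he => ?_⟩
  set F := (Finset.Icc 1 K).filter (fun k => q ∣ k) with hF
  have h1 : TT R q a e N K - N / (q.totient : ℝ) * ∑ k ∈ F, SS R k
      = ∑ d ∈ Finset.Ioc 0 ⌊R⌋₊, wR R d * ∑ k ∈ F, (apA q a d N (e d) k - if k.Coprime d then N / ((q.totient : ℝ) * d.totient) else 0) := by
    rw [TT_eq]
    unfold SS
    rw [Finset.sum_comm, Finset.mul_sum, ← Finset.sum_sub_distrib]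
    refine Finset.sum_congr rfl fun d _ => ?_
    rw [Finset.mul_sum, Finset.mul_sum, Finset.mul_sum, ← Finset.sum_sub_distrib]
    refine Finset.sum_congr rfl fun k _ => ?_
    split_ifs
    · rw [mul_sub, div_mul_div_comm]; ring
    · ring
  have h2 : ∀ d ∈ Finset.Ioc 0 ⌊R⌋₊, |∑ k ∈ F, (apA q a d N (e d) k - if k.Coprime d then N / ((q.totient : ℝ) * d.totient) else 0)|
      ≤ C * (Real.sqrt N * (Real.log N) ^ 2) * ((K / q : ℝ) / Real.sqrt d + Real.sqrt (K / q : ℝ)) := by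
    intro d hd
    rw [Finset.mem_Ioc] at hd
    by_cases hqd : q.Coprime d
    · refine (Finset.abs_sum_le_sum_abs _ _).trans ?_
      have := hE q a d N (e d) K hq hd.1 hN ((Nat.mul_le_mul_left q hd.2).trans hqR) hKN hqd ha (he d hd.1)
      rw [Nat.totient_mul hqd] at this
      push_cast at this
      exact this
    · have : ∑ k ∈ F, (apA q a d N (e d) k - if k.Coprime d then N / ((q.totient : ℝ) * d.totient) else 0) = 0 := by
        refine Finset.sum_eq_zero fun k hk => ?_
        have hk' := (Finset.mem_filter.1 hk).2
        rw [apA_noncop_q q a d N (e d) k ha hk' hqd, if_neg, sub_zero]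
        intro hkd
        exact hqd (Nat.Coprime.coprime_dvd_left hk' hkd)
      rw [this, abs_zero]
      positivity
  rw [h1]
  refine (Finset.abs_sum_le_sum_abs _ _).trans ?_
  set B := C * (Real.sqrt N * (Real.log N) ^ 2) with hB
  have hB0 : 0 ≤ B := by positivity
  calc _ ≤ ∑ d ∈ Finset.Ioc 0 ⌊R⌋₊, (B * (K / q : ℝ) * (|wR R d| * (1 / Real.sqrt d)) + B * Real.sqrt (K / q : ℝ) * |wR R d|) := by
        refine Finset.sum_le_sum fun d hd => ?_
        rw [abs_mul]
        refine (mul_le_mul_of_nonneg_left (h2 d hd) (abs_nonneg _)).trans (le_of_eq ?_)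
        ring
    _ = B * (K / q : ℝ) * ∑ d ∈ Finset.Ioc 0 ⌊R⌋₊, (|wR R d| * (1 / Real.sqrt d)) + B * Real.sqrt (K / q : ℝ) * ∑ d ∈ Finset.Ioc 0 ⌊R⌋₊, |wR R d| := by
        rw [Finset.sum_add_distrib, ← Finset.mul_sum, ← Finset.mul_sum]
    _ ≤ B * (K / q : ℝ) * (6 * KK ^ 2 * Real.sqrt R) + B * Real.sqrt (K / q : ℝ) * (6 * KK ^ 2 * R) :=
        add_le_add (mul_le_mul_of_nonneg_left (wR_sum_sqrt R hR) (by positivity)) (mul_le_mul_of_nonneg_left (wR_sum R hR) (by positivity))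
    _ = _ := by rw [hB]; ring

noncomputable def Phi (x t : ℝ) : ℝ := max x (min t (2 * x))
noncomputable def GG (x t : ℝ) : ℝ := Phi x t - Phi x (t - 1)

theorem flen_eq (n : ℕ) (x u : ℝ) (hx : 0 ≤ x) (hu : 0 ≤ u) (hux : u ≤ x) :
    flen n x u = Phi x n - Phi x (n - u) := by
  unfold flen Phi
  set t : ℝ := (n:ℝ)
  split_ifs with h1 h2 h3
  · rw [min_eq_left (by linarith), max_eq_right h1.1, min_eq_left (by linarith), max_eq_left (by linarith)]
  · rw [min_eq_left (by linarith), max_eq_right (by linarith), min_eq_left (by linarith), max_eq_right (by linarith)]; ring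
  · rw [min_eq_right (by linarith), max_eq_right (by linarith), min_eq_left (by linarith), max_eq_right (by linarith)]; ring
  · rcases lt_or_ge t x with h | h
    · rw [min_eq_left (by linarith), max_eq_left (by linarith), min_eq_left (by linarith), max_eq_left (by linarith)]; ring
    · have h4 : x + u ≤ t := by
        by_contra hc; push Not at hc; exact h1 ⟨h, hc⟩
      have h5 : 2 * x < t := by
        by_contra hc; push Not at hc; exact h2 ⟨h4, hc⟩
      have h6 : 2 * x + u < t := by
        by_contra hc; push Not at hc; exact h3 ⟨h5, hc⟩
      rw [min_eq_right (by linarith), min_eq_right (by linarith)]; ring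

theorem Phi_low (x t : ℝ) (h : t ≤ x) : Phi x t = x := by
  unfold Phi; exact max_eq_left (le_trans (min_le_left _ _) h)

theorem Phi_high (x t : ℝ) (hx : 0 ≤ x) (h : 2 * x ≤ t) : Phi x t = 2 * x := by
  unfold Phi; rw [min_eq_right h, max_eq_right (by linarith)]

theorem Phi_mid (x t : ℝ) (h1 : x ≤ t) (h : t ≤ 2 * x) : Phi x t = t := by
  unfold Phi; rw [min_eq_left h, max_eq_right h1]

theorem GG_formula (x : ℝ) (hx : 2 ≤ x) (n i : ℕ) :
    GG x ((n:ℝ) - i) = (2 * x - ⌊2 * x⌋₊) * (if n ≤ ⌊2 * x⌋₊ + 1 + i then 1 else 0)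
      + (1 - (2 * x - ⌊2 * x⌋₊)) * (if n ≤ ⌊2 * x⌋₊ + i then 1 else 0)
      - ((⌊x⌋₊ : ℝ) + 1 - x) * (if n ≤ ⌊x⌋₊ + i then 1 else 0)
      - (1 - ((⌊x⌋₊ : ℝ) + 1 - x)) * (if n ≤ ⌊x⌋₊ + 1 + i then 1 else 0) := by
  have hx1 : (⌊x⌋₊ : ℝ) ≤ x := Nat.floor_le (by linarith)
  have hx2 : x < ⌊x⌋₊ + 1 := Nat.lt_floor_add_one x
  have hy1 : (⌊2 * x⌋₊ : ℝ) ≤ 2 * x := Nat.floor_le (by linarith)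
  have hy2 : 2 * x < ⌊2 * x⌋₊ + 1 := Nat.lt_floor_add_one _
  set X := ⌊x⌋₊
  set Y := ⌊2 * x⌋₊
  have hXY : X + 2 ≤ Y := by
    apply Nat.le_floor
    push_cast; linarith
  have hXY' : (X:ℝ) + 2 ≤ Y := by exact_mod_cast hXY
  unfold GG
  rcases Nat.lt_or_ge (X + i) n with h1 | h1
  swap
  · have h1' : (n:ℝ) ≤ X + i := by exact_mod_cast h1
    rw [if_pos (by omega), if_pos (by omega), if_pos (by omega), if_pos (by omega),
      Phi_low _ _ (by linarith), Phi_low _ _ (by linarith)]; ring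
  rcases Nat.lt_or_ge (X + 1 + i) n with h2 | h2
  swap
  · have h1' : (n:ℝ) = X + 1 + i := by exact_mod_cast (by omega : n = X + 1 + i)
    rw [if_pos (by omega), if_pos (by omega), if_neg (by omega), if_pos (by omega),
      Phi_mid _ _ (by linarith) (by linarith), Phi_low _ _ (by linarith), h1']; ring
  have h2' : (X:ℝ) + 1 + i + 1 ≤ n := by exact_mod_cast h2
  rcases Nat.lt_or_ge (Y + i) n with h3 | h3
  swap
  · have h3' : (n:ℝ) ≤ Y + i := by exact_mod_cast h3
    rw [if_pos (by omega), if_pos (by omega), if_neg (by omega), if_neg (by omega),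
      Phi_mid _ _ (by linarith) (by linarith), Phi_mid _ _ (by linarith) (by linarith)]; ring
  rcases Nat.lt_or_ge (Y + 1 + i) n with h4 | h4
  swap
  · have h1' : (n:ℝ) = Y + 1 + i := by exact_mod_cast (by omega : n = Y + 1 + i)
    rw [if_pos (by omega), if_neg (by omega), if_neg (by omega), if_neg (by omega),
      Phi_high _ _ (by linarith) (by linarith), Phi_mid _ _ (by linarith) (by linarith), h1']; ring
  · have h4' : (Y:ℝ) + 1 + i + 1 ≤ n := by exact_mod_cast h4
    rw [if_neg (by omega), if_neg (by omega), if_neg (by omega), if_neg (by omega),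
      Phi_high _ _ (by linarith) (by linarith), Phi_high _ _ (by linarith) (by linarith)]; ring

theorem sum_indic (A : ℕ → ℝ) (B N : ℕ) (h : N ≤ B) :
    ∑ n ∈ Finset.Icc 1 B, A n * (if n ≤ N then 1 else 0) = ∑ n ∈ Finset.Icc 1 N, A n := by
  simp only [mul_ite, mul_one, mul_zero]
  rw [← Finset.sum_filter]
  congr 1
  ext n; simp only [Finset.mem_filter, Finset.mem_Icc]; omega

/-- the combination of partial sums -/
noncomputable def combo (x : ℝ) (i : ℕ) (f : ℕ → ℝ) : ℝ :=
  (2 * x - ⌊2 * x⌋₊) * f (⌊2 * x⌋₊ + 1 + i) + (1 - (2 * x - ⌊2 * x⌋₊)) * f (⌊2 * x⌋₊ + i)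
    - ((⌊x⌋₊ : ℝ) + 1 - x) * f (⌊x⌋₊ + i) - (1 - ((⌊x⌋₊ : ℝ) + 1 - x)) * f (⌊x⌋₊ + 1 + i)

theorem sum_GG (x : ℝ) (hx : 2 ≤ x) (A : ℕ → ℝ) (B i : ℕ) (hB : ⌊2 * x⌋₊ + 1 + i ≤ B) :
    ∑ n ∈ Finset.Icc 1 B, A n * GG x ((n:ℝ) - i) = combo x i (fun N => ∑ n ∈ Finset.Icc 1 N, A n) := by
  have hXY : ⌊x⌋₊ ≤ ⌊2 * x⌋₊ := Nat.floor_le_floor (by linarith)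
  unfold combo
  beta_reduce
  rw [← sum_indic A B _ hB, ← sum_indic A B (⌊2 * x⌋₊ + i) (by omega), ← sum_indic A B (⌊x⌋₊ + i) (by omega),
    ← sum_indic A B (⌊x⌋₊ + 1 + i) (by omega), Finset.mul_sum, Finset.mul_sum, Finset.mul_sum, Finset.mul_sum,
    ← Finset.sum_add_distrib, ← Finset.sum_sub_distrib, ← Finset.sum_sub_distrib]
  refine Finset.sum_congr rfl fun n _ => ?_
  rw [GG_formula x hx]; ring

theorem combo_sum {ι : Type*} (s : Finset ι) (x : ℝ) (i : ℕ) (f : ι → ℕ → ℝ) :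
    ∑ k ∈ s, combo x i (f k) = combo x i (fun N => ∑ k ∈ s, f k N) := by
  unfold combo
  rw [Finset.sum_sub_distrib, Finset.sum_sub_distrib, Finset.sum_add_distrib, ← Finset.mul_sum, ← Finset.mul_sum, ← Finset.mul_sum, ← Finset.mul_sum]

theorem Phi_tele (x t : ℝ) (a b : ℕ) (hab : a ≤ b) :
    Phi x (t - a) - Phi x (t - b) = ∑ i ∈ Finset.Ico a b, GG x (t - i) := by
  induction b, hab using Nat.le_induction with
  | base => simp
  | succ k hk ih =>
    rw [Finset.sum_Ico_succ_top hk, ← ih]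
    unfold GG
    push_cast
    rw [show t - ((k:ℝ) + 1) = t - k - 1 by ring]; ring

theorem combo_main (x : ℝ) (i : ℕ) (c : ℝ) : combo x i (fun N => (N:ℝ) * c) = x * c := by
  unfold combo; push_cast; ring

theorem combo_bound (x : ℝ) (hx : 2 ≤ x) (i : ℕ) (f g : ℕ → ℝ) (E : ℝ)
    (h : ∀ N, ⌊x⌋₊ ≤ N → N ≤ ⌊2 * x⌋₊ + 1 + i → |f N - g N| ≤ E) : |combo x i f - combo x i g| ≤ 2 * E := by
  have hx1 : (⌊x⌋₊ : ℝ) ≤ x := Nat.floor_le (by linarith)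
  have hx2 : x < ⌊x⌋₊ + 1 := Nat.lt_floor_add_one x
  have hy1 : (⌊2 * x⌋₊ : ℝ) ≤ 2 * x := Nat.floor_le (by linarith)
  have hy2 : 2 * x < ⌊2 * x⌋₊ + 1 := Nat.lt_floor_add_one _
  have hXY : ⌊x⌋₊ ≤ ⌊2 * x⌋₊ := Nat.floor_le_floor (by linarith)
  have h1 := h (⌊2 * x⌋₊ + 1 + i) (by omega) (by omega)
  have h2 := h (⌊2 * x⌋₊ + i) (by omega) (by omega)
  have h3 := h (⌊x⌋₊ + i) (by omega) (by omega)
  have h4 := h (⌊x⌋₊ + 1 + i) (by omega) (by omega)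
  unfold combo
  rw [abs_le] at *
  set b := 2 * x - (⌊2 * x⌋₊ : ℝ) with hb
  set a := (⌊x⌋₊ : ℝ) + 1 - x with ha
  have hb0 : 0 ≤ b := by linarith
  have hb1 : 0 ≤ 1 - b := by linarith
  have ha0 : 0 ≤ a := by linarith
  have ha1 : 0 ≤ 1 - a := by linarith
  constructor
  · nlinarith [mul_le_mul_of_nonneg_left h1.1 hb0, mul_le_mul_of_nonneg_left h2.1 hb1, mul_le_mul_of_nonneg_left h3.2 ha0, mul_le_mul_of_nonneg_left h4.2 ha1]
  · nlinarith [mul_le_mul_of_nonneg_left h1.2 hb0, mul_le_mul_of_nonneg_left h2.2 hb1, mul_le_mul_of_nonneg_left h3.1 ha0, mul_le_mul_of_nonneg_left h4.1 ha1]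

/-- first swap -/
theorem swap1 (q h : ℕ) (f : ℕ → ℕ → ℝ) :
    ∑ k ∈ (Finset.Icc 1 h).filter (fun k => q ∣ k), ∑ i ∈ Finset.Ico 0 (h - k), f k i
      = ∑ i ∈ Finset.range h, ∑ k ∈ (Finset.Icc 1 (h - 1 - i)).filter (fun k => q ∣ k), f k i := by
  refine Finset.sum_comm' ?_
  intro k i
  simp only [Finset.mem_filter, Finset.mem_Icc, Finset.mem_Ico, Finset.mem_range]
  omega

theorem swap2 (q h : ℕ) (f : ℕ → ℕ → ℝ) :
    ∑ k ∈ (Finset.Icc 1 h).filter (fun k => q ∣ k), ∑ i ∈ Finset.Ico k h, f k i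
      = ∑ i ∈ Finset.range h, ∑ k ∈ (Finset.Icc 1 i).filter (fun k => q ∣ k), f k i := by
  refine Finset.sum_comm' ?_
  intro k i
  simp only [Finset.mem_filter, Finset.mem_Icc, Finset.mem_Ico, Finset.mem_range]
  omega

noncomputable def WW (R : ℝ) (q a : ℕ) (e : ℕ → ℕ) (k n : ℕ) : ℝ :=
  if (n : ZMod q) = (a : ZMod q) then vonMangoldt n * ellR R e n k else 0

theorem TT_WW (R : ℝ) (q a : ℕ) (e : ℕ → ℕ) (N K : ℕ) :
    TT R q a e N K = ∑ k ∈ (Finset.Icc 1 K).filter (fun k => q ∣ k), ∑ n ∈ Finset.Icc 1 N, WW R q a e k n := by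
  unfold TT WW
  refine Finset.sum_congr rfl fun k _ => ?_
  rw [Finset.sum_filter]

theorem ellR_one (R : ℝ) (n k : ℕ) : lamR R (n + k) = ellR R (fun d => d - 1) n k := by
  rw [lamR_eq]
  unfold ellR
  refine Finset.sum_congr rfl fun d hd => ?_
  rw [Finset.mem_Ioc] at hd
  congr 1
  apply if_congr _ rfl rfl
  have h1 : k * (d - 1) + k ≡ 0 [MOD d] := by
    rw [Nat.modEq_zero_iff_dvd]
    have : k * (d - 1) + k = k * d := by
      obtain ⟨c, rfl⟩ : ∃ c, d = c + 1 := ⟨d - 1, by omega⟩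
      simp; ring
    rw [this]; exact dvd_mul_left _ _
  rw [← Nat.modEq_zero_iff_dvd]
  constructor
  · intro h
    exact Nat.ModEq.add_right_cancel' k (h.trans h1.symm)
  · intro h
    exact (h.add_right k).trans h1

theorem ellR_two (R : ℝ) (n k : ℕ) : lamR R n = ellR R (fun _ => 1) (n + k) k := by
  rw [lamR_eq]
  unfold ellR
  refine Finset.sum_congr rfl fun d hd => ?_
  congr 1
  apply if_congr _ rfl rfl
  rw [← Nat.modEq_zero_iff_dvd, mul_one]
  constructor
  · intro h
    simpa using h.add_right k
  · intro h
    have : n + k ≡ 0 + k [MOD d] := by simpa using h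
    exact Nat.ModEq.add_right_cancel' k this

theorem S1_inner (x R : ℝ) (q h a k : ℕ) (hx : 2 ≤ x) (hk : k ≤ h) (hhx : (h:ℝ) ≤ x) :
    ∑ n ∈ (Finset.Ioc ⌊x⌋₊ ⌊2 * x + h - k⌋₊).filter (fun n : ℕ => (n : ZMod q) = (a : ZMod q)),
        (vonMangoldt n * lamR R (n + k)) * flen n x ((h : ℝ) - k)
      = ∑ n ∈ Finset.Icc 1 (⌊2 * x⌋₊ + h), WW R q a (fun d => d - 1) k n * ∑ i ∈ Finset.Ico 0 (h - k), GG x ((n:ℝ) - i) := by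
  have hkh : (k:ℝ) ≤ h := by exact_mod_cast hk
  have hk0 : (0:ℝ) ≤ k := by positivity
  have hz : (0:ℝ) ≤ 2 * x + h - k := by linarith
  have hy2 : 2 * x < ⌊2 * x⌋₊ + 1 := Nat.lt_floor_add_one _
  rw [Finset.sum_filter]
  have hsub : Finset.Ioc ⌊x⌋₊ ⌊2 * x + h - k⌋₊ ⊆ Finset.Icc 1 (⌊2 * x⌋₊ + h) := by
    intro n hn
    rw [Finset.mem_Ioc] at hn
    rw [Finset.mem_Icc]
    refine ⟨by omega, ?_⟩
    have h1 : (n:ℝ) ≤ 2 * x + h - k := (Nat.le_floor_iff hz).1 hn.2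
    have : (n:ℝ) < ((⌊2 * x⌋₊ + h + 1 : ℕ):ℝ) := by push_cast; linarith
    have : n < ⌊2 * x⌋₊ + h + 1 := by exact_mod_cast this
    omega
  have hF : ∀ n : ℕ, ∑ i ∈ Finset.Ico 0 (h - k), GG x ((n:ℝ) - i) = Phi x n - Phi x (n - ((h:ℝ) - k)) := by
    intro n
    rw [← Phi_tele x n 0 (h - k) (Nat.zero_le _)]
    rw [Nat.cast_sub hk]; simp
  rw [← Finset.sum_subset hsub]
  · refine Finset.sum_congr rfl fun n _ => ?_
    unfold WW
    split_ifs
    · rw [hF, ← flen_eq n x _ (by linarith) (by linarith) (by linarith), ellR_one]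
    · ring
  · intro n hn hn2
    rw [Finset.mem_Icc] at hn
    rw [Finset.mem_Ioc] at hn2
    rw [hF]
    rcases Nat.lt_or_ge ⌊x⌋₊ n with h1 | h1
    · have h2 : ⌊2 * x + h - k⌋₊ < n := by omega
      have h3 := (Nat.floor_lt hz).1 h2
      rw [Phi_high x _ (by linarith) (by linarith), Phi_high x _ (by linarith) (by linarith)]; ring
    · have h3 : (n:ℝ) ≤ x := (Nat.le_floor_iff (by linarith)).1 h1
      rw [Phi_low x _ (by linarith), Phi_low x _ (by linarith)]; ring

theorem S2_inner (x R : ℝ) (q h a k : ℕ) (hx : 2 ≤ x) (hk : k ≤ h) (hqk : q ∣ k) (hhx : (h:ℝ) ≤ x) :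
    ∑ n ∈ (Finset.Ioc ⌊x⌋₊ ⌊2 * x + h - k⌋₊).filter (fun n : ℕ => (n : ZMod q) = (a : ZMod q)),
        (vonMangoldt (n + k) * lamR R n) * flen n x ((h : ℝ) - k)
      = ∑ n ∈ Finset.Icc 1 (⌊2 * x⌋₊ + h), WW R q a (fun _ => 1) k n * ∑ i ∈ Finset.Ico k h, GG x ((n:ℝ) - i) := by
  have hkh : (k:ℝ) ≤ h := by exact_mod_cast hk
  have hk0 : (0:ℝ) ≤ k := by positivity
  have hz : (0:ℝ) ≤ 2 * x + h - k := by linarith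
  have hy2 : 2 * x < ⌊2 * x⌋₊ + 1 := Nat.lt_floor_add_one _
  rw [Finset.sum_filter]
  have hsub : Finset.Ioc (⌊x⌋₊ + k) (⌊2 * x + h - k⌋₊ + k) ⊆ Finset.Icc 1 (⌊2 * x⌋₊ + h) := by
    intro n hn
    rw [Finset.mem_Ioc] at hn
    rw [Finset.mem_Icc]
    refine ⟨by omega, ?_⟩
    have h1 : ((⌊2 * x + h - k⌋₊ : ℕ) : ℝ) ≤ 2 * x + h - k := Nat.floor_le hz
    have h2 : (n:ℝ) ≤ ((⌊2 * x + h - k⌋₊ : ℕ) : ℝ) + k := by exact_mod_cast hn.2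
    have : (n:ℝ) < ((⌊2 * x⌋₊ + h + 1 : ℕ):ℝ) := by push_cast; linarith
    have : n < ⌊2 * x⌋₊ + h + 1 := by exact_mod_cast this
    omega
  have hF : ∀ n : ℕ, ∑ i ∈ Finset.Ico k h, GG x ((n:ℝ) - i) = Phi x (n - k) - Phi x (n - h) := by
    intro n
    rw [← Phi_tele x n k h hk]
  rw [← Finset.sum_subset hsub]
  · rw [← Finset.map_add_right_Ioc, Finset.sum_map]
    refine Finset.sum_congr rfl fun n _ => ?_
    rw [addRightEmbedding_apply, hF]
    unfold WW
    have hz : ((n + k : ℕ) : ZMod q) = (n : ZMod q) := by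
      push_cast
      rw [(ZMod.natCast_eq_zero_iff k q).2 hqk, add_zero]
    rw [hz]
    split_ifs
    · rw [flen_eq n x _ (by linarith) (by linarith) (by linarith), ← ellR_two]
      push_cast
      rw [show (n:ℝ) + k - k = n by ring, show (n:ℝ) + k - h = n - (h - k) by ring]
    · ring
  · intro n hn hn2
    rw [Finset.mem_Icc] at hn
    rw [Finset.mem_Ioc] at hn2
    rw [hF]
    rcases Nat.lt_or_ge (⌊x⌋₊ + k) n with h1 | h1
    · have h2 : ⌊2 * x + h - k⌋₊ + k < n := by omega
      have h3 : 2 * x + h - k < ⌊2 * x + h - k⌋₊ + 1 := Nat.lt_floor_add_one _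
      have h4 : ((⌊2 * x + h - k⌋₊ : ℕ) : ℝ) + k + 1 ≤ n := by exact_mod_cast h2
      rw [Phi_high x _ (by linarith) (by linarith), Phi_high x _ (by linarith) (by linarith)]; ring
    · have h3 : ((⌊x⌋₊ : ℕ):ℝ) ≤ x := Nat.floor_le (by linarith)
      have h4 : (n:ℝ) ≤ ((⌊x⌋₊ : ℕ):ℝ) + k := by exact_mod_cast h1
      rw [Phi_low x _ (by linarith), Phi_low x _ (by linarith)]; ring

/-- combined inner form -/
theorem combo_form (x R : ℝ) (q h a : ℕ) (hx : 2 ≤ x) (e K : ℕ → ℕ) :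
    ∑ i ∈ Finset.range h, ∑ k ∈ (Finset.Icc 1 (K i)).filter (fun k => q ∣ k),
      ∑ n ∈ Finset.Icc 1 (⌊2 * x⌋₊ + h), WW R q a e k n * GG x ((n:ℝ) - i)
    = ∑ i ∈ Finset.range h, combo x i (fun N => TT R q a e N (K i)) := by
  refine Finset.sum_congr rfl fun i hi => ?_
  rw [Finset.mem_range] at hi
  have : ∀ k ∈ (Finset.Icc 1 (K i)).filter (fun k => q ∣ k), ∑ n ∈ Finset.Icc 1 (⌊2 * x⌋₊ + h), WW R q a e k n * GG x ((n:ℝ) - i)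
      = combo x i (fun N => ∑ n ∈ Finset.Icc 1 N, WW R q a e k n) := by
    intro k _
    exact sum_GG x hx _ _ _ (by omega)
  rw [Finset.sum_congr rfl this, combo_sum]
  simp_rw [TT_WW]

noncomputable def Ssum (x R : ℝ) (q h a : ℕ) : ℝ :=
  ∑ k ∈ (Finset.Icc 1 h).filter (fun k => q ∣ k),
          ∑ n ∈ (Finset.Ioc ⌊x⌋₊ ⌊2 * x + h - k⌋₊).filter
              (fun n : ℕ => (n : ZMod q) = (a : ZMod q)),
            (ArithmeticFunction.vonMangoldt n * lamR R (n + k)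
              + ArithmeticFunction.vonMangoldt (n + k) * lamR R n)
              * flen n x ((h : ℝ) - k)

theorem Ssum_eq (x R : ℝ) (q h a : ℕ) (hx : 2 ≤ x) (hhx : (h:ℝ) ≤ x) :
    Ssum x R q h a = ∑ i ∈ Finset.range h, combo x i (fun N => TT R q a (fun d => d - 1) N (h - 1 - i))
      + ∑ i ∈ Finset.range h, combo x i (fun N => TT R q a (fun _ => 1) N i) := by
  rw [← combo_form x R q h a hx (fun d => d - 1) (fun i => h - 1 - i), ← combo_form x R q h a hx (fun _ => 1) (fun i => i),
    ← swap1 q h (fun k i => ∑ n ∈ Finset.Icc 1 (⌊2 * x⌋₊ + h), WW R q a (fun d => d - 1) k n * GG x ((n:ℝ) - i)),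
    ← swap2 q h (fun k i => ∑ n ∈ Finset.Icc 1 (⌊2 * x⌋₊ + h), WW R q a (fun _ => 1) k n * GG x ((n:ℝ) - i)),
    ← Finset.sum_add_distrib]
  unfold Ssum
  refine Finset.sum_congr rfl fun k hk => ?_
  rw [Finset.mem_filter, Finset.mem_Icc] at hk
  simp_rw [add_mul]
  rw [Finset.sum_add_distrib, S1_inner x R q h a k hx hk.1.2 hhx, S2_inner x R q h a k hx hk.1.2 hk.2 hhx]
  congr 1
  · rw [Finset.sum_comm]
    refine Finset.sum_congr rfl fun n _ => by rw [Finset.mul_sum]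
  · rw [Finset.sum_comm]
    refine Finset.sum_congr rfl fun n _ => by rw [Finset.mul_sum]

noncomputable def M0 (R : ℝ) (q h : ℕ) : ℝ :=
  ∑ k ∈ (Finset.Icc 1 h).filter (fun k => q ∣ k), ((h:ℝ) - k) * SS R k

theorem M0_one (R : ℝ) (q h : ℕ) :
    ∑ i ∈ Finset.range h, ∑ k ∈ (Finset.Icc 1 (h - 1 - i)).filter (fun k => q ∣ k), SS R k = M0 R q h := by
  rw [← swap1 q h (fun k _ => SS R k)]
  unfold M0
  refine Finset.sum_congr rfl fun k hk => ?_
  rw [Finset.mem_filter, Finset.mem_Icc] at hk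
  rw [Finset.sum_const, Nat.card_Ico, nsmul_eq_mul, Nat.sub_zero, Nat.cast_sub hk.1.2]

theorem M0_two (R : ℝ) (q h : ℕ) :
    ∑ i ∈ Finset.range h, ∑ k ∈ (Finset.Icc 1 i).filter (fun k => q ∣ k), SS R k = M0 R q h := by
  rw [← swap2 q h (fun k _ => SS R k)]
  unfold M0
  refine Finset.sum_congr rfl fun k hk => ?_
  rw [Finset.mem_filter, Finset.mem_Icc] at hk
  rw [Finset.sum_const, Nat.card_Ico, nsmul_eq_mul, Nat.cast_sub hk.1.2]

theorem half_S (C x R : ℝ) (q h a : ℕ) (e K : ℕ → ℕ) (hC : 0 < C)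
    (hTT : ∀ (R : ℝ) (q a : ℕ) (e : ℕ → ℕ) (N K : ℕ), 0 ≤ R → 1 ≤ q → 2 ≤ N →
    q * ⌊R⌋₊ ≤ N → K ≤ N → a.Coprime q → (∀ d, 1 ≤ d → (e d).Coprime d) →
    |TT R q a e N K - N / (q.totient : ℝ) * ∑ k ∈ (Finset.Icc 1 K).filter (fun k => q ∣ k), SS R k|
      ≤ C * (Real.sqrt N * (Real.log N) ^ 2) * ((K / q : ℝ) * Real.sqrt R + Real.sqrt (K / q : ℝ) * R))
    (hx : 2 ≤ x) (hR : 2 ≤ R) (hq : 1 ≤ q) (hhx : (h:ℝ) ≤ x) (hqR : (q:ℝ) * R ≤ x) (ha : a.Coprime q)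
    (he : ∀ d, 1 ≤ d → (e d).Coprime d) (hK : ∀ i, i < h → K i ≤ h) :
    |∑ i ∈ Finset.range h, combo x i (fun N => TT R q a e N (K i))
      - x / (q.totient : ℝ) * ∑ i ∈ Finset.range h, ∑ k ∈ (Finset.Icc 1 (K i)).filter (fun k => q ∣ k), SS R k|
      ≤ 36 * C * (h * (Real.sqrt x * (Real.log x) ^ 2 * ((h / q : ℝ) * Real.sqrt R + Real.sqrt (h / q : ℝ) * R))) := by
  have hq0 : (0:ℝ) < q := by exact_mod_cast hq
  rw [Finset.mul_sum, ← Finset.sum_sub_distrib]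
  set E := 18 * C * (Real.sqrt x * (Real.log x) ^ 2 * ((h / q : ℝ) * Real.sqrt R + Real.sqrt (h / q : ℝ) * R)) with hE
  have key : ∀ i ∈ Finset.range h, |combo x i (fun N => TT R q a e N (K i))
      - x / (q.totient : ℝ) * ∑ k ∈ (Finset.Icc 1 (K i)).filter (fun k => q ∣ k), SS R k| ≤ 2 * E := by
    intro i hi
    rw [Finset.mem_range] at hi
    have h1 : x / (q.totient : ℝ) * ∑ k ∈ (Finset.Icc 1 (K i)).filter (fun k => q ∣ k), SS R k
        = combo x i (fun N => (N:ℝ) * (1 / (q.totient : ℝ) * ∑ k ∈ (Finset.Icc 1 (K i)).filter (fun k => q ∣ k), SS R k)) := by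
      rw [combo_main]; ring
    rw [h1]
    refine combo_bound x hx i _ _ E ?_
    intro N hN1 hN2
    have hX2 : 2 ≤ ⌊x⌋₊ := Nat.le_floor (by exact_mod_cast hx)
    have hhX : h ≤ ⌊x⌋₊ := Nat.le_floor hhx
    have hQ : (⌊R⌋₊ : ℝ) ≤ R := Nat.floor_le (by linarith)
    have hqQ : q * ⌊R⌋₊ ≤ ⌊x⌋₊ := by
      apply Nat.le_floor
      push_cast
      nlinarith
    have h2 := hTT R q a e N (K i) (by linarith) hq (by omega) (hqQ.trans hN1) ((hK i hi).trans (hhX.trans hN1)) ha he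
    have h3 : (N:ℝ) * (1 / (q.totient : ℝ) * ∑ k ∈ (Finset.Icc 1 (K i)).filter (fun k => q ∣ k), SS R k)
      = N / (q.totient : ℝ) * ∑ k ∈ (Finset.Icc 1 (K i)).filter (fun k => q ∣ k), SS R k := by ring
    simp only [h3]
    refine h2.trans ?_
    have hN4 : (N:ℝ) ≤ 4 * x := by
      have h5 : (⌊2 * x⌋₊ : ℝ) ≤ 2 * x := Nat.floor_le (by linarith)
      have h6 : (N:ℝ) ≤ (⌊2 * x⌋₊ : ℝ) + 1 + i := by exact_mod_cast hN2
      have h7 : (i:ℝ) + 1 ≤ h := by exact_mod_cast hi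
      linarith
    have hN2' : (2:ℝ) ≤ N := by exact_mod_cast (hX2.trans hN1)
    have hsq : Real.sqrt N ≤ 2 * Real.sqrt x := by
      refine (Real.sqrt_le_sqrt hN4).trans (le_of_eq ?_)
      rw [Real.sqrt_mul (by norm_num), show (4:ℝ) = 2 ^ 2 by norm_num, Real.sqrt_sq (by norm_num)]
    have hlx : Real.log 2 ≤ Real.log x := Real.log_le_log (by norm_num) hx
    have hl2 : 0 < Real.log 2 := Real.log_pos (by norm_num)
    have hlog : Real.log N ≤ 3 * Real.log x := by
      refine (Real.log_le_log (by linarith) hN4).trans ?_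
      rw [Real.log_mul (by norm_num) (by linarith), show (4:ℝ) = 2 ^ 2 by norm_num, Real.log_pow]
      push_cast; linarith
    have hlogN : 0 ≤ Real.log N := Real.log_nonneg (by linarith)
    have hKh : (K i : ℝ) / q ≤ h / q := by
      have : (K i : ℝ) ≤ h := by exact_mod_cast hK i hi
      gcongr
    have hA : Real.sqrt N * (Real.log N) ^ 2 ≤ 18 * (Real.sqrt x * (Real.log x) ^ 2) := by
      calc _ ≤ (2 * Real.sqrt x) * (3 * Real.log x) ^ 2 := by gcongr
        _ = _ := by ring
    have hB : (K i / q : ℝ) * Real.sqrt R + Real.sqrt (K i / q : ℝ) * R ≤ (h / q : ℝ) * Real.sqrt R + Real.sqrt (h / q : ℝ) * R := by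
      gcongr
    calc _ ≤ C * (18 * (Real.sqrt x * (Real.log x) ^ 2)) * ((h / q : ℝ) * Real.sqrt R + Real.sqrt (h / q : ℝ) * R) := by
          gcongr
      _ = E := by rw [hE]; ring
  refine (Finset.abs_sum_le_sum_abs _ _).trans ((Finset.sum_le_card_nsmul _ _ _ key).trans (le_of_eq ?_))
  rw [Finset.card_range, nsmul_eq_mul, hE]; ring

theorem S_reduction (hG : GRH) : ∃ C : ℝ, 0 < C ∧ ∀ (x R : ℝ) (q h a : ℕ), 2 ≤ x → 2 ≤ R → 1 ≤ q →
    (h:ℝ) ≤ x → (q:ℝ) * R ≤ x → a.Coprime q →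
    |Ssum x R q h a - 2 * (x / (q.totient : ℝ) * M0 R q h)|
      ≤ C * (h * (Real.sqrt x * (Real.log x) ^ 2 * ((h / q : ℝ) * Real.sqrt R + Real.sqrt (h / q : ℝ) * R))) := by
  obtain ⟨C, hC, hTT⟩ := TT_bound hG
  refine ⟨72 * C, by positivity, fun x R q h a hx hR hq hhx hqR ha => ?_⟩
  have h1 := half_S C x R q h a (fun d => d - 1) (fun i => h - 1 - i) hC hTT hx hR hq hhx hqR ha (by
    intro d hd
    obtain ⟨c, rfl⟩ : ∃ c, d = c + 1 := ⟨d - 1, by omega⟩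
    simp) (by intro i hi; omega)
  have h2 := half_S C x R q h a (fun _ => 1) (fun i => i) hC hTT hx hR hq hhx hqR ha (by
    intro d hd; simp) (by intro i hi; omega)
  rw [M0_one] at h1
  rw [M0_two] at h2
  rw [Ssum_eq x R q h a hx hhx]
  rw [abs_le] at *
  constructor <;> linarith [h1.1, h1.2, h2.1, h2.2]

theorem conv_sqf (Y k : ℕ) (hk : 1 ≤ k) (u : ℕ → ℝ) (hu : ∀ r, ¬ Squarefree r → u r = 0) :
    ∑ r ∈ Finset.Ioc 0 Y, u r = ∑ g ∈ k.divisors, ∑ s ∈ Finset.Ioc 0 (Y / g), (if s.Coprime k then u (g * s) else 0) := by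
  have h1 : ∀ r ∈ Finset.Ioc 0 Y, Nat.gcd r k ∈ k.divisors := fun r _ => by
    rw [Nat.mem_divisors]; exact ⟨Nat.gcd_dvd_right _ _, by omega⟩
  rw [← Finset.sum_fiberwise_of_maps_to h1]
  refine Finset.sum_congr rfl fun g hg => ?_
  rw [Nat.mem_divisors] at hg
  have hg1 : 1 ≤ g := Nat.pos_of_dvd_of_pos hg.1 hk
  have h2 := sum_multiples 0 Y g hg1 (fun r => if Nat.gcd r k = g then u r else 0)
  rw [Nat.zero_div] at h2
  have h3 : ∑ r ∈ (Finset.Ioc 0 Y).filter (fun r => Nat.gcd r k = g), u r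
      = ∑ r ∈ (Finset.Ioc 0 Y).filter (fun r => g ∣ r), (if Nat.gcd r k = g then u r else 0) := by
    rw [← Finset.sum_filter, Finset.filter_filter]
    apply Finset.sum_congr _ (fun _ _ => rfl)
    apply Finset.filter_congr
    intro r _
    constructor
    · intro h; exact ⟨h ▸ Nat.gcd_dvd_left r k, h⟩
    · intro h; exact h.2
  rw [h3, h2]
  refine Finset.sum_congr rfl fun s hs => ?_
  by_cases hsq : Squarefree (g * s)
  · apply if_congr _ rfl rfl
    have hgs : g.Coprime s := Nat.coprime_of_squarefree_mul hsq
    constructor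
    · intro h
      rw [Nat.coprime_iff_gcd_eq_one]
      have hd : g * Nat.gcd s k ∣ Nat.gcd (g * s) k := by
        apply Nat.dvd_gcd
        · exact Nat.mul_dvd_mul_left g (Nat.gcd_dvd_left s k)
        · exact Nat.Coprime.mul_dvd_of_dvd_of_dvd (Nat.Coprime.coprime_dvd_right (Nat.gcd_dvd_left s k) hgs) hg.1 (Nat.gcd_dvd_right s k)
      rw [h] at hd
      have := Nat.le_of_dvd hg1 hd
      have h0 : 1 ≤ Nat.gcd s k := Nat.gcd_pos_of_pos_right s hk
      nlinarith
    · intro h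
      rw [Nat.Coprime.gcd_mul_right_cancel g h]
      exact Nat.gcd_eq_left hg.1
  · rw [hu _ hsq]; simp

noncomputable def afId : ArithmeticFunction ℝ := ⟨fun n => (n:ℝ), by simp⟩
noncomputable def afIdPhi : ArithmeticFunction ℝ := ⟨fun n => (n:ℝ) / n.totient, by simp⟩
noncomputable def afPhi (q : ℕ) : ArithmeticFunction ℝ := ⟨fun n => if n.Coprime q then 1 / (n.totient:ℝ) else 0, by simp⟩

theorem afId_mult : afId.IsMultiplicative := by
  refine ⟨by simp [afId], fun {m n} _ => by simp [afId]⟩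

theorem afIdPhi_mult : afIdPhi.IsMultiplicative := by
  refine ⟨by simp [afIdPhi], fun {m n} h => ?_⟩
  simp only [afIdPhi, ArithmeticFunction.coe_mk]
  rw [Nat.totient_mul h]; push_cast
  rw [div_mul_div_comm]

theorem afPhi_mult (q : ℕ) : (afPhi q).IsMultiplicative := by
  refine ⟨by simp [afPhi], fun {m n} h => ?_⟩
  simp only [afPhi, ArithmeticFunction.coe_mk]
  rw [Nat.totient_mul h]; push_cast
  rw [if_congr Nat.coprime_mul_iff_left rfl rfl]
  by_cases h1 : m.Coprime q
  · by_cases h2 : n.Coprime q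
    · rw [if_pos ⟨h1, h2⟩, if_pos h1, if_pos h2, div_mul_div_comm, one_mul]
    · rw [if_neg (fun h => h2 h.2), if_neg h2, mul_zero]
  · rw [if_neg (fun h => h1 h.1), if_neg h1, zero_mul]

theorem totient_sqf (n : ℕ) (hn : Squarefree n) : (n.totient : ℝ) = ∏ p ∈ n.primeFactors, ((p:ℝ) - 1) := by
  rw [totient_prod_real]
  nth_rw 1 [← Nat.prod_primeFactors_of_squarefree hn]
  push_cast
  rw [← Finset.prod_mul_distrib]
  refine Finset.prod_congr rfl fun p hp => ?_
  have : (p:ℝ) ≠ 0 := by exact_mod_cast (Nat.prime_of_mem_primeFactors hp).ne_zero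
  field_simp

theorem moebius_sqf (n : ℕ) (hn : Squarefree n) : (moebius n : ℝ) = ∏ p ∈ n.primeFactors, (-1:ℝ) := by
  rw [Finset.prod_const, moebius_apply_of_squarefree hn]
  rw [(ArithmeticFunction.cardDistinctFactors_eq_cardFactors_iff_squarefree hn.ne_zero).2 hn |>.symm]
  rw [ArithmeticFunction.cardDistinctFactors_apply]
  push_cast; rfl

theorem sum_id_moebius (n : ℕ) (hn : Squarefree n) :
    ∑ e ∈ n.divisors, (e:ℝ) * (moebius e : ℝ) = (moebius n : ℝ) * n.totient := by
  have := afId_mult.prodPrimeFactors_one_sub_of_squarefree _ hn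
  simp only [afId, ArithmeticFunction.coe_mk] at this
  rw [totient_sqf n hn, moebius_sqf n hn, ← Finset.prod_mul_distrib]
  simp_rw [mul_comm (_:ℝ) (moebius _ : ℝ)]
  rw [← this]
  refine Finset.prod_congr rfl fun p _ => by ring

theorem sum_idphi_moebius (n : ℕ) (hn : Squarefree n) :
    ∑ e ∈ n.divisors, (e:ℝ) * (moebius e : ℝ) / e.totient = (moebius n : ℝ) / n.totient := by
  have := afIdPhi_mult.prodPrimeFactors_one_sub_of_squarefree _ hn
  simp only [afIdPhi, ArithmeticFunction.coe_mk] at this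
  rw [totient_sqf n hn, moebius_sqf n hn, ← Finset.prod_div_distrib]
  have h2 : ∀ e : ℕ, (e:ℝ) * (moebius e : ℝ) / e.totient = (moebius e : ℝ) * ((e:ℝ) / e.totient) := fun e => by ring
  simp_rw [h2]
  rw [← this]
  refine Finset.prod_congr rfl fun p hp => ?_
  have hp := Nat.prime_of_mem_primeFactors hp
  rw [Nat.totient_prime hp, Nat.cast_sub hp.one_lt.le]
  have : (p:ℝ) - 1 ≠ 0 := by
    have : (1:ℝ) < p := by exact_mod_cast hp.one_lt
    linarith
  push_cast
  field_simp
  ring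

theorem sum_sqf_prod (f : ArithmeticFunction ℝ) (hf : f.IsMultiplicative) (n : ℕ) (hn : 1 ≤ n) :
    ∑ g ∈ n.divisors, (moebius g : ℝ) ^ 2 * f g = ∏ p ∈ n.primeFactors, (1 + f p) := by
  set r := ∏ p ∈ n.primeFactors, p with hr
  have hrd : r ∣ n := Nat.prod_primeFactors_dvd n
  have hrp : r.primeFactors = n.primeFactors := Nat.primeFactors_prod (fun p hp => Nat.prime_of_mem_primeFactors hp)
  have hrs : Squarefree r := by
    rw [hr]
    exact Finset.squarefree_prod_of_pairwise_isCoprime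
      (by
        intro a ha b hb hab
        exact Nat.coprime_iff_isRelPrime.1 ((Nat.coprime_primes (Nat.prime_of_mem_primeFactors ha) (Nat.prime_of_mem_primeFactors hb)).2 hab))
      (fun p hp => (Nat.prime_of_mem_primeFactors hp).squarefree)
  rw [← hrp, hf.prodPrimeFactors_one_add_of_squarefree hrs]
  have h1 : ∑ g ∈ r.divisors, f g = ∑ g ∈ r.divisors, (moebius g : ℝ) ^ 2 * f g := by
    refine Finset.sum_congr rfl fun g hg => ?_
    have : Squarefree g := hrs.squarefree_of_dvd (Nat.dvd_of_mem_divisors hg)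
    have h := moebius_sq_eq_one_of_squarefree this
    have h' : (moebius g : ℝ)^2 = 1 := by exact_mod_cast h
    rw [h', one_mul]
  rw [h1]
  symm
  apply Finset.sum_subset (Nat.divisors_subset_of_dvd (by omega) hrd)
  intro g hg hg2
  by_cases hs : Squarefree g
  · exfalso; apply hg2
    rw [Nat.mem_divisors] at hg ⊢
    refine ⟨?_, hrs.ne_zero⟩
    rw [← Nat.prod_primeFactors_of_squarefree hs, hr]
    exact Finset.prod_dvd_prod_of_subset _ _ _ (Nat.primeFactors_mono hg.1 hg.2)
  · rw [moebius_eq_zero_of_not_squarefree hs]; simp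

noncomputable def pp (q k s : ℕ) : ℝ := if s.Coprime k ∧ s.Coprime q then (moebius s : ℝ) / (s.totient : ℝ) ^ 2 else 0
noncomputable def ff (q g : ℕ) : ℝ := (moebius g : ℝ) ^ 2 * afPhi q g

theorem ff_apply (q g : ℕ) : ff q g = if g.Coprime q then (moebius g : ℝ) ^ 2 / g.totient else 0 := by
  unfold ff afPhi
  simp only [ArithmeticFunction.coe_mk]
  split_ifs <;> ring

theorem SS_eq_one (R : ℝ) (k : ℕ) :
    SS R k = ∑ r ∈ Finset.Ioc 0 ⌊R⌋₊, (moebius r : ℝ) ^ 2 / (r.totient : ℝ) *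
      ∑ d ∈ r.divisors, (if k.Coprime d then (d:ℝ) * (moebius d : ℝ) / d.totient else 0) := by
  unfold SS wR cR
  have h1 : ∀ d ∈ Finset.Ioc 0 ⌊R⌋₊, (if k.Coprime d then (d:ℝ) * (moebius d : ℝ) * (∑ r ∈ (Finset.Ioc 0 ⌊R⌋₊).filter (fun r => d ∣ r), (moebius r : ℝ) ^ 2 / (r.totient : ℝ)) / (d.totient : ℝ) else 0)
      = ∑ r ∈ (Finset.Ioc 0 ⌊R⌋₊).filter (fun r => d ∣ r), (moebius r : ℝ) ^ 2 / (r.totient : ℝ) * (if k.Coprime d then (d:ℝ) * (moebius d : ℝ) / d.totient else 0) := by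
    intro d _
    rw [← Finset.sum_mul]
    split_ifs
    · ring
    · ring
  rw [Finset.sum_congr rfl h1]
  simp_rw [Finset.mul_sum]
  refine (Finset.sum_comm' ?_).symm
  intro r d
  simp only [Nat.mem_divisors, Finset.mem_Ioc, Finset.mem_filter]
  constructor
  · rintro ⟨⟨h1, h2⟩, h3, h4⟩
    exact ⟨⟨⟨h1, h2⟩, h3⟩, Nat.pos_of_dvd_of_pos h3 (by omega), (Nat.le_of_dvd (by omega) h3).trans h2⟩
  · rintro ⟨⟨⟨h1, h2⟩, h3⟩, h4⟩
    exact ⟨⟨h1, h2⟩, h3, by omega⟩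

theorem moebius_not_sqf (r : ℕ) (h : ¬ Squarefree r) : (moebius r : ℝ) = 0 := by
  rw [moebius_eq_zero_of_not_squarefree h]; simp

theorem moebius_sq_sqf (r : ℕ) (h : Squarefree r) : (moebius r : ℝ) ^ 2 = 1 := by
  exact_mod_cast moebius_sq_eq_one_of_squarefree h

theorem moebius_mul_cop (g s : ℕ) (h : g.Coprime s) : (moebius (g * s) : ℝ) = (moebius g : ℝ) * (moebius s : ℝ) := by
  rw [isMultiplicative_moebius.map_mul_of_coprime h]; push_cast; rfl

theorem not_sqf_cases (g s : ℕ) (h : g.Coprime s) (hn : ¬ Squarefree (g * s)) :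
    (moebius g : ℝ) * (moebius s : ℝ) = 0 := by
  rw [← moebius_mul_cop g s h, moebius_not_sqf _ hn]

theorem SS_eq (R : ℝ) (k : ℕ) (hk : 1 ≤ k) :
    SS R k = ∑ g ∈ k.divisors, ∑ s ∈ Finset.Ioc 0 (⌊R⌋₊ / g), ff 1 g * pp 1 k s := by
  rw [SS_eq_one, conv_sqf _ k hk]
  · refine Finset.sum_congr rfl fun g hg => Finset.sum_congr rfl fun s hs => ?_
    rw [Nat.mem_divisors] at hg
    rw [ff_apply, if_pos (Nat.coprime_one_right g)]
    unfold pp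
    by_cases hsk : s.Coprime k
    · rw [if_pos hsk, if_pos ⟨hsk, Nat.coprime_one_right s⟩]
      have hgs : g.Coprime s := (Nat.Coprime.coprime_dvd_right hg.1 hsk).symm
      by_cases hsq : Squarefree (g * s)
      · have hs' : Squarefree s := hsq.squarefree_of_dvd (dvd_mul_left s g)
        have hg' : Squarefree g := hsq.squarefree_of_dvd (dvd_mul_right g s)
        have : ∑ d ∈ (g * s).divisors, (if k.Coprime d then (d:ℝ) * (moebius d : ℝ) / d.totient else 0)
            = (moebius s : ℝ) / s.totient := by
          rw [← sum_idphi_moebius s hs', ← Finset.sum_filter]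
          apply Finset.sum_congr _ (fun _ _ => rfl)
          ext d
          simp only [Finset.mem_filter, Nat.mem_divisors]
          constructor
          · rintro ⟨⟨h1, h2⟩, h3⟩
            refine ⟨?_, hs'.ne_zero⟩
            exact Nat.Coprime.dvd_of_dvd_mul_left (Nat.Coprime.coprime_dvd_left hg.1 h3).symm h1
          · rintro ⟨h1, h2⟩
            exact ⟨⟨h1.mul_left g, hsq.ne_zero⟩, (Nat.Coprime.coprime_dvd_left h1 hsk).symm⟩
        rw [this, moebius_sq_sqf _ hsq, moebius_sq_sqf _ hg', Nat.totient_mul hgs]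
        push_cast
        ring
      · rw [moebius_not_sqf _ hsq]
        have := not_sqf_cases g s hgs hsq
        have h2 : (moebius g : ℝ) ^ 2 / g.totient * ((moebius s : ℝ) / (s.totient:ℝ)^2)
          = ((moebius g : ℝ) * (moebius s : ℝ)) * ((moebius g : ℝ) / g.totient / (s.totient:ℝ)^2) := by ring
        rw [h2, this]; simp
    · rw [if_neg hsk, if_neg (c := s.Coprime _ ∧ s.Coprime _) (fun h => hsk h.1), mul_zero]
  · intro r hr; rw [moebius_not_sqf r hr]; simp

noncomputable def GZ (Z q j : ℕ) : ℝ :=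
  ∑ r ∈ Finset.Ioc 0 Z, (if r.Coprime q then (moebius r : ℝ) / (r.totient : ℝ) ^ 2 *
    ∑ e ∈ r.divisors, (if e ∣ j then (e:ℝ) * (moebius e : ℝ) else 0) else 0)

theorem GZ_eq (Z q j : ℕ) (hj : 1 ≤ j) :
    GZ Z q j = ∑ g ∈ j.divisors, ∑ s ∈ Finset.Ioc 0 (Z / g), ff q g * pp q j s := by
  unfold GZ
  rw [conv_sqf _ j hj]
  · refine Finset.sum_congr rfl fun g hg => Finset.sum_congr rfl fun s hs => ?_
    rw [Nat.mem_divisors] at hg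
    rw [ff_apply]
    unfold pp
    by_cases hsk : s.Coprime j
    · rw [if_pos hsk]
      have hgs : g.Coprime s := (Nat.Coprime.coprime_dvd_right hg.1 hsk).symm
      rw [if_congr (Nat.coprime_mul_iff_left (k := q) (m := g) (n := s)) rfl rfl]
      by_cases hgq : g.Coprime q
      swap
      · rw [if_neg hgq, if_neg (fun h => hgq h.1), zero_mul]
      by_cases hsq1 : s.Coprime q
      swap
      · rw [if_neg (fun h => hsq1 h.2), if_neg (c := s.Coprime j ∧ s.Coprime q) (fun h => hsq1 h.2), mul_zero]
      rw [if_pos ⟨hgq, hsq1⟩, if_pos hgq, if_pos ⟨hsk, hsq1⟩]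
      by_cases hsq : Squarefree (g * s)
      · have hs' : Squarefree s := hsq.squarefree_of_dvd (dvd_mul_left s g)
        have hg' : Squarefree g := hsq.squarefree_of_dvd (dvd_mul_right g s)
        have : ∑ e ∈ (g * s).divisors, (if e ∣ j then (e:ℝ) * (moebius e : ℝ) else 0)
            = (moebius g : ℝ) * g.totient := by
          rw [← sum_id_moebius g hg', ← Finset.sum_filter]
          apply Finset.sum_congr _ (fun _ _ => rfl)
          ext d
          simp only [Finset.mem_filter, Nat.mem_divisors]
          constructor
          · rintro ⟨⟨h1, h2⟩, h3⟩
            refine ⟨?_, hg'.ne_zero⟩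
            exact Nat.Coprime.dvd_of_dvd_mul_right (Nat.Coprime.coprime_dvd_right h3 hsk).symm h1
          · rintro ⟨h1, h2⟩
            exact ⟨⟨h1.mul_right s, hsq.ne_zero⟩, h1.trans hg.1⟩
        rw [this, moebius_mul_cop g s hgs, Nat.totient_mul hgs]
        have : (g.totient : ℝ) ≠ 0 := by
          exact_mod_cast (Nat.totient_pos.2 (Nat.pos_of_ne_zero hg'.ne_zero)).ne'
        have : (s.totient : ℝ) ≠ 0 := by
          exact_mod_cast (Nat.totient_pos.2 (Nat.pos_of_ne_zero hs'.ne_zero)).ne'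
        push_cast
        field_simp
      · rw [moebius_not_sqf _ hsq]
        have := not_sqf_cases g s hgs hsq
        have h2 : (moebius g : ℝ) ^ 2 / g.totient * ((moebius s : ℝ) / (s.totient:ℝ)^2)
          = ((moebius g : ℝ) * (moebius s : ℝ)) * ((moebius g : ℝ) / g.totient / (s.totient:ℝ)^2) := by ring
        rw [h2, this]; simp
    · rw [if_neg hsk, if_neg (c := s.Coprime _ ∧ s.Coprime _) (fun h => hsk h.1), mul_zero]
  · intro r hr; rw [moebius_not_sqf r hr]; simp

noncomputable def DD (k : ℕ) : ℝ := ∑ g ∈ k.divisors, (g:ℝ) / g.totient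

theorem pp_abs (q k s : ℕ) : |pp q k s| ≤ 1 / (s.totient:ℝ) ^ 2 := by
  unfold pp
  split_ifs
  · rw [abs_div, abs_of_nonneg (by positivity : (0:ℝ) ≤ (s.totient:ℝ)^2)]
    gcongr
    exact abs_moebius_le s
  · simp

theorem ff_nonneg (q g : ℕ) : 0 ≤ ff q g := by
  rw [ff_apply]; split_ifs <;> positivity

theorem ff_le (q g : ℕ) : ff q g ≤ 1 / (g.totient:ℝ) := by
  rw [ff_apply]
  split_ifs
  · gcongr; exact moebius_sq_le g
  · positivity

theorem tail_inv_totient_sq (Y Z g : ℕ) (hY : 1 ≤ Y) (hg : 1 ≤ g) :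
    ∑ s ∈ Finset.Ioc (Y / g) Z, 1 / (s.totient:ℝ)^2 ≤ KK * 4 * g / Y := by
  have h1 : ∑ s ∈ Finset.Ioc (Y / g) Z, 1 / (s.totient:ℝ)^2 = ∑ s ∈ Finset.Ioc (Y / g) Z, phiF s * (1 / (s:ℝ)^2) := by
    refine Finset.sum_congr rfl fun s hs => ?_
    rw [Finset.mem_Ioc] at hs
    exact inv_totient_sq s (lt_of_le_of_lt (Nat.zero_le _) hs.1)
  rw [h1]
  have hY' : (0:ℝ) < Y := by exact_mod_cast hY
  have hK := KK_pos
  by_cases h : 1 ≤ Y / g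
  · refine (phiF_sum_inv_sq _ Z h).trans ?_
    have h2 := half_le_div Y g hg h
    have hg' : (0:ℝ) < g := by exact_mod_cast hg
    have h3 : (0:ℝ) < ((Y / g : ℕ):ℝ) := by exact_mod_cast h
    rw [mul_assoc, mul_div_assoc]
    apply mul_le_mul_of_nonneg_left _ hK.le
    rw [div_le_div_iff₀ h3 hY']
    rw [div_le_iff₀ hg'] at h2
    nlinarith
  · have h0 : Y / g = 0 := Nat.lt_one_iff.1 (not_le.1 h)
    rw [h0]
    refine (phiF_sum_inv_sq0 Z).trans ?_
    have : Y < g := by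
      rcases Nat.div_eq_zero_iff.1 h0 with h | h <;> omega
    have : (Y:ℝ) ≤ g := by exact_mod_cast this.le
    rw [le_div_iff₀ hY']
    nlinarith

theorem approx_gen (Y Z q k : ℕ) (hY : 1 ≤ Y) (hYZ : Y ≤ Z) :
    |∑ g ∈ k.divisors, ∑ s ∈ Finset.Ioc 0 (Y / g), ff q g * pp q k s
      - (∑ g ∈ k.divisors, ff q g) * ∑ s ∈ Finset.Ioc 0 Z, pp q k s| ≤ KK * 4 / Y * DD k := by
  rw [Finset.sum_mul, ← Finset.sum_sub_distrib]
  refine (Finset.abs_sum_le_sum_abs _ _).trans ?_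
  unfold DD
  rw [Finset.mul_sum]
  refine Finset.sum_le_sum fun g hg => ?_
  have hg1 : 1 ≤ g := Nat.pos_of_mem_divisors hg
  have hle : Y / g ≤ Z := (Nat.div_le_self Y g).trans hYZ
  have hsp : ∑ s ∈ Finset.Ioc 0 Z, pp q k s = ∑ s ∈ Finset.Ioc 0 (Y / g), pp q k s + ∑ s ∈ Finset.Ioc (Y / g) Z, pp q k s := by
    rw [Finset.sum_Ioc_consecutive _ (Nat.zero_le _) hle]
  rw [← Finset.mul_sum, hsp, ← mul_sub, abs_mul, abs_of_nonneg (ff_nonneg q g)]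
  have h1 : |∑ s ∈ Finset.Ioc 0 (Y / g), pp q k s - (∑ s ∈ Finset.Ioc 0 (Y / g), pp q k s + ∑ s ∈ Finset.Ioc (Y / g) Z, pp q k s)|
      ≤ KK * 4 * g / Y := by
    rw [sub_add_cancel_left, abs_neg]
    refine (Finset.abs_sum_le_sum_abs _ _).trans ?_
    exact (Finset.sum_le_sum fun s _ => pp_abs q k s).trans (tail_inv_totient_sq Y Z g hY hg1)
  have h0 : 0 ≤ KK * 4 * g / Y := le_trans (abs_nonneg _) h1
  calc _ ≤ 1 / (g.totient:ℝ) * (KK * 4 * g / Y) := mul_le_mul (ff_le q g) h1 (abs_nonneg _) (by positivity)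
    _ = _ := by ring

theorem sum_ff_prod (q n : ℕ) (hn : 1 ≤ n) : ∑ g ∈ n.divisors, ff q g = ∏ p ∈ n.primeFactors, (1 + afPhi q p) :=
  sum_sqf_prod (afPhi q) (afPhi_mult q) n hn

theorem one_add_inv_pred (p : ℕ) (hp : p.Prime) : 1 + 1 / (p.totient:ℝ) = (1 - (p:ℝ)⁻¹)⁻¹ := by
  rw [Nat.totient_prime hp, Nat.cast_sub hp.one_lt.le]
  have h1 : (1:ℝ) < p := by exact_mod_cast hp.one_lt
  have : (p:ℝ) - 1 ≠ 0 := by linarith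
  have : (p:ℝ) ≠ 0 := by linarith
  push_cast
  field_simp
  ring

theorem afPhi_one (p : ℕ) : afPhi 1 p = 1 / (p.totient:ℝ) := by
  simp [afPhi]

theorem sum_ff_one (n : ℕ) (hn : 1 ≤ n) : ∑ g ∈ n.divisors, ff 1 g = (n:ℝ) / n.totient := by
  rw [sum_ff_prod 1 n hn, totient_prod_real]
  have hn0 : (n:ℝ) ≠ 0 := by positivity
  rw [← div_div, div_self hn0, one_div, ← Finset.prod_inv_distrib]
  refine Finset.prod_congr rfl fun p hp => ?_
  rw [afPhi_one, one_add_inv_pred p (Nat.prime_of_mem_primeFactors hp)]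

theorem sum_ff_mul (q j : ℕ) (hq : 1 ≤ q) (hj : 1 ≤ j) :
    ∑ g ∈ (q * j).divisors, ff 1 g = (q:ℝ) / q.totient * ∑ g ∈ j.divisors, ff q g := by
  rw [← sum_ff_one q hq, sum_ff_prod _ _ (Nat.mul_pos hq hj), sum_ff_prod _ _ hq, sum_ff_prod _ _ hj,
    Nat.primeFactors_mul (by omega) (by omega), ← Finset.union_sdiff_self_eq_union, Finset.prod_union Finset.disjoint_sdiff]
  congr 1
  have hsub : j.primeFactors \ q.primeFactors ⊆ j.primeFactors := Finset.sdiff_subset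
  rw [← Finset.prod_subset hsub (f := fun p => 1 + afPhi q p)]
  · refine Finset.prod_congr rfl fun p hp => ?_
    rw [Finset.mem_sdiff] at hp
    have hpp := Nat.prime_of_mem_primeFactors hp.1
    have hc : p.Coprime q := by
      rw [Nat.Prime.coprime_iff_not_dvd hpp]
      intro h
      exact hp.2 (Nat.mem_primeFactors.2 ⟨hpp, h, by omega⟩)
    simp [afPhi, hc]
  · intro p hp hp2
    have hpp := Nat.prime_of_mem_primeFactors hp
    have : p ∈ q.primeFactors := by
      by_contra h
      exact hp2 (Finset.mem_sdiff.2 ⟨hp, h⟩)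
    have hc : ¬ p.Coprime q := by
      rw [Nat.Prime.coprime_iff_not_dvd hpp, not_not]
      exact Nat.dvd_of_mem_primeFactors this
    simp [afPhi, hc]

theorem pp_mul (q j s : ℕ) : pp 1 (q * j) s = pp q j s := by
  unfold pp
  apply if_congr _ rfl rfl
  rw [Nat.coprime_mul_iff_right]
  simp only [Nat.coprime_one_right_iff, and_true]
  exact and_comm

theorem DD_nonneg (k : ℕ) : 0 ≤ DD k := Finset.sum_nonneg fun _ _ => by positivity

theorem DD_mul (q j : ℕ) : DD (q * j) ≤ DD q * DD j := by
  unfold DD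
  rw [Nat.divisors_mul, Finset.mul_def, Finset.sum_mul_sum, ← Finset.sum_product']
  refine (Finset.sum_image_le_of_nonneg (fun _ _ => by positivity)).trans ?_
  refine Finset.sum_le_sum fun x hx => ?_
  rw [Finset.mem_product] at hx
  have h1 := Nat.pos_of_mem_divisors hx.1
  have h2 := Nat.pos_of_mem_divisors hx.2
  have h3 : (0:ℝ) < x.1.totient := by exact_mod_cast Nat.totient_pos.2 h1
  have h4 : (0:ℝ) < x.2.totient := by exact_mod_cast Nat.totient_pos.2 h2
  rw [div_mul_div_comm]
  push_cast
  apply div_le_div_of_nonneg_left (by positivity) (by positivity)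
  exact_mod_cast Nat.totient_super_multiplicative x.1 x.2

theorem totient_mul_le_mul (l m : ℕ) : (l * m).totient ≤ l.totient * m := by
  by_cases hl : l = 0
  · simp [hl]
  have h1 := Nat.totient_gcd_mul_totient_mul l m
  have h2 : m.totient * l.gcd m ≤ m * (l.gcd m).totient := by
    by_cases hm : m = 0
    · simp [hm]
    obtain ⟨c, hc⟩ := Nat.gcd_dvd_right l m
    set g := l.gcd m
    have hg : 0 < g := Nat.gcd_pos_of_pos_left m (Nat.pos_of_ne_zero hl)
    have : (m.totient : ℝ) * g ≤ m * g.totient := by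
      rw [totient_prod_real m, totient_prod_real g]
      have : ∏ p ∈ m.primeFactors, (1 - (p:ℝ)⁻¹) ≤ ∏ p ∈ g.primeFactors, (1 - (p:ℝ)⁻¹) := by
        apply Finset.prod_le_prod_of_subset_of_le_one (Nat.primeFactors_mono (Nat.gcd_dvd_right l m) hm)
        · intro p hp
          have : (1:ℝ) ≤ p := by exact_mod_cast (Nat.prime_of_mem_primeFactors hp).one_lt.le
          have := inv_le_one_of_one_le₀ this
          linarith
        · intro p hp _
          have : (0:ℝ) ≤ (p:ℝ)⁻¹ := by positivity
          linarith
      calc _ = (m:ℝ) * g * ∏ p ∈ m.primeFactors, (1 - (p:ℝ)⁻¹) := by ring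
        _ ≤ (m:ℝ) * g * ∏ p ∈ g.primeFactors, (1 - (p:ℝ)⁻¹) := by gcongr
        _ = _ := by ring
    exact_mod_cast this
  have hg : 0 < (l.gcd m).totient := Nat.totient_pos.2 (Nat.gcd_pos_of_pos_left m (Nat.pos_of_ne_zero hl))
  nlinarith

theorem DD_le (q : ℕ) (hq : 1 ≤ q) : DD q ≤ (q.divisors.card : ℝ) * ((q:ℝ) / q.totient) := by
  unfold DD
  rw [← nsmul_eq_mul]
  apply Finset.sum_le_card_nsmul
  intro g hg
  have h1 := Nat.pos_of_mem_divisors hg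
  obtain ⟨m, rfl⟩ := Nat.dvd_of_mem_divisors hg
  have h3 : (0:ℝ) < g.totient := by exact_mod_cast Nat.totient_pos.2 h1
  have h4 : (0:ℝ) < (g * m).totient := by exact_mod_cast Nat.totient_pos.2 hq
  rw [div_le_div_iff₀ h3 h4]
  have : ((g * m).totient : ℝ) ≤ g.totient * m := by exact_mod_cast totient_mul_le_mul g m
  push_cast
  nlinarith [Nat.cast_nonneg (α := ℝ) g]

theorem one_le_DD (q : ℕ) (hq : 1 ≤ q) : (q:ℝ) / q.totient ≤ DD q :=
  Finset.single_le_sum (f := fun g : ℕ => (g:ℝ) / g.totient) (fun _ _ => by positivity) (Nat.mem_divisors_self q (by omega))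

theorem sum_divisors_Ioc (N : ℕ) (f : ℕ → ℕ → ℝ) :
    ∑ j ∈ Finset.Ioc 0 N, ∑ e ∈ j.divisors, f j e = ∑ e ∈ Finset.Ioc 0 N, ∑ m ∈ Finset.Ioc 0 (N / e), f (e * m) e := by
  have h1 : ∀ e ∈ Finset.Ioc 0 N, ∑ m ∈ Finset.Ioc 0 (N / e), f (e * m) e = ∑ j ∈ (Finset.Ioc 0 N).filter (fun j => e ∣ j), f j e := by
    intro e he
    rw [Finset.mem_Ioc] at he
    rw [sum_multiples 0 N e (by omega) (fun j => f j e), Nat.zero_div]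
  rw [Finset.sum_congr rfl h1]
  refine Finset.sum_comm' ?_
  intro r d
  simp only [Nat.mem_divisors, Finset.mem_Ioc, Finset.mem_filter]
  constructor
  · rintro ⟨⟨h1, h2⟩, h3, h4⟩
    exact ⟨⟨⟨h1, h2⟩, h3⟩, Nat.pos_of_dvd_of_pos h3 (by omega), (Nat.le_of_dvd (by omega) h3).trans h2⟩
  · rintro ⟨⟨⟨h1, h2⟩, h3⟩, h4⟩
    exact ⟨⟨h1, h2⟩, h3, by omega⟩

theorem DD_sum (N : ℕ) (hN : 1 ≤ N) : ∑ j ∈ Finset.Ioc 0 N, DD j ≤ N * (KK * (1 + Real.log N)) := by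
  unfold DD
  rw [sum_divisors_Ioc N (fun _ g => (g:ℝ) / g.totient)]
  refine le_trans ?_ (mul_le_mul_of_nonneg_left (phiF_sum_inv0 N hN) (Nat.cast_nonneg N))
  rw [Finset.mul_sum]
  refine Finset.sum_le_sum fun e he => ?_
  rw [Finset.mem_Ioc] at he
  have he0 : (0:ℝ) < e := by exact_mod_cast he.1
  rw [Finset.sum_const, Nat.card_Ioc, nsmul_eq_mul, Nat.sub_zero]
  have h1 : ((N / e : ℕ):ℝ) ≤ (N:ℝ) / e := Nat.cast_div_le
  calc _ ≤ (N:ℝ) / e * ((e:ℝ) / e.totient) := by gcongr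
    _ = N * (1 / (e.totient:ℝ)) := by field_simp
    _ ≤ _ := mul_le_mul_of_nonneg_left (inv_totient_le e he.1) (Nat.cast_nonneg N)

theorem SS_GZ (R : ℝ) (q j Z : ℕ) (hR : 2 ≤ R) (hq : 1 ≤ q) (hj : 1 ≤ j) (hZ : q * ⌊R⌋₊ ≤ Z) :
    |SS R (q * j) - (q:ℝ) / q.totient * GZ Z q j| ≤ 16 * KK / R * (DD q * DD j) := by
  have hK := KK_pos
  have hfl : 1 ≤ ⌊R⌋₊ := Nat.le_floor (by push_cast; linarith)
  have hflR : R / 2 ≤ (⌊R⌋₊ : ℝ) := by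
    have := Nat.lt_floor_add_one R
    linarith
  have hfp : (0:ℝ) < (⌊R⌋₊:ℝ) := by exact_mod_cast hfl
  have hqZ : ⌊R⌋₊ ≤ Z := le_trans (Nat.le_mul_of_pos_left _ hq) hZ
  have hZ1 : 1 ≤ Z := hfl.trans hqZ
  have h1 := approx_gen ⌊R⌋₊ Z 1 (q * j) hfl hqZ
  have h2 := approx_gen Z Z q j hZ1 le_rfl
  rw [← SS_eq R (q * j) (Nat.mul_pos hq hj), sum_ff_mul q j hq hj] at h1
  rw [← GZ_eq Z q j hj] at h2
  simp_rw [pp_mul] at h1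
  set A := (q:ℝ) / q.totient with hA
  have hA0 : 0 ≤ A := by positivity
  set P := ∑ s ∈ Finset.Ioc 0 Z, pp q j s
  set F := ∑ g ∈ j.divisors, ff q g
  have h3 : |A * GZ Z q j - A * F * P| ≤ KK * 4 / ⌊R⌋₊ * DD j := by
    rw [mul_assoc, ← mul_sub, abs_mul, abs_of_nonneg hA0]
    have hAq : A ≤ q := by
      apply div_le_self (by positivity)
      exact_mod_cast Nat.totient_pos.2 hq
    have hZr : (q:ℝ) * ⌊R⌋₊ ≤ Z := by exact_mod_cast hZ
    have hZp : (0:ℝ) < Z := by exact_mod_cast hZ1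
    have hqp : (0:ℝ) < q := by exact_mod_cast hq
    calc _ ≤ (q:ℝ) * (KK * 4 / Z * DD j) := by gcongr
      _ ≤ (q:ℝ) * (KK * 4 / (q * ⌊R⌋₊) * DD j) := by
        have := DD_nonneg j
        gcongr
      _ = _ := by field_simp
  have hD := DD_mul q j
  have hD1 : 1 ≤ DD q := (one_le_nphi q hq).trans (one_le_DD q hq)
  have hD2 := DD_nonneg j
  have hD3 : DD j ≤ DD q * DD j := by nlinarith
  have hB : KK * 4 / ⌊R⌋₊ ≤ 8 * KK / R := by
    rw [div_le_div_iff₀ hfp (by linarith)]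
    nlinarith
  have hB0 : 0 ≤ KK * 4 / ⌊R⌋₊ := by positivity
  have e1 : |SS R (q * j) - A * F * P| ≤ 8 * KK / R * (DD q * DD j) := by
    refine h1.trans ?_
    refine mul_le_mul hB hD (DD_nonneg _) (hB0.trans hB)
  have e2 : |A * GZ Z q j - A * F * P| ≤ 8 * KK / R * (DD q * DD j) := by
    refine h3.trans ?_
    refine mul_le_mul hB hD3 hD2 (hB0.trans hB)
  have : SS R (q * j) - A * GZ Z q j = (SS R (q * j) - A * F * P) - (A * GZ Z q j - A * F * P) := by ring
  rw [this]
  refine (abs_sub _ _).trans ?_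
  have : 16 * KK / R * (DD q * DD j) = 8 * KK / R * (DD q * DD j) + 8 * KK / R * (DD q * DD j) := by ring
  rw [this]
  exact add_le_add e1 e2

theorem sum_moebius_eq (r : ℕ) : ∑ e ∈ r.divisors, (moebius e : ℝ) = if r = 1 then 1 else 0 := by
  have h := congrArg (fun f : ArithmeticFunction ℤ => f r) moebius_mul_coe_zeta
  simp only [coe_mul_zeta_apply, one_apply] at h
  have h2 := congrArg (fun z : ℤ => (z : ℝ)) h
  push_cast at h2
  exact h2

noncomputable def bq (q r : ℕ) : ℝ := if r.Coprime q then (moebius r : ℝ) / (r.totient : ℝ) ^ 2 else 0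
noncomputable def VV (q N : ℕ) : ℝ := ∑ r ∈ Finset.Ioc 0 N, ff q r
noncomputable def tauH (H : ℝ) (N e : ℕ) : ℝ := (e:ℝ) * ∑ j ∈ Finset.Ioc 0 N, (if e ∣ j then H - j else 0)

theorem bq_abs (q e m : ℕ) (he : 1 ≤ e) (hm : 1 ≤ m) :
    |bq q (e * m)| ≤ 1 / (e.totient:ℝ) ^ 2 * (1 / (m.totient:ℝ) ^ 2) := by
  unfold bq
  split_ifs
  · rw [abs_div, abs_of_nonneg (by positivity : (0:ℝ) ≤ ((e * m).totient:ℝ)^2), div_mul_div_comm, one_mul]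
    have h3 : (0:ℝ) < e.totient := by exact_mod_cast Nat.totient_pos.2 he
    have h4 : (0:ℝ) < m.totient := by exact_mod_cast Nat.totient_pos.2 hm
    apply div_le_div₀ (by norm_num) (abs_moebius_le _) (by positivity)
    rw [← mul_pow]
    gcongr
    exact_mod_cast Nat.totient_super_multiplicative e m
  · simp; positivity

theorem AZ_eq (H : ℝ) (N Z q : ℕ) :
    ∑ j ∈ Finset.Ioc 0 N, (H - j) * GZ Z q j
      = ∑ r ∈ Finset.Ioc 0 Z, ∑ e ∈ r.divisors, bq q r * ((moebius e : ℝ) * tauH H N e) := by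
  have h1 : ∀ j, GZ Z q j = ∑ r ∈ Finset.Ioc 0 Z, ∑ e ∈ r.divisors, bq q r * (if e ∣ j then (e:ℝ) * (moebius e : ℝ) else 0) := by
    intro j
    unfold GZ bq
    refine Finset.sum_congr rfl fun r _ => ?_
    rw [← Finset.mul_sum]
    split_ifs <;> simp
  simp_rw [h1, Finset.mul_sum]
  rw [Finset.sum_comm]
  refine Finset.sum_congr rfl fun r _ => ?_
  rw [Finset.sum_comm]
  refine Finset.sum_congr rfl fun e _ => ?_
  unfold tauH
  rw [Finset.mul_sum, Finset.mul_sum, Finset.mul_sum]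
  refine Finset.sum_congr rfl fun j _ => ?_
  split_ifs <;> ring

theorem tauH_zero (H : ℝ) (N e : ℕ) (he : N < e) : tauH H N e = 0 := by
  unfold tauH
  rw [Finset.sum_eq_zero, mul_zero]
  intro j hj
  rw [Finset.mem_Ioc] at hj
  rw [if_neg]
  intro h
  have := Nat.le_of_dvd hj.1 h
  omega

theorem sum_lin (H e : ℝ) (M : ℕ) : ∑ m ∈ Finset.Ioc 0 M, (H - e * m) = M * H - e * M * (M + 1) / 2 := by
  induction M with
  | zero => simp
  | succ k ih => rw [Finset.sum_Ioc_succ_top (by omega), ih]; push_cast; ring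

theorem tauH_approx (H : ℝ) (N e : ℕ) (he : 1 ≤ e) (h1 : (N:ℝ) ≤ H) (h2 : H < N + 1) :
    |tauH H N e - (H ^ 2 / 2 - e * H / 2)| ≤ (e:ℝ) ^ 2 := by
  have h3 := sum_multiples 0 N e he (fun j => H - j)
  rw [Nat.zero_div, Finset.sum_filter] at h3
  unfold tauH
  rw [h3]
  push_cast
  rw [sum_lin]
  set M := N / e with hM
  have he0 : (1:ℝ) ≤ e := by exact_mod_cast he
  have l1 : (e:ℝ) * M ≤ H := by
    have : e * M ≤ N := Nat.mul_div_le N e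
    have : (e:ℝ) * M ≤ N := by exact_mod_cast this
    linarith
  have l2 : H ≤ e * (M + 1) := by
    have : N < e * (M + 1) := Nat.lt_mul_div_succ N he
    have : N + 1 ≤ e * (M + 1) := this
    have : (N:ℝ) + 1 ≤ e * (M + 1) := by exact_mod_cast this
    linarith
  have key : (e:ℝ) * (M * H - e * M * (M + 1) / 2) - (H ^ 2 / 2 - e * H / 2) = (H - e * M) * (e * (M + 1) - H) / 2 := by ring
  rw [key, abs_of_nonneg (by apply div_nonneg (mul_nonneg _ _) <;> linarith)]
  have a1 : H - e * M ≤ e := by linarith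
  have a2 : e * (M + 1) - H ≤ e := by linarith
  have := mul_le_mul a1 a2 (by linarith) (by linarith)
  nlinarith

theorem pair_bound (q Z : ℕ) (c : ℕ → ℕ → ℝ) :
    |∑ r ∈ Finset.Ioc 0 Z, ∑ e ∈ r.divisors, bq q r * c r e|
      ≤ ∑ e ∈ Finset.Ioc 0 Z, 1 / (e.totient:ℝ) ^ 2 * ∑ m ∈ Finset.Ioc 0 (Z / e), 1 / (m.totient:ℝ) ^ 2 * |c (e * m) e| := by
  rw [sum_divisors_Ioc]
  refine (Finset.abs_sum_le_sum_abs _ _).trans (Finset.sum_le_sum fun e he => ?_)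
  rw [Finset.mul_sum]
  refine (Finset.abs_sum_le_sum_abs _ _).trans (Finset.sum_le_sum fun m hm => ?_)
  rw [Finset.mem_Ioc] at he hm
  rw [abs_mul, ← mul_assoc]
  exact mul_le_mul_of_nonneg_right (bq_abs q e m he.1 hm.1) (abs_nonneg _)

theorem inv_tot_sum (Y : ℕ) : ∑ m ∈ Finset.Ioc 0 Y, 1 / (m.totient:ℝ) ^ 2 ≤ KK * 2 := by
  refine le_trans (le_of_eq ?_) (phiF_sum_inv_sq0 Y)
  refine Finset.sum_congr rfl fun s hs => ?_
  rw [Finset.mem_Ioc] at hs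
  exact inv_totient_sq s hs.1

theorem inv_tot_tail (N Y : ℕ) (hN : 1 ≤ N) : ∑ m ∈ Finset.Ioc N Y, 1 / (m.totient:ℝ) ^ 2 ≤ KK * 2 / N := by
  rw [mul_div_assoc]
  refine le_trans (le_of_eq ?_) (phiF_sum_inv_sq N Y hN)
  refine Finset.sum_congr rfl fun s hs => ?_
  rw [Finset.mem_Ioc] at hs
  exact inv_totient_sq s (by omega)

theorem X1_bound (q N Z : ℕ) (hN : 1 ≤ N) (hZ : N ≤ Z) :
    |∑ r ∈ Finset.Ioc 0 Z, ∑ e ∈ r.divisors, bq q r * (if e ≤ N then (moebius e : ℝ) else 0) - 1| ≤ 4 * KK ^ 2 / N := by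
  have h0 : ∑ r ∈ Finset.Ioc 0 Z, ∑ e ∈ r.divisors, bq q r * (moebius e : ℝ) = 1 := by
    rw [Finset.sum_eq_single 1]
    · simp [bq]
    · intro r hr hr1
      rw [← Finset.mul_sum]
      have h := sum_moebius_eq r
      rw [h, if_neg hr1, mul_zero]
    · intro h; exfalso; apply h; rw [Finset.mem_Ioc]; omega
  have h1 : ∑ r ∈ Finset.Ioc 0 Z, ∑ e ∈ r.divisors, bq q r * (if e ≤ N then (moebius e : ℝ) else 0) - 1
      = - ∑ r ∈ Finset.Ioc 0 Z, ∑ e ∈ r.divisors, bq q r * (if e ≤ N then 0 else (moebius e : ℝ)) := by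
    rw [← h0, ← Finset.sum_sub_distrib, ← Finset.sum_neg_distrib]
    refine Finset.sum_congr rfl fun r _ => ?_
    rw [← Finset.sum_sub_distrib, ← Finset.sum_neg_distrib]
    refine Finset.sum_congr rfl fun e _ => ?_
    split_ifs <;> ring
  rw [h1, abs_neg]
  refine (pair_bound q Z (fun _ e => if e ≤ N then 0 else (moebius e : ℝ))).trans ?_
  rw [← Finset.sum_Ioc_consecutive _ (Nat.zero_le N) hZ, Finset.sum_eq_zero, zero_add]
  · have hK := KK_pos
    have : 4 * KK ^ 2 / N = KK * 2 / N * (KK * 2) := by ring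
    rw [this]
    refine le_trans ?_ (mul_le_mul_of_nonneg_right (inv_tot_tail N Z hN) (by positivity))
    rw [Finset.sum_mul]
    refine Finset.sum_le_sum fun e he => ?_
    apply mul_le_mul_of_nonneg_left _ (by positivity)
    refine le_trans (Finset.sum_le_sum fun m hm => ?_) (inv_tot_sum (Z / e))
    apply mul_le_of_le_one_right (by positivity)
    split_ifs
    · simp
    · exact abs_moebius_le e
  · intro e he
    rw [Finset.mem_Ioc] at he
    simp [he.2]

theorem X3_bound (q N Z : ℕ) (c : ℕ → ℝ) (hc : ∀ e, 1 ≤ e → e ≤ N → |c e| ≤ (e:ℝ) ^ 2) (hZ : N ≤ Z) :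
    |∑ r ∈ Finset.Ioc 0 Z, ∑ e ∈ r.divisors, bq q r * (if e ≤ N then (moebius e : ℝ) * c e else 0)| ≤ 2 * KK ^ 2 * N := by
  refine (pair_bound q Z (fun _ e => if e ≤ N then (moebius e : ℝ) * c e else 0)).trans ?_
  have hK := KK_pos
  rw [← Finset.sum_Ioc_consecutive _ (Nat.zero_le N) hZ, add_comm, Finset.sum_eq_zero, zero_add]
  · have : 2 * KK ^ 2 * N = KK * N * (KK * 2) := by ring
    rw [this]
    refine le_trans ?_ (mul_le_mul_of_nonneg_right (phiF_sum_one N) (by positivity))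
    rw [Finset.sum_mul]
    refine Finset.sum_le_sum fun e he => ?_
    rw [Finset.mem_Ioc] at he
    have h1 : |if e ≤ N then (moebius e : ℝ) * c e else 0| ≤ (e:ℝ)^2 := by
      rw [if_pos he.2, abs_mul]
      have := mul_le_mul (abs_moebius_le e) (hc e he.1 he.2) (abs_nonneg _) zero_le_one
      linarith
    have h2 : phiF e = 1 / (e.totient:ℝ)^2 * (e:ℝ)^2 := by unfold phiF; ring
    rw [h2, mul_assoc]
    apply mul_le_mul_of_nonneg_left _ (by positivity)
    rw [← Finset.sum_mul, mul_comm]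
    exact mul_le_mul h1 (inv_tot_sum (Z / e)) (Finset.sum_nonneg fun _ _ => by positivity) (by positivity)
  · intro e he
    rw [Finset.mem_Ioc] at he
    simp [not_le.2 he.1]

theorem X2_bound (q N Z : ℕ) (hN : 1 ≤ N) (hZ : N ≤ Z) :
    |∑ r ∈ Finset.Ioc 0 Z, ∑ e ∈ r.divisors, bq q r * (if e ≤ N then (moebius e : ℝ) * e else 0) - VV q N| ≤ 4 * KK ^ 2 := by
  have hK := KK_pos
  have hN0 : (0:ℝ) < N := by exact_mod_cast hN
  have h1 : ∑ r ∈ Finset.Ioc 0 Z, ∑ e ∈ r.divisors, bq q r * (if e ≤ N then (moebius e : ℝ) * e else 0) - VV q N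
      = ∑ r ∈ Finset.Ioc 0 Z, ∑ e ∈ r.divisors, bq q r * (if r ≤ N then 0 else if e ≤ N then (moebius e : ℝ) * e else 0) := by
    rw [← Finset.sum_Ioc_consecutive _ (Nat.zero_le N) hZ, ← Finset.sum_Ioc_consecutive _ (Nat.zero_le N) hZ, add_sub_right_comm]
    congr 1
    · have : ∑ r ∈ Finset.Ioc 0 N, ∑ e ∈ r.divisors, bq q r * (if r ≤ N then 0 else if e ≤ N then (moebius e : ℝ) * e else 0) = 0 := by
        refine Finset.sum_eq_zero fun r hr => Finset.sum_eq_zero fun e he => ?_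
        rw [Finset.mem_Ioc] at hr
        rw [if_pos hr.2, mul_zero]
      rw [this, sub_eq_zero]
      unfold VV
      refine Finset.sum_congr rfl fun r hr => ?_
      rw [Finset.mem_Ioc] at hr
      have : ∀ e ∈ r.divisors, bq q r * (if e ≤ N then (moebius e : ℝ) * e else 0) = bq q r * ((e:ℝ) * (moebius e : ℝ)) := by
        intro e he
        have := Nat.le_of_dvd hr.1 (Nat.dvd_of_mem_divisors he)
        rw [if_pos (by omega)]; ring
      rw [Finset.sum_congr rfl this, ← Finset.mul_sum, ff_apply]
      unfold bq
      by_cases hsq : Squarefree r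
      · rw [sum_id_moebius r hsq]
        have : (r.totient : ℝ) ≠ 0 := by exact_mod_cast (Nat.totient_pos.2 hr.1).ne'
        split_ifs
        · field_simp
        · simp
      · rw [moebius_not_sqf r hsq]; simp
    · refine Finset.sum_congr rfl fun r hr => Finset.sum_congr rfl fun e he => ?_
      rw [Finset.mem_Ioc] at hr
      rw [if_neg (not_le.2 hr.1)]
  rw [h1]
  refine (pair_bound q Z (fun r e => if r ≤ N then 0 else if e ≤ N then (moebius e : ℝ) * e else 0)).trans ?_
  rw [← Finset.sum_Ioc_consecutive _ (Nat.zero_le N) hZ, add_comm, Finset.sum_eq_zero, zero_add]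
  · have : 4 * KK ^ 2 = KK * N * (KK * 4 / N) := by field_simp
    rw [this]
    refine le_trans ?_ (mul_le_mul_of_nonneg_right (phiF_sum_one N) (by positivity))
    rw [Finset.sum_mul]
    refine Finset.sum_le_sum fun e he => ?_
    rw [Finset.mem_Ioc] at he
    have h2 : phiF e = 1 / (e.totient:ℝ)^2 * (e:ℝ)^2 := by unfold phiF; ring
    rw [h2, mul_assoc]
    apply mul_le_mul_of_nonneg_left _ (by positivity)
    have hle : N / e ≤ Z / e := Nat.div_le_div_right hZ
    have h3 : ∑ m ∈ Finset.Ioc 0 (Z / e), 1 / (m.totient:ℝ) ^ 2 * |if e * m ≤ N then 0 else if e ≤ N then (moebius e : ℝ) * e else 0|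
        ≤ ∑ m ∈ Finset.Ioc (N / e) (Z / e), 1 / (m.totient:ℝ) ^ 2 * (e:ℝ) := by
      rw [← Finset.sum_Ioc_consecutive _ (Nat.zero_le (N / e)) hle, Finset.sum_eq_zero, zero_add]
      · refine Finset.sum_le_sum fun m hm => ?_
        apply mul_le_mul_of_nonneg_left _ (by positivity)
        split_ifs
        · simp
        · rw [abs_mul, abs_of_nonneg (Nat.cast_nonneg (α := ℝ) e)]
          exact mul_le_of_le_one_left (Nat.cast_nonneg e) (abs_moebius_le e)
        · simp
      · intro m hm
        rw [Finset.mem_Ioc] at hm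
        have : e * m ≤ N := by
          calc e * m ≤ e * (N / e) := Nat.mul_le_mul_left e hm.2
            _ ≤ N := Nat.mul_div_le N e
        rw [if_pos this]; simp
    refine h3.trans ?_
    rw [← Finset.sum_mul]
    calc _ ≤ (KK * 4 * e / N) * (e:ℝ) := by
          apply mul_le_mul_of_nonneg_right (tail_inv_totient_sq N (Z / e) e hN he.1) (Nat.cast_nonneg e)
      _ = _ := by ring
  · intro e he
    rw [Finset.mem_Ioc] at he
    simp [not_le.2 he.1]

theorem AZ_approx (H : ℝ) (N Z q : ℕ) (hN : 1 ≤ N) (h1 : (N:ℝ) ≤ H) (h2 : H < N + 1) (hZ : N ≤ Z) :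
    |∑ j ∈ Finset.Ioc 0 N, (H - j) * GZ Z q j - (H ^ 2 / 2 - H / 2 * VV q N)| ≤ 14 * KK ^ 2 * N := by
  rw [AZ_eq]
  have hK := KK_pos
  have hN0 : (1:ℝ) ≤ N := by exact_mod_cast hN
  have e1 := X1_bound q N Z hN hZ
  have e2 := X2_bound q N Z hN hZ
  have e3 := X3_bound q N Z (fun e => tauH H N e - (H ^ 2 / 2 - e * H / 2)) (fun e he _ => tauH_approx H N e he h1 h2) hZ
  set X1 := ∑ r ∈ Finset.Ioc 0 Z, ∑ e ∈ r.divisors, bq q r * (if e ≤ N then (moebius e : ℝ) else 0)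
  set X2 := ∑ r ∈ Finset.Ioc 0 Z, ∑ e ∈ r.divisors, bq q r * (if e ≤ N then (moebius e : ℝ) * e else 0)
  set X3 := ∑ r ∈ Finset.Ioc 0 Z, ∑ e ∈ r.divisors, bq q r * (if e ≤ N then (moebius e : ℝ) * (tauH H N e - (H ^ 2 / 2 - e * H / 2)) else 0)
  have hs : ∑ r ∈ Finset.Ioc 0 Z, ∑ e ∈ r.divisors, bq q r * ((moebius e : ℝ) * tauH H N e)
      = H ^ 2 / 2 * X1 - H / 2 * X2 + X3 := by
    simp only [X1, X2, X3, Finset.mul_sum]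
    rw [← Finset.sum_sub_distrib, ← Finset.sum_add_distrib]
    refine Finset.sum_congr rfl fun r _ => ?_
    rw [← Finset.sum_sub_distrib, ← Finset.sum_add_distrib]
    refine Finset.sum_congr rfl fun e _ => ?_
    by_cases he : e ≤ N
    · simp only [if_pos he]; ring
    · rw [tauH_zero H N e (by omega)]; simp only [if_neg he]; ring
  rw [hs]
  have : H ^ 2 / 2 * X1 - H / 2 * X2 + X3 - (H ^ 2 / 2 - H / 2 * VV q N)
      = H ^ 2 / 2 * (X1 - 1) - H / 2 * (X2 - VV q N) + X3 := by ring
  rw [this]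
  have hH2 : H ≤ 2 * N := by linarith
  have hH0 : 0 ≤ H := by linarith
  have f1 : |H ^ 2 / 2 * (X1 - 1)| ≤ 8 * KK ^ 2 * N := by
    rw [abs_mul, abs_of_nonneg (by positivity : 0 ≤ H^2/2)]
    calc _ ≤ (2 * N) ^ 2 / 2 * (4 * KK ^ 2 / N) := by gcongr
      _ = _ := by field_simp; ring
  have f2 : |H / 2 * (X2 - VV q N)| ≤ 4 * KK ^ 2 * N := by
    rw [abs_mul, abs_of_nonneg (by positivity : 0 ≤ H/2)]
    calc _ ≤ (2 * N) / 2 * (4 * KK ^ 2) := by gcongr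
      _ = _ := by ring
  calc _ ≤ |H ^ 2 / 2 * (X1 - 1) - H / 2 * (X2 - VV q N)| + |X3| := abs_add_le _ _
    _ ≤ |H ^ 2 / 2 * (X1 - 1)| + |H / 2 * (X2 - VV q N)| + |X3| := by
      gcongr; exact abs_sub _ _
    _ ≤ _ := by linarith

theorem M0_approx (R : ℝ) (q h : ℕ) (hR : 2 ≤ R) (hq : 1 ≤ q) (hqh : q ≤ h) :
    |M0 R q h - ((h:ℝ) ^ 2 / (2 * (q.totient:ℝ)) - (q:ℝ) / q.totient * (h / 2) * VV q (h / q))|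
      ≤ 14 * KK ^ 2 * h * ((q:ℝ) / q.totient)
        + 16 * KK ^ 2 * (h:ℝ) ^ 2 * (q.divisors.card:ℝ) / ((q.totient:ℝ) * R) * (1 + Real.log ((h / q : ℕ):ℝ)) := by
  set N := h / q with hNdef
  have hN : 1 ≤ N := (Nat.one_le_div_iff hq).2 hqh
  have hK := KK_pos
  have hq0 : (0:ℝ) < q := by exact_mod_cast hq
  have hphi : (0:ℝ) < q.totient := by exact_mod_cast Nat.totient_pos.2 hq
  set H : ℝ := (h:ℝ) / q with hH
  have hqH : (q:ℝ) * H = h := by rw [hH]; field_simp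
  have h1 : (N:ℝ) ≤ H := Nat.cast_div_le
  have h2 : H < N + 1 := by
    rw [hH, div_lt_iff₀ hq0]
    have := Nat.lt_mul_div_succ h hq
    have : (h:ℝ) < q * (N + 1) := by exact_mod_cast this
    linarith
  have hN0 : (1:ℝ) ≤ N := by exact_mod_cast hN
  have hlog : 0 ≤ Real.log N := Real.log_nonneg hN0
  set Z := q * ⌊R⌋₊ + N with hZ
  have hM0 : M0 R q h = q * ∑ j ∈ Finset.Ioc 0 N, (H - j) * SS R (q * j) := by
    unfold M0
    rw [show Finset.Icc 1 h = Finset.Ioc 0 h from rfl, sum_multiples 0 h q hq, Nat.zero_div, Finset.mul_sum]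
    refine Finset.sum_congr rfl fun j _ => ?_
    push_cast
    rw [← mul_assoc, mul_sub, hqH]
  set A := (q:ℝ) / q.totient with hA
  have hA0 : 0 ≤ A := by positivity
  have e1 := AZ_approx H N Z q hN h1 h2 (by omega)
  set G := ∑ j ∈ Finset.Ioc 0 N, (H - j) * GZ Z q j
  set V := VV q N
  have e2 : |∑ j ∈ Finset.Ioc 0 N, (H - j) * SS R (q * j) - A * G| ≤ H * (16 * KK / R * (DD q * (N * (KK * (1 + Real.log N))))) := by
    simp only [G]
    rw [Finset.mul_sum, ← Finset.sum_sub_distrib]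
    refine (Finset.abs_sum_le_sum_abs _ _).trans ?_
    calc _ ≤ ∑ j ∈ Finset.Ioc 0 N, H * (16 * KK / R * (DD q * DD j)) := by
          refine Finset.sum_le_sum fun j hj => ?_
          rw [Finset.mem_Ioc] at hj
          have hjN : (j:ℝ) ≤ N := by exact_mod_cast hj.2
          have : (H - j) * SS R (q * j) - A * ((H - j) * GZ Z q j) = (H - j) * (SS R (q * j) - A * GZ Z q j) := by ring
          rw [this, abs_mul, abs_of_nonneg (by linarith : (0:ℝ) ≤ H - j)]
          apply mul_le_mul _ (SS_GZ R q j Z hR hq hj.1 (by omega)) (abs_nonneg _) (by linarith)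
          have : (0:ℝ) ≤ j := Nat.cast_nonneg j
          linarith
      _ = H * (16 * KK / R * (DD q * ∑ j ∈ Finset.Ioc 0 N, DD j)) := by
          simp_rw [Finset.mul_sum]
      _ ≤ _ := by
          have := DD_nonneg q
          have hH0 : 0 ≤ H := by linarith
          have hR0 : 0 < R := by linarith
          have := DD_sum N hN
          gcongr
  have hsplit : M0 R q h - ((h:ℝ) ^ 2 / (2 * (q.totient:ℝ)) - A * (h / 2) * V)
      = q * (∑ j ∈ Finset.Ioc 0 N, (H - j) * SS R (q * j) - A * G) + q * A * (G - (H ^ 2 / 2 - H / 2 * V)) := by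
    rw [hM0]
    have t1 : (h:ℝ) ^ 2 / (2 * (q.totient:ℝ)) = q * A * (H ^ 2 / 2) := by
      rw [← hqH, hA]; field_simp
    have t2 : A * (h / 2) * V = q * A * (H / 2 * V) := by
      rw [← hqH]; ring
    rw [t1, t2]; ring
  rw [hsplit]
  refine (abs_add_le _ _).trans ?_
  rw [abs_mul, abs_mul, abs_of_nonneg hq0.le, abs_of_nonneg (mul_nonneg hq0.le hA0), add_comm]
  have hqN : (q:ℝ) * N ≤ h := by rw [← hqH]; gcongr
  apply add_le_add
  · calc _ ≤ q * A * (14 * KK ^ 2 * N) := by gcongr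
      _ = 14 * KK ^ 2 * (q * N) * A := by ring
      _ ≤ _ := by gcongr
  · have hR0 : 0 < R := by linarith
    have hd := DD_le q hq
    have hd0 := DD_nonneg q
    have hNH : (N:ℝ) ≤ H := h1
    calc _ ≤ q * (H * (16 * KK / R * (DD q * (N * (KK * (1 + Real.log N)))))) := by gcongr
      _ = (q * H) * (16 * KK^2 / R * DD q * N * (1 + Real.log N)) := by ring
      _ ≤ (q * H) * (16 * KK^2 / R * ((q.divisors.card:ℝ) * A) * H * (1 + Real.log N)) := by
        have : 0 ≤ q * H := by rw [hqH]; positivity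
        gcongr
      _ = _ := by rw [hqH, hA, hH]; field_simp

theorem sum_sq_dvd_moebius (N r : ℕ) (hr : 1 ≤ r) (hrN : r ≤ N) :
    ∑ b ∈ (Finset.Ioc 0 N).filter (fun b => b ^ 2 ∣ r), (moebius b : ℝ) = (moebius r : ℝ) ^ 2 := by
  obtain ⟨s, B, hsB, hs⟩ := Nat.sq_mul_squarefree r
  have hB0 : B ≠ 0 := by rintro rfl; simp at hsB; omega
  have hs0 : s ≠ 0 := by rintro rfl; simp at hsB; omega
  have hset : (Finset.Ioc 0 N).filter (fun b => b ^ 2 ∣ r) = B.divisors := by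
    ext b
    simp only [Finset.mem_filter, Finset.mem_Ioc, Nat.mem_divisors]
    constructor
    · rintro ⟨⟨h1, h2⟩, h3⟩
      refine ⟨?_, hB0⟩
      rw [← Nat.factorization_le_iff_dvd (by omega) hB0]
      intro p
      have h4 := (Nat.factorization_le_iff_dvd (by positivity) (by omega)).2 h3 p
      rw [← hsB, Nat.factorization_mul (by positivity) hs0, Nat.factorization_pow, Nat.factorization_pow] at h4
      have h5 := Squarefree.natFactorization_le_one p hs
      simp only [Finsupp.add_apply, Finsupp.smul_apply, smul_eq_mul] at h4
      omega
    · rintro ⟨h1, h2⟩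
      have h3 : b ^ 2 ∣ r := by
        rw [← hsB]; exact (pow_dvd_pow_of_dvd h1 2).mul_right s
      have hb : 0 < b := Nat.pos_of_dvd_of_pos h1 (by omega)
      refine ⟨⟨hb, ?_⟩, h3⟩
      have := Nat.le_of_dvd (by omega) h3
      nlinarith
  rw [hset, sum_moebius_eq]
  split_ifs with h
  · subst h
    simp at hsB
    subst hsB
    rw [moebius_sq_sqf _ hs]
  · rw [moebius_not_sqf, zero_pow two_ne_zero]
    intro hsq
    rw [← hsB] at hsq
    have := hsq.squarefree_of_dvd (dvd_mul_right _ _)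
    have h2 := this B (by rw [sq])
    exact h (Nat.isUnit_iff.1 h2)

theorem nphi_eq_of_pf (m r : ℕ) (hm : 1 ≤ m) (hr : 1 ≤ r) (h : m.primeFactors = r.primeFactors) :
    (m:ℝ) / m.totient = (r:ℝ) / r.totient := by
  have hm0 : (m:ℝ) ≠ 0 := by positivity
  have hr0 : (r:ℝ) ≠ 0 := by positivity
  rw [totient_prod_real m, totient_prod_real r, h, ← div_div, ← div_div, div_self hm0, div_self hr0]

theorem ff_conv (b n : ℕ) (hb : 1 ≤ b) (hn : 1 ≤ n) :
    (b:ℝ) / b.totient * ∑ a ∈ n.divisors, ff b a = ((b ^ 2 * n : ℕ):ℝ) / (b ^ 2 * n).totient := by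
  rw [← sum_ff_mul b n hb hn, sum_ff_one _ (Nat.mul_pos hb hn)]
  apply nphi_eq_of_pf _ _ (Nat.mul_pos hb hn) (Nat.mul_pos (pow_pos hb 2) hn)
  rw [Nat.primeFactors_mul (by omega) (by omega), Nat.primeFactors_mul (by positivity) (by omega), Nat.primeFactors_pow _ two_ne_zero]

noncomputable def harm (N : ℕ) : ℝ := ∑ m ∈ Finset.Ioc 0 N, 1 / (m:ℝ)
noncomputable def Wab (b a : ℕ) : ℝ := (moebius b : ℝ) / (b * b.totient) * (ff b a / a)

theorem VV_one_eq (N : ℕ) :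
    VV 1 N = ∑ b ∈ Finset.Ioc 0 N, ∑ a ∈ Finset.Ioc 0 (N / b), Wab b a * harm (N / b ^ 2 / a) := by
  have h1 : VV 1 N = ∑ r ∈ Finset.Ioc 0 N, ∑ b ∈ (Finset.Ioc 0 N).filter (fun b => b ^ 2 ∣ r), (moebius b : ℝ) * (1 / (r.totient:ℝ)) := by
    unfold VV
    refine Finset.sum_congr rfl fun r hr => ?_
    rw [Finset.mem_Ioc] at hr
    rw [← Finset.sum_mul, sum_sq_dvd_moebius N r hr.1 hr.2, ff_apply, if_pos (Nat.coprime_one_right r)]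
    ring
  rw [h1]
  simp_rw [Finset.sum_filter]
  rw [Finset.sum_comm]
  refine Finset.sum_congr rfl fun b hb => ?_
  rw [Finset.mem_Ioc] at hb
  rw [← Finset.sum_filter, sum_multiples 0 N (b ^ 2) (pow_pos hb.1 2), Nat.zero_div]
  have hb0 : (0:ℝ) < b := by exact_mod_cast hb.1
  have hbp : (0:ℝ) < b.totient := by exact_mod_cast Nat.totient_pos.2 hb.1
  have h2 : ∀ n ∈ Finset.Ioc 0 (N / b ^ 2), (moebius b : ℝ) * (1 / ((b ^ 2 * n).totient : ℝ))
      = ∑ a ∈ n.divisors, (moebius b : ℝ) / (b * b.totient) * ff b a * (1 / (n:ℝ)) := by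
    intro n hn
    rw [Finset.mem_Ioc] at hn
    have hn0 : (0:ℝ) < n := by exact_mod_cast hn.1
    have h3 := ff_conv b n hb.1 hn.1
    have h4 : (0:ℝ) < (b ^ 2 * n).totient := by
      have := hb.1
      have := hn.1
      exact_mod_cast Nat.totient_pos.2 (by positivity)
    rw [← Finset.sum_mul, ← Finset.mul_sum]
    have h5 : (1:ℝ) / ((b ^ 2 * n).totient : ℝ) = (b:ℝ) / b.totient * (∑ a ∈ n.divisors, ff b a) / (b ^ 2 * n) := by
      rw [h3]; push_cast; field_simp
    rw [h5]
    field_simp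
  rw [Finset.sum_congr rfl h2, sum_divisors_Ioc (N / b ^ 2) (fun n a => (moebius b : ℝ) / (b * b.totient) * ff b a * (1 / (n:ℝ)))]
  have hle : N / b ^ 2 ≤ N / b := Nat.div_le_div_left (by nlinarith [hb.1]) hb.1
  rw [← Finset.sum_Ioc_consecutive _ (Nat.zero_le (N / b ^ 2)) hle]
  have hz : ∑ a ∈ Finset.Ioc (N / b ^ 2) (N / b), Wab b a * harm (N / b ^ 2 / a) = 0 := by
    refine Finset.sum_eq_zero fun a ha => ?_
    rw [Finset.mem_Ioc] at ha
    rw [Nat.div_eq_of_lt ha.1]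
    simp [harm]
  rw [hz, add_zero]
  refine Finset.sum_congr rfl fun a ha => ?_
  rw [Finset.mem_Ioc] at ha
  unfold harm Wab
  rw [Finset.mul_sum]
  refine Finset.sum_congr rfl fun m hm => ?_
  push_cast
  ring

theorem Wab_eq (b a : ℕ) (hb : 1 ≤ b) (ha : 1 ≤ a) :
    Wab b a = (moebius b : ℝ) * ((moebius (b * a) : ℝ) ^ 2 / (((b * a : ℕ):ℝ) * (b * a).totient)) := by
  unfold Wab
  rw [ff_apply]
  by_cases h : a.Coprime b
  · rw [if_pos h, moebius_mul_cop b a h.symm, Nat.totient_mul h.symm]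
    have hb0 : (b:ℝ) ≠ 0 := by positivity
    have ha0 : (a:ℝ) ≠ 0 := by positivity
    have h1 : (b.totient:ℝ) ≠ 0 := by exact_mod_cast (Nat.totient_pos.2 hb).ne'
    have h2 : (a.totient:ℝ) ≠ 0 := by exact_mod_cast (Nat.totient_pos.2 ha).ne'
    by_cases hs : Squarefree b
    · rw [mul_pow, moebius_sq_sqf b hs]
      push_cast
      field_simp
    · rw [moebius_not_sqf b hs]; simp
  · rw [if_neg h, moebius_not_sqf (b * a)]
    · simp
    · intro hs
      exact h (Nat.coprime_of_squarefree_mul hs).symm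

theorem Wab_sum (N : ℕ) (hN : 1 ≤ N) : ∑ b ∈ Finset.Ioc 0 N, ∑ a ∈ Finset.Ioc 0 (N / b), Wab b a = 1 := by
  have h1 : ∑ b ∈ Finset.Ioc 0 N, ∑ a ∈ Finset.Ioc 0 (N / b), Wab b a
      = ∑ c ∈ Finset.Ioc 0 N, ∑ b ∈ c.divisors, (moebius b : ℝ) * ((moebius c : ℝ) ^ 2 / ((c:ℝ) * c.totient)) := by
    rw [sum_divisors_Ioc N (fun c b => (moebius b : ℝ) * ((moebius c : ℝ) ^ 2 / ((c:ℝ) * c.totient)))]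
    refine Finset.sum_congr rfl fun b hb => Finset.sum_congr rfl fun a ha => ?_
    rw [Finset.mem_Ioc] at hb ha
    exact Wab_eq b a hb.1 ha.1
  rw [h1, Finset.sum_eq_single 1]
  · simp
  · intro c hc hc1
    rw [← Finset.sum_mul, sum_moebius_eq, if_neg hc1, zero_mul]
  · intro h; exfalso; apply h; rw [Finset.mem_Ioc]; omega

theorem harm_diff (N t : ℕ) (ht : 1 ≤ t) : |harm N - harm (N / t)| ≤ 1 + Real.log t := by
  have hle : N / t ≤ N := Nat.div_le_self N t
  have h1 : harm N - harm (N / t) = ∑ m ∈ Finset.Ioc (N / t) N, 1 / (m:ℝ) := by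
    unfold harm
    rw [← Finset.sum_Ioc_consecutive _ (Nat.zero_le (N / t)) hle]; ring
  rw [h1, abs_of_nonneg (Finset.sum_nonneg fun _ _ => by positivity)]
  have ht0 : (0:ℝ) < t := by exact_mod_cast ht
  by_cases h : 1 ≤ N / t
  · refine (sum_inv_Ioc_le _ _ h hle).trans ?_
    have h2 := half_le_div N t ht h
    have h3 : (0:ℝ) < ((N / t : ℕ):ℝ) := by exact_mod_cast h
    have hN : (0:ℝ) < N := by
      have : 0 < N := lt_of_lt_of_le h hle
      exact_mod_cast this
    have h4 : (N:ℝ) / ((N / t : ℕ):ℝ) ≤ 2 * t := by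
      rw [div_le_iff₀ ht0] at h2
      rw [div_le_iff₀ h3]; linarith
    have h5 := Real.log_le_log (by positivity) h4
    rw [Real.log_mul (by norm_num) ht0.ne'] at h5
    have := Real.log_two_lt_d9
    linarith
  · have h0 : N / t = 0 := Nat.lt_one_iff.1 (not_le.1 h)
    rw [h0]
    refine (sum_inv_le_log N).trans ?_
    rcases Nat.eq_zero_or_pos N with rfl | hN
    · simp; exact Real.log_nonneg (by exact_mod_cast ht)
    have : N < t := by
      rcases Nat.div_eq_zero_iff.1 h0 with h | h <;> omega
    have : Real.log N ≤ Real.log t := Real.log_le_log (by exact_mod_cast hN) (by exact_mod_cast this.le)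
    linarith

theorem five_sqrt (a : ℕ) (ha : 1 ≤ a) : 1 + 2 * Real.log a ≤ 5 * Real.sqrt a := by
  have ha1 : (1:ℝ) ≤ a := by exact_mod_cast ha
  have h1 : (1:ℝ) ≤ Real.sqrt a := Real.one_le_sqrt.2 ha1
  have h2 := Real.log_le_sub_one_of_pos (by linarith : 0 < Real.sqrt a)
  rw [Real.log_sqrt (by linarith)] at h2
  linarith

theorem sum_log_phi (M : ℕ) : ∑ a ∈ Finset.Ioc 0 M, (1 + 2 * Real.log a) * (1 / ((a:ℝ) * a.totient)) ≤ 15 * KK := by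
  have : 15 * KK = 5 * (KK * 3) := by ring
  rw [this]
  refine le_trans ?_ (mul_le_mul_of_nonneg_left (phiF_sum_three_half M) (by norm_num))
  rw [Finset.mul_sum]
  refine Finset.sum_le_sum fun a ha => ?_
  rw [Finset.mem_Ioc] at ha
  have ha0 : (0:ℝ) < a := by exact_mod_cast ha.1
  have h1 := inv_totient_le a ha.1
  have hs := Real.sqrt_pos.2 ha0
  have hs2 := Real.mul_self_sqrt ha0.le
  calc _ ≤ 5 * Real.sqrt a * (1 / ((a:ℝ) * a.totient)) := by
        apply mul_le_mul_of_nonneg_right (five_sqrt a ha.1) (by positivity)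
    _ = 5 * Real.sqrt a / a * (1 / (a.totient:ℝ)) := by field_simp
    _ ≤ 5 * Real.sqrt a / a * (phiF a * (1 / (a:ℝ))) := by gcongr
    _ = 5 * (phiF a * (Real.sqrt a / (a * a))) := by field_simp
    _ = _ := by
      congr 2
      rw [div_eq_div_iff (by positivity) (by positivity)]
      linear_combination (a:ℝ) * hs2

theorem VV_one_approx (N : ℕ) (hN : 1 ≤ N) : |VV 1 N - harm N| ≤ (15 * KK) ^ 2 := by
  have hK := KK_pos
  have h1 : VV 1 N - harm N = ∑ b ∈ Finset.Ioc 0 N, ∑ a ∈ Finset.Ioc 0 (N / b), Wab b a * (harm (N / b ^ 2 / a) - harm N) := by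
    have hw : harm N = (∑ b ∈ Finset.Ioc 0 N, ∑ a ∈ Finset.Ioc 0 (N / b), Wab b a) * harm N := by
      rw [Wab_sum N hN, one_mul]
    have e0 : VV 1 N - harm N = VV 1 N - (∑ b ∈ Finset.Ioc 0 N, ∑ a ∈ Finset.Ioc 0 (N / b), Wab b a) * harm N := by
      rw [← hw]
    rw [e0, VV_one_eq, Finset.sum_mul, ← Finset.sum_sub_distrib]
    refine Finset.sum_congr rfl fun b _ => ?_
    rw [Finset.sum_mul, ← Finset.sum_sub_distrib]
    refine Finset.sum_congr rfl fun a _ => by ring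
  rw [h1]
  refine (Finset.abs_sum_le_sum_abs _ _).trans ?_
  rw [sq]
  refine le_trans ?_ (mul_le_mul_of_nonneg_right (sum_log_phi N) (by positivity))
  rw [Finset.sum_mul]
  refine Finset.sum_le_sum fun b hb => ?_
  rw [Finset.mem_Ioc] at hb
  refine (Finset.abs_sum_le_sum_abs _ _).trans ?_
  have hlb : 0 ≤ Real.log b := Real.log_nonneg (by exact_mod_cast hb.1)
  refine le_trans ?_ (mul_le_mul_of_nonneg_left (sum_log_phi (N / b)) (by positivity))
  rw [Finset.mul_sum]
  refine Finset.sum_le_sum fun a ha => ?_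
  rw [Finset.mem_Ioc] at ha
  have hla : 0 ≤ Real.log a := Real.log_nonneg (by exact_mod_cast ha.1)
  have hb0 : (0:ℝ) < b := by exact_mod_cast hb.1
  have ha0 : (0:ℝ) < a := by exact_mod_cast ha.1
  have hW : |Wab b a| ≤ 1 / ((b:ℝ) * b.totient) * (1 / ((a:ℝ) * a.totient)) := by
    unfold Wab
    rw [abs_mul, abs_div, abs_div, abs_of_nonneg (by positivity : (0:ℝ) ≤ b * b.totient), abs_of_nonneg (ff_nonneg b a), abs_of_nonneg ha0.le]
    apply mul_le_mul
    · gcongr; exact abs_moebius_le b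
    · calc ff b a / a ≤ 1 / (a.totient:ℝ) / a := by gcongr; exact ff_le b a
        _ = _ := by rw [div_div, mul_comm]
    · exact div_nonneg (ff_nonneg b a) ha0.le
    · positivity
  have hd : |harm (N / b ^ 2 / a) - harm N| ≤ (1 + 2 * Real.log b) * (1 + 2 * Real.log a) := by
    rw [abs_sub_comm, Nat.div_div_eq_div_mul]
    refine (harm_diff N (b ^ 2 * a) (Nat.mul_pos (pow_pos hb.1 2) ha.1)).trans ?_
    push_cast
    rw [Real.log_mul (by positivity) (by positivity), Real.log_pow]
    push_cast
    nlinarith [mul_nonneg hla hlb]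
  rw [abs_mul]
  calc _ ≤ (1 / ((b:ℝ) * b.totient) * (1 / ((a:ℝ) * a.totient))) * ((1 + 2 * Real.log b) * (1 + 2 * Real.log a)) :=
        mul_le_mul hW hd (abs_nonneg _) (by positivity)
    _ = _ := by ring

theorem ff_one_mul (l s : ℕ) (h : l.Coprime s) : ff 1 (l * s) = ff 1 l * ff 1 s := by
  simp only [ff_apply, if_pos (Nat.coprime_one_right _)]
  rw [moebius_mul_cop l s h, Nat.totient_mul h]
  push_cast
  rw [mul_pow, mul_div_mul_comm]

theorem ff_one_not_sqf (r : ℕ) (h : ¬ Squarefree r) : ff 1 r = 0 := by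
  simp only [ff_apply, if_pos (Nat.coprime_one_right _)]
  rw [moebius_not_sqf r h]; simp

theorem VV_conv (N q : ℕ) (hq : 1 ≤ q) : VV 1 N = ∑ l ∈ q.divisors, ff 1 l * VV q (N / l) := by
  unfold VV
  rw [conv_sqf N q hq (ff 1) ff_one_not_sqf]
  refine Finset.sum_congr rfl fun l hl => ?_
  rw [Finset.mul_sum]
  refine Finset.sum_congr rfl fun s _ => ?_
  split_ifs with hs
  · have hls : l.Coprime s := (Nat.Coprime.coprime_dvd_right (Nat.dvd_of_mem_divisors hl) hs).symm
    rw [ff_one_mul l s hls]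
    congr 1
    simp only [ff_apply, if_pos (Nat.coprime_one_right _), if_pos hs]
  · rw [ff_apply q s, if_neg hs, mul_zero]

theorem VV_diff_nonneg (q N l : ℕ) : 0 ≤ VV q N - VV q (N / l) := by
  unfold VV
  rw [sub_nonneg]
  refine Finset.sum_le_sum_of_subset_of_nonneg ?_ fun i _ _ => ff_nonneg q i
  exact Finset.Ioc_subset_Ioc_right (Nat.div_le_self N l)

theorem VV_diff_le (q N l : ℕ) (hN : 1 ≤ N) (hl : 1 ≤ l) : VV q N - VV q (N / l) ≤ KK * (2 + Real.log l) := by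
  have hK := KK_pos
  have hl0 : (0:ℝ) < l := by exact_mod_cast hl
  have hN0 : (0:ℝ) < N := by exact_mod_cast hN
  have hpt : ∀ r ∈ Finset.Ioc (N / l) N, ff q r ≤ phiF r * (1 / (r:ℝ)) := by
    intro r hr
    rw [Finset.mem_Ioc] at hr
    exact (ff_le q r).trans (inv_totient_le r (Nat.lt_of_le_of_lt (Nat.zero_le _) hr.1))
  have h1 : VV q N - VV q (N / l) = ∑ r ∈ Finset.Ioc (N / l) N, ff q r := by
    unfold VV
    rw [sub_eq_iff_eq_add', Finset.sum_Ioc_consecutive _ (Nat.zero_le _) (Nat.div_le_self N l)]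
  rw [h1]
  refine (Finset.sum_le_sum hpt).trans ?_
  rcases Nat.eq_zero_or_pos (N / l) with h0 | h0
  · rw [h0]
    refine (phiF_sum_inv0 N hN).trans ?_
    have : N < l := by
      by_contra h
      have := Nat.div_pos (not_lt.1 h) hl
      omega
    have h3 : Real.log N ≤ Real.log l := Real.log_le_log hN0 (by exact_mod_cast this.le)
    apply mul_le_mul_of_nonneg_left _ hK.le
    linarith
  · refine (phiF_sum_inv (N / l) N h0 (Nat.div_le_self N l)).trans ?_
    apply mul_le_mul_of_nonneg_left _ hK.le
    have h2 := half_le_div N l hl h0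
    have h3 : (0:ℝ) < ((N / l : ℕ):ℝ) := by exact_mod_cast h0
    have h4 : (N:ℝ) / ((N / l : ℕ):ℝ) ≤ 2 * l := by
      rw [div_le_iff₀ h3]
      rw [div_le_iff₀ hl0] at h2
      linarith
    have h5 := Real.log_le_log (by positivity) h4
    rw [Real.log_mul (by norm_num) hl0.ne'] at h5
    have := Real.log_two_lt_d9
    linarith

noncomputable def vv (q : ℕ) : ℝ := ∑ p ∈ q.primeFactors, Real.log p / ((p:ℝ) - 1)

theorem vv_nonneg (q : ℕ) : 0 ≤ vv q := by
  refine Finset.sum_nonneg fun p hp => ?_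
  have := (Nat.prime_of_mem_primeFactors hp).two_le
  have h2 : (2:ℝ) ≤ p := by exact_mod_cast this
  apply div_nonneg (Real.log_nonneg (by linarith)) (by linarith)

theorem ff_one_prime_mul (p m : ℕ) (hp : p.Prime) : ff 1 (p * m) ≤ ff 1 m * (1 / ((p:ℝ) - 1)) := by
  have h2 : (2:ℝ) ≤ p := by exact_mod_cast hp.two_le
  by_cases h : p ∣ m
  · rw [ff_one_not_sqf]
    · apply mul_nonneg (ff_nonneg 1 m)
      apply div_nonneg zero_le_one; linarith
    · intro hs
      have := hs p (mul_dvd_mul_left p h)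
      exact hp.one_lt.ne' (Nat.isUnit_iff.1 this)
  · rw [ff_one_mul p m ((Nat.Prime.coprime_iff_not_dvd hp).2 h), mul_comm]
    apply le_of_eq
    congr 1
    rw [ff_apply, if_pos (Nat.coprime_one_right _), moebius_sq_sqf p hp.prime.squarefree, Nat.totient_prime hp, Nat.cast_sub hp.one_le, Nat.cast_one]

theorem sum_ff_log (q : ℕ) (hq : 1 ≤ q) : ∑ l ∈ q.divisors, ff 1 l * Real.log l ≤ (q:ℝ) / q.totient * vv q := by
  have h1 : ∀ l ∈ q.divisors, ff 1 l * Real.log l = ∑ p ∈ q.primeFactors, if p ∣ l then ff 1 l * Real.log p else 0 := by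
    intro l hl
    have hlq := Nat.dvd_of_mem_divisors hl
    by_cases hs : Squarefree l
    · rw [← Finset.sum_filter]
      have : q.primeFactors.filter (fun p => p ∣ l) = l.primeFactors := by
        ext p
        simp only [Finset.mem_filter, Nat.mem_primeFactors]
        constructor
        · rintro ⟨⟨a, b, c⟩, d⟩; exact ⟨a, d, hs.ne_zero⟩
        · rintro ⟨a, b, c⟩; exact ⟨⟨a, b.trans hlq, by omega⟩, b⟩
      rw [this, ← Finset.mul_sum, ← Real.log_prod]
      · congr 2
        rw [← Nat.cast_prod, Nat.prod_primeFactors_of_squarefree hs]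
      · intro p hp
        have := (Nat.prime_of_mem_primeFactors hp).pos
        positivity
    · rw [ff_one_not_sqf l hs]; simp
  rw [Finset.sum_congr rfl h1, Finset.sum_comm]
  unfold vv
  rw [Finset.mul_sum]
  refine Finset.sum_le_sum fun p hp => ?_
  have hpp := Nat.prime_of_mem_primeFactors hp
  have h2 : (2:ℝ) ≤ p := by exact_mod_cast hpp.two_le
  have hlog : 0 ≤ Real.log p := Real.log_nonneg (by linarith)
  rw [← Finset.sum_filter, ← Finset.sum_mul]
  have hsub : q.divisors.filter (fun l => p ∣ l) ⊆ q.divisors.image (fun m => p * m) := by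
    intro l hl
    rw [Finset.mem_filter, Nat.mem_divisors] at hl
    obtain ⟨⟨ha, hb⟩, m, rfl⟩ := hl
    exact Finset.mem_image.2 ⟨m, Nat.mem_divisors.2 ⟨(dvd_mul_left m p).trans ha, hb⟩, rfl⟩
  have h3 : ∑ l ∈ q.divisors.filter (fun l => p ∣ l), ff 1 l ≤ (q:ℝ) / q.totient * (1 / ((p:ℝ) - 1)) := by
    refine (Finset.sum_le_sum_of_subset_of_nonneg hsub fun i _ _ => ff_nonneg 1 i).trans ?_
    rw [Finset.sum_image (fun a _ b _ h => Nat.eq_of_mul_eq_mul_left hpp.pos h), ← sum_ff_one q hq, Finset.sum_mul]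
    exact Finset.sum_le_sum fun m _ => ff_one_prime_mul p m hpp
  calc _ ≤ (q:ℝ) / q.totient * (1 / ((p:ℝ) - 1)) * Real.log p := mul_le_mul_of_nonneg_right h3 hlog
    _ = _ := by ring

theorem VV_q_approx (q N : ℕ) (hq : 1 ≤ q) (hN : 1 ≤ N) :
    |(q:ℝ) / q.totient * VV q N - VV 1 N| ≤ KK * ((q:ℝ) / q.totient) * (2 + vv q) := by
  have hK := KK_pos
  have h1 : (q:ℝ) / q.totient * VV q N - VV 1 N = ∑ l ∈ q.divisors, ff 1 l * (VV q N - VV q (N / l)) := by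
    rw [VV_conv N q hq, ← sum_ff_one q hq, Finset.sum_mul, ← Finset.sum_sub_distrib]
    exact Finset.sum_congr rfl fun l _ => by ring
  rw [h1, abs_of_nonneg (Finset.sum_nonneg fun l _ => mul_nonneg (ff_nonneg 1 l) (VV_diff_nonneg q N l))]
  calc _ ≤ ∑ l ∈ q.divisors, ff 1 l * (KK * (2 + Real.log l)) := by
        refine Finset.sum_le_sum fun l hl => mul_le_mul_of_nonneg_left ?_ (ff_nonneg 1 l)
        exact VV_diff_le q N l hN (Nat.pos_of_mem_divisors hl)
    _ = KK * (2 * ∑ l ∈ q.divisors, ff 1 l + ∑ l ∈ q.divisors, ff 1 l * Real.log l) := by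
        rw [mul_add, Finset.mul_sum, Finset.mul_sum, Finset.mul_sum, ← Finset.sum_add_distrib]
        exact Finset.sum_congr rfl fun l _ => by ring
    _ ≤ KK * (2 * ((q:ℝ) / q.totient) + (q:ℝ) / q.totient * vv q) := by
        rw [sum_ff_one q hq]
        apply mul_le_mul_of_nonneg_left _ hK.le
        linarith [sum_ff_log q hq]
    _ = _ := by ring

theorem harm_log (N : ℕ) (hN : 1 ≤ N) : |harm N - Real.log N| ≤ 1 := by
  have e : harm N = ((harmonic N : ℚ) : ℝ) := by
    rw [harmonic_eq_sum_Icc]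
    unfold harm
    push_cast
    exact Finset.sum_congr rfl fun i _ => by rw [one_div]
  rw [e, abs_le]
  have h1 := harmonic_le_one_add_log N
  have h2 := log_add_one_le_harmonic N
  have hN0 : (0:ℝ) < N := by exact_mod_cast hN
  have h3 : Real.log N ≤ Real.log ((N + 1 : ℕ):ℝ) := Real.log_le_log hN0 (by push_cast; linarith)
  constructor <;> linarith

theorem log_floor (h q : ℕ) (hq : 1 ≤ q) (hqh : q ≤ h) :
    |Real.log ((h / q : ℕ):ℝ) - Real.log ((h:ℝ) / q)| ≤ 1 := by
  have hq0 : (0:ℝ) < q := by exact_mod_cast hq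
  have h0 : 1 ≤ h / q := Nat.div_pos hqh hq
  have h3 : (0:ℝ) < ((h / q : ℕ):ℝ) := by exact_mod_cast h0
  have h1 := half_le_div h q hq h0
  have h2 : ((h / q : ℕ):ℝ) ≤ (h:ℝ) / q := Nat.cast_div_le
  have h4 := Real.log_le_log h3 h2
  have h5 := Real.log_le_log (lt_of_lt_of_le h3 h2) h1
  rw [Real.log_mul (by norm_num) h3.ne'] at h5
  have := Real.log_two_lt_d9
  rw [abs_le]; constructor <;> linarith

theorem AVV_approx : ∃ C : ℝ, 0 < C ∧ ∀ q h : ℕ, 1 ≤ q → q ≤ h →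
    |(q:ℝ) / q.totient * VV q (h / q) - Real.log ((h:ℝ) / q)| ≤ C * ((q:ℝ) / q.totient * (1 + vv q)) := by
  have hK := KK_pos
  refine ⟨2 * KK + (15 * KK) ^ 2 + 2, by positivity, fun q h hq hqh => ?_⟩
  have h0 : 1 ≤ h / q := Nat.div_pos hqh hq
  have a1 := VV_q_approx q (h / q) hq h0
  have a2 := VV_one_approx (h / q) h0
  have a3 := harm_log (h / q) h0
  have a4 := log_floor h q hq hqh
  have hA := one_le_nphi q hq
  have hv := vv_nonneg q
  have t : |(q:ℝ) / q.totient * VV q (h / q) - Real.log ((h:ℝ) / q)| ≤ KK * ((q:ℝ) / q.totient) * (2 + vv q) + (15 * KK) ^ 2 + 1 + 1 := by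
    rw [abs_le] at *
    constructor <;> linarith [a1.1, a1.2, a2.1, a2.2, a3.1, a3.2, a4.1, a4.2]
  refine t.trans ?_
  set A := (q:ℝ) / q.totient
  have hAv : 1 ≤ A * (1 + vv q) := by nlinarith
  have : KK * A * (2 + vv q) ≤ 2 * KK * (A * (1 + vv q)) := by
    have : 0 ≤ KK * A * vv q := by positivity
    nlinarith
  nlinarith [sq_nonneg (15 * KK)]

noncomputable def dyP (k : ℕ) : Finset ℕ := (Finset.Ioc (2 ^ k) (2 ^ (k + 1))).filter Nat.Prime

theorem dyP_card (k : ℕ) : k * (dyP k).card ≤ 2 ^ (k + 1) := by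
  have h1 : ∏ p ∈ dyP k, p ∣ (2 ^ k).centralBinom := by
    apply Finset.prod_primes_dvd
    · intro p hp
      exact (Finset.mem_filter.1 hp).2.prime
    · intro p hp
      have hp' := Finset.mem_filter.1 hp
      have h3 := Finset.mem_Ioc.1 hp'.1
      rw [Nat.centralBinom_eq_two_mul_choose]
      apply hp'.2.dvd_choose h3.1
      · have : 2 * 2 ^ k - 2 ^ k = 2 ^ k := by omega
        rw [this]; exact h3.1
      · have := h3.2
        rw [pow_succ] at this
        omega
  have h2 : (2 ^ k) ^ (dyP k).card ≤ ∏ p ∈ dyP k, p := by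
    rw [← Finset.prod_const]
    apply Finset.prod_le_prod' 
    intro p hp
    exact (Finset.mem_Ioc.1 (Finset.mem_filter.1 hp).1).1.le
  have h3 := Nat.le_of_dvd (Nat.centralBinom_pos _) h1
  have h4 := Nat.centralBinom_le_four_pow (2 ^ k)
  have h5 : (2:ℕ) ^ (k * (dyP k).card) ≤ 2 ^ (2 ^ (k + 1)) := by
    calc 2 ^ (k * (dyP k).card) = (2 ^ k) ^ (dyP k).card := by rw [pow_mul]
      _ ≤ 4 ^ (2 ^ k) := h2.trans (h3.trans h4)
      _ = 2 ^ (2 ^ (k + 1)) := by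
        rw [pow_succ 2 k, mul_comm, pow_mul]
        norm_num
  exact (Nat.pow_le_pow_iff_right (by norm_num)).1 h5

theorem dyP_sum (k : ℕ) (g : ℕ → ℝ) (B : ℝ) (hB : 0 ≤ B) (hg : ∀ p ∈ dyP (k + 1), g p ≤ B / 2 ^ (k + 1)) :
    ∑ p ∈ dyP (k + 1), g p ≤ 2 * B / ((k:ℝ) + 1) := by
  have h1 := Finset.sum_le_card_nsmul _ _ _ hg
  refine h1.trans ?_
  have h2 : ((k + 1 : ℕ):ℝ) * ((dyP (k + 1)).card : ℝ) ≤ (2:ℝ) ^ (k + 1 + 1) := by exact_mod_cast dyP_card (k + 1)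
  push_cast at h2
  rw [nsmul_eq_mul, mul_div_assoc', div_le_div_iff₀ (by positivity) (by positivity)]
  have h3 : (2:ℝ) ^ (k + 1 + 1) = 2 * 2 ^ (k + 1) := by ring
  rw [h3] at h2
  nlinarith [mul_le_mul_of_nonneg_right h2 hB]

noncomputable def smP (K : ℕ) : Finset ℕ := (Finset.Ioc 0 (2 ^ (K + 1))).filter Nat.Prime

theorem smP_zero : smP 0 = {2} := by
  unfold smP
  ext p
  simp only [Finset.mem_filter, Finset.mem_Ioc, Finset.mem_singleton]
  constructor
  · rintro ⟨⟨a, b⟩, c⟩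
    have := c.two_le
    norm_num at b
    omega
  · rintro rfl; exact ⟨⟨by norm_num, by norm_num⟩, Nat.prime_two⟩

theorem smP_succ (K : ℕ) (g : ℕ → ℝ) : ∑ p ∈ smP (K + 1), g p = ∑ p ∈ smP K, g p + ∑ p ∈ dyP (K + 1), g p := by
  unfold smP dyP
  simp only [Finset.sum_filter]
  rw [Finset.sum_Ioc_consecutive _ (Nat.zero_le _) (Nat.pow_le_pow_right (by norm_num) (by omega))]

theorem smP_inv (K : ℕ) : ∑ p ∈ smP K, 1 / (p:ℝ) ≤ 1 / 2 + 2 * harm K := by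
  induction K with
  | zero => rw [smP_zero]; simp [harm]
  | succ K ih =>
    rw [smP_succ]
    have h1 := dyP_sum K (fun p => 1 / (p:ℝ)) 1 zero_le_one (by
      intro p hp
      have := (Finset.mem_Ioc.1 (Finset.mem_filter.1 hp).1).1
      have h2 : (2:ℝ) ^ (K + 1) ≤ p := by exact_mod_cast this.le
      exact one_div_le_one_div_of_le (by positivity) h2)
    have h2 : harm (K + 1) = harm K + 1 / ((K:ℝ) + 1) := by
      unfold harm
      rw [Finset.sum_Ioc_succ_top (Nat.zero_le _)]
      push_cast; rfl
    rw [h2]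
    have : 2 * 1 / ((K:ℝ) + 1) = 2 * (1 / ((K:ℝ) + 1)) := by ring
    linarith

theorem smP_log (K : ℕ) : ∑ p ∈ smP K, Real.log p / (p:ℝ) ≤ 3 * ((K:ℝ) + 1) := by
  have hl2 := Real.log_two_lt_d9
  have hl0 : 0 < Real.log 2 := Real.log_pos (by norm_num)
  induction K with
  | zero => rw [smP_zero]; simp; linarith
  | succ K ih =>
    rw [smP_succ]
    have h1 := dyP_sum K (fun p => Real.log p / (p:ℝ)) (((K:ℝ) + 2) * Real.log 2) (by positivity) (by
      intro p hp
      have h3 := Finset.mem_Ioc.1 (Finset.mem_filter.1 hp).1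
      have h2 : (2:ℝ) ^ (K + 1) ≤ p := by exact_mod_cast h3.1.le
      have h4 : (p:ℝ) ≤ (2:ℝ) ^ (K + 1 + 1) := by exact_mod_cast h3.2
      have hp0 : (0:ℝ) < p := lt_of_lt_of_le (by positivity) h2
      have h5 := Real.log_le_log hp0 h4
      rw [Real.log_pow] at h5
      push_cast at h5
      apply div_le_div₀ (by positivity) _ (by positivity) h2
      linarith)
    have h3 : 2 * (((K:ℝ) + 2) * Real.log 2) / ((K:ℝ) + 1) ≤ 3 := by
      rw [div_le_iff₀ (by positivity)]
      nlinarith [(Nat.cast_nonneg K : (0:ℝ) ≤ K)]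
    push_cast
    linarith

theorem sum_log_pf (q : ℕ) (hq : 1 ≤ q) : ∑ p ∈ q.primeFactors, Real.log p ≤ Real.log q := by
  rw [← Real.log_prod]
  · rw [← Nat.cast_prod]
    apply Real.log_le_log
    · exact_mod_cast Nat.pos_of_dvd_of_pos (Nat.prod_primeFactors_dvd q) hq
    · exact_mod_cast Nat.le_of_dvd hq (Nat.prod_primeFactors_dvd q)
  · intro p hp
    have := (Nat.prime_of_mem_primeFactors hp).pos
    positivity

/-- generic split of a sum over prime factors -/
theorem pf_split (q K : ℕ) (hq : 1 ≤ q) (hK : Real.log (3 * q) ≤ 2 ^ (K + 1)) (g : ℕ → ℝ) (c : ℝ) (hc : 0 ≤ c)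
    (hg : ∀ p, p.Prime → 0 ≤ g p) (hg2 : ∀ p, p.Prime → g p ≤ c * Real.log p / p) :
    ∑ p ∈ q.primeFactors, g p ≤ ∑ p ∈ smP K, g p + c := by
  have hq0 : (1:ℝ) ≤ q := by exact_mod_cast hq
  have hlq : 0 ≤ Real.log q := Real.log_nonneg hq0
  have hL : Real.log q ≤ Real.log (3 * q) := Real.log_le_log (by linarith) (by linarith)
  rw [← Finset.sum_filter_add_sum_filter_not _ (fun p => p ≤ 2 ^ (K + 1))]
  apply add_le_add
  · refine Finset.sum_le_sum_of_subset_of_nonneg ?_ ?_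
    · intro p hp
      rw [Finset.mem_filter] at hp
      have := Nat.prime_of_mem_primeFactors hp.1
      exact Finset.mem_filter.2 ⟨Finset.mem_Ioc.2 ⟨this.pos, hp.2⟩, this⟩
    · intro p hp _
      exact hg p (Finset.mem_filter.1 hp).2
  · calc _ ≤ ∑ p ∈ q.primeFactors.filter (fun p => ¬ p ≤ 2 ^ (K + 1)), c / 2 ^ (K + 1) * Real.log p := by
          refine Finset.sum_le_sum fun p hp => ?_
          rw [Finset.mem_filter, not_le] at hp
          have hpp := Nat.prime_of_mem_primeFactors hp.1
          have h2 : (2:ℝ) ^ (K + 1) ≤ p := by exact_mod_cast hp.2.le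
          have hl : 0 ≤ Real.log p := Real.log_nonneg (by exact_mod_cast hpp.one_le)
          refine (hg2 p hpp).trans ?_
          rw [mul_div_right_comm]
          gcongr
      _ ≤ ∑ p ∈ q.primeFactors, c / 2 ^ (K + 1) * Real.log p := by
          refine Finset.sum_le_sum_of_subset_of_nonneg (Finset.filter_subset _ _) ?_
          intro p hp _
          have hl : 0 ≤ Real.log p := Real.log_nonneg (by exact_mod_cast (Nat.prime_of_mem_primeFactors hp).one_le)
          positivity
      _ = c / 2 ^ (K + 1) * ∑ p ∈ q.primeFactors, Real.log p := by rw [Finset.mul_sum]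
      _ ≤ c / 2 ^ (K + 1) * 2 ^ (K + 1) := by
          gcongr
          exact (sum_log_pf q hq).trans (hL.trans hK)
      _ = c := by field_simp

theorem vv_le (q K : ℕ) (hq : 1 ≤ q) (hK : Real.log (3 * q) ≤ 2 ^ (K + 1)) : vv q ≤ 8 * ((K:ℝ) + 1) := by
  have h1 := pf_split q K hq hK (fun p => Real.log p / p) 1 zero_le_one (by
    intro p hp
    have hl : 0 ≤ Real.log p := Real.log_nonneg (by exact_mod_cast hp.one_le)
    positivity) (by intro p _; rw [one_mul])
  have h2 := smP_log K
  have h3 : vv q ≤ 2 * ∑ p ∈ q.primeFactors, Real.log p / p := by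
    unfold vv
    rw [Finset.mul_sum]
    refine Finset.sum_le_sum fun p hp => ?_
    have hpp := Nat.prime_of_mem_primeFactors hp
    have h2 : (2:ℝ) ≤ p := by exact_mod_cast hpp.two_le
    have hl : 0 ≤ Real.log p := Real.log_nonneg (by linarith)
    rw [mul_div_assoc', div_le_div_iff₀ (by linarith) (by linarith)]
    nlinarith
  have : (0:ℝ) ≤ K := Nat.cast_nonneg K
  linarith

theorem sum_telesc (M : ℕ) : ∑ n ∈ Finset.Ioc 1 (M + 1), (1 / ((n:ℝ) - 1) - 1 / n) = 1 - 1 / ((M:ℝ) + 1) := by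
  induction M with
  | zero => simp
  | succ M ih =>
    rw [Finset.sum_Ioc_succ_top (by omega), ih]
    push_cast
    have : (M:ℝ) + 1 + 1 - 1 = M + 1 := by ring
    rw [this]; ring

theorem nphi_le_exp (q K : ℕ) (hq : 1 ≤ q) (hK : Real.log (3 * q) ≤ 2 ^ (K + 1)) :
    (q:ℝ) / q.totient ≤ Real.exp 6 * ((K:ℝ) + 1) ^ 2 := by
  have hq0 : (0:ℝ) < q := by exact_mod_cast hq
  have h1 : (q:ℝ) / q.totient = ∏ p ∈ q.primeFactors, (1 - (p:ℝ)⁻¹)⁻¹ := by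
    rw [totient_prod_real q, Finset.prod_inv_distrib, ← div_div, div_self hq0.ne', one_div]
  have h2 : (q:ℝ) / q.totient ≤ Real.exp (∑ p ∈ q.primeFactors, 1 / ((p:ℝ) - 1)) := by
    rw [h1, Real.exp_sum]
    apply Finset.prod_le_prod
    · intro p hp
      have h2 : (2:ℝ) ≤ p := by exact_mod_cast (Nat.prime_of_mem_primeFactors hp).two_le
      have : (p:ℝ)⁻¹ ≤ 1 := inv_le_one_of_one_le₀ (by linarith)
      apply inv_nonneg.2; linarith
    · intro p hp
      have h2 : (2:ℝ) ≤ p := by exact_mod_cast (Nat.prime_of_mem_primeFactors hp).two_le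
      have h3 := Real.add_one_le_exp (1 / ((p:ℝ) - 1))
      refine le_trans (le_of_eq ?_) h3
      have : (p:ℝ) - 1 ≠ 0 := by linarith
      have : (p:ℝ) ≠ 0 := by linarith
      field_simp
      ring
  have h3 := pf_split q K hq hK (fun p => 1 / (p:ℝ)) (3 / 2) (by norm_num) (by intro p _; positivity) (by
    intro p hp
    have h2 : (2:ℝ) ≤ p := by exact_mod_cast hp.two_le
    have h4 : Real.log 2 ≤ Real.log p := Real.log_le_log (by norm_num) h2
    have := Real.log_two_gt_d9
    gcongr
    linarith)
  have h4 := smP_inv K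
  have h5 : ∑ p ∈ q.primeFactors, (1 / ((p:ℝ) - 1) - 1 / p) ≤ 1 := by
    refine le_trans (Finset.sum_le_sum_of_subset_of_nonneg (t := Finset.Ioc 1 (q + 1)) ?_ ?_) ?_
    · intro p hp
      have := Nat.prime_of_mem_primeFactors hp
      have h6 := Nat.le_of_dvd hq (Nat.dvd_of_mem_primeFactors hp)
      exact Finset.mem_Ioc.2 ⟨this.one_lt, by omega⟩
    · intro n hn _
      have h2 : (2:ℝ) ≤ n := by exact_mod_cast (Finset.mem_Ioc.1 hn).1
      rw [sub_nonneg]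
      exact one_div_le_one_div_of_le (by linarith) (by linarith)
    · rw [sum_telesc]
      have : 0 ≤ 1 / ((q:ℝ) + 1) := by positivity
      linarith
  rw [Finset.sum_sub_distrib] at h5
  have h6 : harm K ≤ 1 + Real.log ((K:ℝ) + 1) := by
    rcases Nat.eq_zero_or_pos K with rfl | hKp
    · simp [harm]
    · have a := (abs_le.1 (harm_log K hKp)).2
      have hK0 : (0:ℝ) < K := by exact_mod_cast hKp
      have : Real.log K ≤ Real.log ((K:ℝ) + 1) := Real.log_le_log hK0 (by linarith)
      linarith
  refine h2.trans ?_
  have hKp : (0:ℝ) < (K:ℝ) + 1 := by positivity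
  have h7 : Real.exp 6 * ((K:ℝ) + 1) ^ 2 = Real.exp (6 + 2 * Real.log ((K:ℝ) + 1)) := by
    rw [Real.exp_add, two_mul, Real.exp_add, Real.exp_log hKp, sq]
  rw [h7]
  apply Real.exp_le_exp.2
  linarith

theorem loglog_ge (q : ℕ) (hq : 1 ≤ q) : (0.089:ℝ) ≤ Real.log (Real.log (3 * q)) := by
  have hq0 : (1:ℝ) ≤ q := by exact_mod_cast hq
  have h1 : Real.log 3 ≤ Real.log (3 * q) := Real.log_le_log (by norm_num) (by linarith)
  have h2 := Real.log_three_gt_d9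
  have h3 : Real.log 1.0986 ≤ Real.log (Real.log (3 * q)) := Real.log_le_log (by norm_num) (by linarith)
  have h4 := Real.one_sub_inv_le_log_of_pos (show (0:ℝ) < 1.0986 by norm_num)
  norm_num at h4 h3 ⊢
  linarith

theorem nphi_vv_bound : ∃ C : ℝ, 0 < C ∧ ∀ q : ℕ, 1 ≤ q →
    (q:ℝ) / q.totient * (1 + vv q) ≤ C * (Real.log (Real.log (3 * q))) ^ 3 := by
  refine ⟨Real.exp 6 * 9 * 13 ^ 3, by positivity, fun q hq => ?_⟩
  have hll := loglog_ge q hq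
  set ll := Real.log (Real.log (3 * q)) with hlldef
  have hq0 : (1:ℝ) ≤ q := by exact_mod_cast hq
  have hLpos : 0 < Real.log (3 * q) := Real.log_pos (by linarith)
  have hl2 := Real.log_two_gt_d9
  have hl0 : 0 < Real.log 2 := Real.log_pos (by norm_num)
  set K := ⌊ll / Real.log 2⌋₊ with hKdef
  have hK1 : ll / Real.log 2 < K + 1 := Nat.lt_floor_add_one _
  have hK2 : (K:ℝ) ≤ ll / Real.log 2 := Nat.floor_le (by positivity)
  have hK : Real.log (3 * q) ≤ 2 ^ (K + 1) := by
    rw [div_lt_iff₀ hl0] at hK1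
    have : Real.log (Real.log (3 * q)) ≤ Real.log ((2:ℝ) ^ (K + 1)) := by
      rw [Real.log_pow]; push_cast; exact hK1.le
    exact (Real.log_le_log_iff hLpos (by positivity)).1 this
  have h1 := nphi_le_exp q K hq hK
  have h2 := vv_le q K hq hK
  have h3 : (K:ℝ) + 1 ≤ 13 * ll := by
    have : ll / Real.log 2 ≤ 1.45 * ll := by
      rw [div_le_iff₀ hl0]
      nlinarith
    linarith
  have hK0 : (0:ℝ) ≤ K := Nat.cast_nonneg K
  have hv := vv_nonneg q
  calc (q:ℝ) / q.totient * (1 + vv q) ≤ (Real.exp 6 * ((K:ℝ) + 1) ^ 2) * (9 * ((K:ℝ) + 1)) := by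
        apply mul_le_mul h1 (by linarith) (by linarith) (by positivity)
    _ = Real.exp 6 * 9 * ((K:ℝ) + 1) ^ 3 := by ring
    _ ≤ Real.exp 6 * 9 * (13 * ll) ^ 3 := by gcongr
    _ = _ := by ring

set_option maxHeartbeats 2000000 in
theorem assembly (hG : GRH) : ∃ C : ℝ, 0 < C ∧ ∀ (x R : ℝ) (q h a : ℕ),
      2 ≤ x → 2 ≤ R → 1 ≤ q → q ≤ h → (h : ℝ) ≤ x → (q : ℝ) * R ≤ x →
      Nat.gcd a q = 1 →
      |Ssum x R q h a
        - x * (h : ℝ) ^ 2 / (q.totient : ℝ) ^ 2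
        + (x * h / (q.totient : ℝ)) * Real.log ((h : ℝ) / q)|
      ≤ C * ((x * h / (q.totient : ℝ)) * (Real.log (Real.log (3 * q))) ^ 3
          + (x * (h : ℝ) ^ 2 * (q.divisors.card : ℝ) / ((q.totient : ℝ) ^ 2 * R))
              * Real.log (2 * h / q)
          + Real.sqrt x * (h : ℝ) ^ ((3 : ℝ) / 2) * R * (Real.log x) ^ 2 / Real.sqrt q
          + Real.sqrt x * (h : ℝ) ^ 2 * Real.sqrt R * (Real.log x) ^ 2 / q) := by
  obtain ⟨C1, hC1, H1⟩ := S_reduction hG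
  obtain ⟨C2, hC2, H2⟩ := AVV_approx
  obtain ⟨C3, hC3, H3⟩ := nphi_vv_bound
  have hK := KK_pos
  refine ⟨C1 + (C2 * C3 + 28 * KK ^ 2 * C3) + 96 * KK ^ 2, by positivity, ?_⟩
  intro x R q h a hx hR hq hqh hhx hqR hgcd
  have B1 := H1 x R q h a hx hR hq hhx hqR hgcd
  have B2 := M0_approx R q h hR hq hqh
  have B3 := H2 q h hq hqh
  have B4 := H3 q hq
  have hx0 : (0:ℝ) < x := by linarith
  have hR0 : (0:ℝ) < R := by linarith
  have hq0 : (0:ℝ) < q := by exact_mod_cast hq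
  have hh0 : (0:ℝ) < h := by exact_mod_cast (lt_of_lt_of_le hq hqh)
  have hphi : (0:ℝ) < q.totient := by exact_mod_cast Nat.totient_pos.2 hq
  have hv := vv_nonneg q
  have hA := one_le_nphi q hq
  have hll := loglog_ge q hq
  set F : ℝ := (q.totient:ℝ) with hF
  set A : ℝ := (q:ℝ) / F with hAdef
  set LL : ℝ := Real.log (Real.log (3 * q)) with hLL
  set N : ℕ := h / q with hN
  set D : ℝ := (q.divisors.card : ℝ) with hD
  set lh : ℝ := Real.log ((h:ℝ) / q) with hlh
  have hD0 : 0 ≤ D := Nat.cast_nonneg _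
  set P : ℝ := x * h / F with hP
  have hP0 : 0 < P := by positivity
  set Q : ℝ := x * (h : ℝ) ^ 2 * D / (F ^ 2 * R) with hQ
  have hQ0 : 0 ≤ Q := by positivity
  -- logs
  have hN1 : 1 ≤ N := Nat.div_pos hqh hq
  have hlN : 1 + Real.log (N:ℝ) ≤ 3 * Real.log (2 * h / q) := by
    have e1 : (N:ℝ) ≤ (h:ℝ) / q := Nat.cast_div_le
    have hNr : (0:ℝ) < N := by exact_mod_cast hN1
    have e2 := Real.log_le_log hNr e1
    have e3 : 0 ≤ Real.log ((h:ℝ) / q) := by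
      apply Real.log_nonneg
      rw [le_div_iff₀ hq0, one_mul]; exact_mod_cast hqh
    have e4 : Real.log (2 * h / q) = Real.log 2 + Real.log ((h:ℝ) / q) := by
      rw [mul_div_assoc, Real.log_mul (by norm_num) (by positivity)]
    rw [e4]
    have := Real.log_two_gt_d9
    linarith
  set L2 : ℝ := Real.log (2 * h / q) with hL2
  have hL20 : 0 ≤ L2 := by
    have : 0 ≤ Real.log (N:ℝ) := Real.log_nonneg (by exact_mod_cast hN1)
    linarith
  -- last terms
  set T3 : ℝ := Real.sqrt x * (h : ℝ) ^ ((3 : ℝ) / 2) * R * (Real.log x) ^ 2 / Real.sqrt q with hT3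
  set T4 : ℝ := Real.sqrt x * (h : ℝ) ^ 2 * Real.sqrt R * (Real.log x) ^ 2 / q with hT4
  have hT30 : 0 ≤ T3 := by positivity
  have hT40 : 0 ≤ T4 := by positivity
  have hE : (h:ℝ) * (Real.sqrt x * (Real.log x) ^ 2 * ((h / q : ℝ) * Real.sqrt R + Real.sqrt (h / q : ℝ) * R)) = T3 + T4 := by
    have e1 : (h:ℝ) ^ ((3:ℝ) / 2) = h * Real.sqrt h := by
      rw [show (3:ℝ) / 2 = 1 + 1 / 2 by norm_num, Real.rpow_add hh0, Real.rpow_one, Real.sqrt_eq_rpow]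
    rw [hT3, hT4, e1, Real.sqrt_div hh0.le]
    ring
  rw [hE] at B1
  have B2' : |2 * (x / F * M0 R q h) - (x * (h:ℝ) ^ 2 / F ^ 2 - P * (A * VV q N))| ≤ 28 * KK ^ 2 * P * A + 96 * KK ^ 2 * (Q * L2) := by
    have e1 : 2 * (x / F * M0 R q h) - (x * (h:ℝ) ^ 2 / F ^ 2 - P * (A * VV q N))
        = 2 * (x / F) * (M0 R q h - ((h:ℝ) ^ 2 / (2 * F) - A * (h / 2) * VV q N)) := by
      rw [hP]; field_simp
    rw [e1, abs_mul, abs_of_pos (by positivity)]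
    calc _ ≤ 2 * (x / F) * (14 * KK ^ 2 * h * A + 16 * KK ^ 2 * (h:ℝ) ^ 2 * D / (F * R) * (1 + Real.log (N:ℝ))) := by gcongr
      _ ≤ 2 * (x / F) * (14 * KK ^ 2 * h * A + 16 * KK ^ 2 * (h:ℝ) ^ 2 * D / (F * R) * (3 * L2)) := by gcongr
      _ = _ := by rw [hP, hQ]; field_simp; ring
  have B3' : |P * (A * VV q N) - P * lh| ≤ C2 * C3 * (P * LL ^ 3) := by
    rw [← mul_sub, abs_mul, abs_of_pos hP0]
    calc _ ≤ P * (C2 * (A * (1 + vv q))) := by gcongr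
      _ ≤ P * (C2 * (C3 * LL ^ 3)) := by gcongr
      _ = _ := by ring
  have B5 : 28 * KK ^ 2 * P * A ≤ 28 * KK ^ 2 * C3 * (P * LL ^ 3) := by
    have : A ≤ C3 * LL ^ 3 := by nlinarith
    calc _ ≤ 28 * KK ^ 2 * P * (C3 * LL ^ 3) := by gcongr
      _ = _ := by ring
  have tot : |Ssum x R q h a - x * (h : ℝ) ^ 2 / F ^ 2 + P * lh|
      ≤ C1 * (T3 + T4) + (28 * KK ^ 2 * C3 * (P * LL ^ 3) + 96 * KK ^ 2 * (Q * L2)) + C2 * C3 * (P * LL ^ 3) := by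
    rw [abs_le] at B1 B2' B3' ⊢
    constructor <;> linarith [B1.1, B1.2, B2'.1, B2'.2, B3'.1, B3'.2]
  refine tot.trans ?_
  have hU : 0 ≤ P * LL ^ 3 := by positivity
  have hV : 0 ≤ Q * L2 := by positivity
  have hW : 0 ≤ T3 + T4 := by positivity
  have hc1 : 0 ≤ C2 * C3 + 28 * KK ^ 2 * C3 := by positivity
  have hc2 : 0 ≤ 96 * KK ^ 2 := by positivity
  nlinarith [mul_nonneg hC1.le hU, mul_nonneg hC1.le hV, mul_nonneg hc1 hV, mul_nonneg hc1 hW, mul_nonneg hc2 hU, mul_nonneg hc2 hW]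

theorem prop2_correlation_sum (hGRH : GRH) :
    ∃ C : ℝ, 0 < C ∧ ∀ (x R : ℝ) (q h a : ℕ),
      2 ≤ x → 2 ≤ R → 1 ≤ q → q ≤ h → (h : ℝ) ≤ x → (q : ℝ) * R ≤ x →
      Nat.gcd a q = 1 →
      |(∑ k ∈ (Finset.Icc 1 h).filter (fun k => q ∣ k),
          ∑ n ∈ (Finset.Ioc ⌊x⌋₊ ⌊2 * x + h - k⌋₊).filter
              (fun n : ℕ => (n : ZMod q) = (a : ZMod q)),
            (ArithmeticFunction.vonMangoldt n * lamR R (n + k)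
              + ArithmeticFunction.vonMangoldt (n + k) * lamR R n)
              * flen n x ((h : ℝ) - k))
        - x * (h : ℝ) ^ 2 / (q.totient : ℝ) ^ 2
        + (x * h / (q.totient : ℝ)) * Real.log ((h : ℝ) / q)|
      ≤ C * ((x * h / (q.totient : ℝ)) * (Real.log (Real.log (3 * q))) ^ 3
          + (x * (h : ℝ) ^ 2 * (q.divisors.card : ℝ) / ((q.totient : ℝ) ^ 2 * R))
              * Real.log (2 * h / q)
          + Real.sqrt x * (h : ℝ) ^ ((3 : ℝ) / 2) * R * (Real.log x) ^ 2 / Real.sqrt q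
          + Real.sqrt x * (h : ℝ) ^ 2 * Real.sqrt R * (Real.log x) ^ 2 / q) := by
  exact assembly hGRH
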